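/- Let N ≥ 2 and 1 < p < N*, where N* = (N+2)/(N−2) if N ≥ 3 and N* = ∞ if N = 2. Set νₖ = k(k + N − 1) and λₖ = νₖ/(p−1) for k ≥ 1. Then for each integer k ≥ 1 and each λ with λₖ < λ ≤ λ_{k+1}, there exist k distinct non-constant positive functions v₁, …, vₖ ∈ C²(S^N) solving −Δ_{S^N} v = v^p − λ v on S^N, such that for each 1 ≤ j ≤ k: vⱼ is axially symmetric, i.e. vⱼ(θ) = ṽⱼ(θ_{N+1}) for some function ṽⱼ on [−1,1], and the function t ↦ ṽⱼ(t) − λ^{1/(p−1)} has exactly j zeros, all of which lie in (−1,1) and all of which are simple (its derivative is nonzero at each zero). -/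

import Mathlib

open scoped BigOperators

/-- The Euclidean Laplacian of `u : ℝᵐ → ℝ` at `x`, as the sum of the pure second
derivatives in the standard coordinate directions. -/
noncomputable def eLaplacian {m : ℕ} (u : EuclideanSpace ℝ (Fin m) → ℝ)
    (x : EuclideanSpace ℝ (Fin m)) : ℝ :=
  ∑ i : Fin m, iteratedFDeriv ℝ 2 u x ![EuclideanSpace.single i 1, EuclideanSpace.single i 1]

/-- The Laplace–Beltrami operator on the unit sphere: apply the Euclidean Laplacian to the
degree-zero homogeneous extension `x ↦ v (x/|x|)` and evaluate at a point of the sphere. -/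
noncomputable def sphLaplacian {m : ℕ} (v : EuclideanSpace ℝ (Fin m) → ℝ)
    (θ : EuclideanSpace ℝ (Fin m)) : ℝ :=
  eLaplacian (fun x => v (‖x‖⁻¹ • x)) θ

namespace SphereShooting

open Real Set Filter Topology MeasureTheory
open scoped NNReal BoundedContinuousFunction

section Kernel

/-- The weighted average `(∫₀ˢ sinⁿ h) / sinⁿ s`. -/
noncomputable def sinMean (n : ℕ) (h : ℝ → ℝ) (s : ℝ) : ℝ :=
  (∫ t in (0 : ℝ)..s, sin t ^ n * h t) / sin s ^ n

lemma sin_pow_pos {n : ℕ} {r : ℝ} (hr : r ∈ Ioo 0 π) : 0 < sin r ^ n :=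
  pow_pos (sin_pos_of_pos_of_lt_pi hr.1 hr.2) n

lemma uIcc_subset_Ico {r : ℝ} (hr : r ∈ Ico 0 π) : uIcc 0 r ⊆ Ico 0 π := by
  rw [uIcc_of_le hr.1]
  exact fun x hx => ⟨hx.1, hx.2.trans_lt hr.2⟩

lemma intervalIntegrable_sin_pow_mul {n : ℕ} {h : ℝ → ℝ} (hc : ContinuousOn h (Ico 0 π)) {r : ℝ}
    (hr : r ∈ Ico 0 π) : IntervalIntegrable (fun t => sin t ^ n * h t) volume 0 r := by
  apply ContinuousOn.intervalIntegrable
  exact (by fun_prop : Continuous fun t => sin t ^ n).continuousOn.mul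
    (hc.mono (uIcc_subset_Ico hr))

lemma hasDerivAt_integral_of_continuousOn {h : ℝ → ℝ} (hc : ContinuousOn h (Ico 0 π)) {r : ℝ}
    (hr : r ∈ Ioo 0 π) : HasDerivAt (fun s => ∫ t in (0 : ℝ)..s, h t) (h r) r := by
  apply intervalIntegral.integral_hasDerivAt_right
  · exact (hc.mono (uIcc_subset_Ico ⟨hr.1.le, hr.2⟩)).intervalIntegrable
  · exact (hc.mono Ioo_subset_Ico_self).stronglyMeasurableAtFilter isOpen_Ioo r hr
  · exact (hc.mono Ioo_subset_Ico_self).continuousAt (isOpen_Ioo.mem_nhds hr)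

lemma continuousOn_integral_of_continuousOn {h : ℝ → ℝ} (hc : ContinuousOn h (Ico 0 π)) :
    ContinuousOn (fun s => ∫ t in (0 : ℝ)..s, h t) (Ico 0 π) := by
  intro r hr
  obtain ⟨R, hrR, hR⟩ := exists_between hr.2
  have hR0 : R ∈ Ico 0 π := ⟨hr.1.trans hrR.le, hR⟩
  have hi : IntegrableOn h (uIcc 0 R) :=
    (hc.mono (uIcc_subset_Ico hR0)).integrableOn_compact isCompact_uIcc
  have h1 := intervalIntegral.continuousOn_primitive_interval hi
  have h2 : ContinuousWithinAt (fun s => ∫ t in (0 : ℝ)..s, h t) (uIcc 0 R) r :=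
    h1 r (by rw [uIcc_of_le hR0.1]; exact ⟨hr.1, hrR.le⟩)
  apply h2.mono_of_mem_nhdsWithin
  rw [uIcc_of_le hR0.1]
  rw [mem_nhdsWithin]
  exact ⟨Iio R, isOpen_Iio, hrR, fun x hx => ⟨hx.2.1, le_of_lt hx.1⟩⟩

lemma continuousOn_sin_pow_mul {n : ℕ} {h : ℝ → ℝ} (hc : ContinuousOn h (Ico 0 π)) :
    ContinuousOn (fun t => sin t ^ n * h t) (Ico 0 π) :=
  (by fun_prop : Continuous fun t => sin t ^ n).continuousOn.mul hc

/-- The blow-up rate used to dominate the singularity of the kernel at `π`. -/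
noncomputable def kernelConst (n : ℕ) : ℝ := π * π ^ (n + 1)

lemma kernelConst_pos (n : ℕ) : 0 < kernelConst n := by
  unfold kernelConst; positivity

lemma integral_sin_pow_le (n : ℕ) {s : ℝ} (h0 : 0 ≤ s) (h1 : s ≤ π / 2) :
    ∫ t in (0 : ℝ)..s, sin t ^ n ≤ s * sin s ^ n := by
  have : ∫ t in (0 : ℝ)..s, sin t ^ n ≤ ∫ t in (0 : ℝ)..s, sin s ^ n := by
    apply intervalIntegral.integral_mono_on h0
    · exact (by fun_prop : Continuous fun t => sin t ^ n).intervalIntegrable _ _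
    · exact intervalIntegrable_const
    · intro t ht
      have := sin_nonneg_of_nonneg_of_le_pi ht.1 (by linarith [ht.2, pi_pos])
      have h3 : sin t ≤ sin s := sin_le_sin_of_le_of_le_pi_div_two (by linarith [ht.1, pi_pos]) h1 ht.2
      gcongr
  simpa using this

lemma sinMean_one_le (n : ℕ) {s : ℝ} (hs : s ∈ Ioo 0 π) :
    (∫ t in (0 : ℝ)..s, sin t ^ n) / sin s ^ n ≤ kernelConst n / (π - s) ^ (n + 1) := by
  have hg : 0 < sin s ^ n := sin_pow_pos hs
  have hps : 0 < π - s := by linarith [hs.2]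
  have hpi := pi_pos
  have hle : (π - s) ^ (n + 1) ≤ π ^ (n + 1) :=
    pow_le_pow_left₀ hps.le (by linarith [hs.1]) _
  rw [div_le_div_iff₀ hg (by positivity)]
  unfold kernelConst
  rcases le_total s (π / 2) with h | h
  · have h1 := integral_sin_pow_le n hs.1.le h
    calc (∫ t in (0 : ℝ)..s, sin t ^ n) * (π - s) ^ (n + 1)
        ≤ (s * sin s ^ n) * π ^ (n + 1) := by
          have : 0 ≤ s := hs.1.le
          gcongr
      _ ≤ (π * sin s ^ n) * π ^ (n + 1) := by
          have := hs.2.le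
          gcongr
      _ = _ := by ring
  · have h1 : ∫ t in (0 : ℝ)..s, sin t ^ n ≤ π := by
      have : ∫ t in (0 : ℝ)..s, sin t ^ n ≤ ∫ t in (0 : ℝ)..s, (1 : ℝ) := by
        apply intervalIntegral.integral_mono_on hs.1.le
        · exact (by fun_prop : Continuous fun t => sin t ^ n).intervalIntegrable _ _
        · exact intervalIntegrable_const
        · intro t ht
          exact pow_le_one₀ (sin_nonneg_of_nonneg_of_le_pi ht.1 (ht.2.trans hs.2.le)) (sin_le_one t)
      simp at this
      linarith [hs.2]
    have h2 : 2 / π * (π - s) ≤ sin s := by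
      have := mul_le_sin hps.le (by linarith)
      rwa [sin_pi_sub] at this
    have h3 : π - s ≤ π * sin s := by
      have : π - s = π / 2 * (2 / π * (π - s)) := by field_simp
      have h5 : 0 ≤ 2 / π * (π - s) := by positivity
      nlinarith
    have h4 : (π - s) ^ n ≤ π ^ n * sin s ^ n := by
      rw [← mul_pow]; exact pow_le_pow_left₀ hps.le h3 n
    calc (∫ t in (0 : ℝ)..s, sin t ^ n) * (π - s) ^ (n + 1)
        ≤ π * (π - s) ^ (n + 1) := by gcongr
      _ = π * ((π - s) ^ n * (π - s)) := by rw [pow_succ]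
      _ ≤ π * ((π ^ n * sin s ^ n) * π) := by
          have : π - s ≤ π := by linarith [hs.1]
          gcongr
      _ = _ := by ring

lemma abs_sinMean_le {n : ℕ} {h : ℝ → ℝ} (hc : ContinuousOn h (Ico 0 π)) {s A : ℝ}
    (hs : s ∈ Ioo 0 π) (hA : ∀ t ∈ Icc 0 s, |h t| ≤ A) :
    |sinMean n h s| ≤ A * ((∫ t in (0 : ℝ)..s, sin t ^ n) / sin s ^ n) := by
  have hg : 0 < sin s ^ n := sin_pow_pos hs
  unfold sinMean
  rw [abs_div, abs_of_pos hg, ← mul_div_assoc]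
  gcongr
  rw [← intervalIntegral.integral_const_mul]
  calc |∫ t in (0 : ℝ)..s, sin t ^ n * h t| ≤ ∫ t in (0 : ℝ)..s, |sin t ^ n * h t| :=
        intervalIntegral.abs_integral_le_integral_abs hs.1.le
    _ ≤ _ := by
      apply intervalIntegral.integral_mono_on hs.1.le
      · exact (intervalIntegrable_sin_pow_mul hc ⟨hs.1.le, hs.2⟩).abs
      · exact (by fun_prop : Continuous fun t => A * sin t ^ n).intervalIntegrable _ _
      · intro t ht
        have : 0 ≤ sin t ^ n :=
          pow_nonneg (sin_nonneg_of_nonneg_of_le_pi ht.1 (ht.2.trans hs.2.le)) n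
        rw [abs_mul, abs_of_nonneg this, mul_comm]
        exact mul_le_mul_of_nonneg_right (hA t ht) this

lemma sinMean_zero (n : ℕ) (h : ℝ → ℝ) : sinMean n h 0 = 0 := by
  simp [sinMean]

lemma continuousOn_sinMean {n : ℕ} {h : ℝ → ℝ} (hc : ContinuousOn h (Ico 0 π)) :
    ContinuousOn (sinMean n h) (Ico 0 π) := by
  intro r hr
  rcases eq_or_lt_of_le hr.1 with h0 | h0
  · subst h0
    have hb : ∃ A, ∀ t ∈ Icc 0 (π / 2), |h t| ≤ A := by
      have := (isCompact_Icc (a := (0 : ℝ)) (b := π / 2)).exists_bound_of_continuousOn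
        (hc.mono fun x hx => ⟨hx.1, by linarith [hx.2, pi_pos]⟩)
      simpa using this
    obtain ⟨A, hA⟩ := hb
    have hA0 : 0 ≤ A := (abs_nonneg _).trans (hA 0 ⟨le_rfl, by positivity⟩)
    rw [ContinuousWithinAt, sinMean_zero]
    have hev : ∀ᶠ s in 𝓝[Ico 0 π] (0 : ℝ), ‖sinMean n h s‖ ≤ A * s := by
      have : Iio (π / 2) ∈ 𝓝[Ico 0 π] (0 : ℝ) :=
        mem_nhdsWithin_of_mem_nhds (Iio_mem_nhds (by positivity))
      filter_upwards [this, self_mem_nhdsWithin] with s hs hs'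
      rcases eq_or_lt_of_le hs'.1 with h1 | h1
      · rw [← h1, sinMean_zero]; simp
      · have hs2 : s ∈ Ioo 0 π := ⟨h1, hs'.2⟩
        have hs3 : s ≤ π / 2 := le_of_lt hs
        refine (abs_sinMean_le hc hs2 fun t ht => hA t ⟨ht.1, ht.2.trans hs3⟩).trans ?_
        gcongr
        rw [div_le_iff₀ (sin_pow_pos hs2)]
        exact integral_sin_pow_le n h1.le hs3
    refine squeeze_zero_norm' hev ?_
    have : Tendsto (fun s : ℝ => A * s) (𝓝 0) (𝓝 (A * 0)) := (continuous_const.mul continuous_id).tendsto 0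
    rw [mul_zero] at this
    exact this.mono_left nhdsWithin_le_nhds
  · have hr' : r ∈ Ioo 0 π := ⟨h0, hr.2⟩
    exact ((continuousOn_integral_of_continuousOn (continuousOn_sin_pow_mul hc)) r hr).div
      (by fun_prop : Continuous fun t => sin t ^ n).continuousWithinAt (sin_pow_pos hr').ne'

/-- The exponent of the weight making the integral operator a contraction. -/
noncomputable def weightExp (n : ℕ) (L : ℝ) (r : ℝ) : ℝ :=
  2 * (L + 1) * kernelConst n * ((π - r) ^ n)⁻¹

lemma weightExp_nonneg {n : ℕ} {L : ℝ} (hL : 0 ≤ L) {r : ℝ} (hr : r < π) :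
    0 ≤ weightExp n L r := by
  have := kernelConst_pos n
  have : 0 < π - r := by linarith
  unfold weightExp; positivity

lemma weightExp_mono {n : ℕ} {L : ℝ} (hL : 0 ≤ L) {r s : ℝ} (hrs : r ≤ s) (hs : s < π) :
    weightExp n L r ≤ weightExp n L s := by
  have := kernelConst_pos n
  have : 0 < π - s := by linarith
  unfold weightExp
  gcongr

lemma hasDerivAt_weightExp (n : ℕ) (L : ℝ) {r : ℝ} (hr : r < π) :
    HasDerivAt (weightExp n L)
      (2 * (L + 1) * kernelConst n * (n / (π - r) ^ (n + 1))) r := by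
  have h0 : π - r ≠ 0 := by linarith
  have h1 : HasDerivAt (fun r : ℝ => π - r) (-1) r := by
    simpa using (hasDerivAt_id r).const_sub π
  have h2 := ((h1.pow n).inv (pow_ne_zero n h0)).const_mul (2 * (L + 1) * kernelConst n)
  unfold weightExp
  refine h2.congr_deriv ?_
  congr 1
  rcases n with _ | n
  · simp
  · simp only [Nat.add_sub_cancel]
    field_simp
    simp only [Pi.pow_apply]
    ring

lemma abs_integral_sinMean_le {n : ℕ} (hn : 1 ≤ n) {L : ℝ} (hL : 0 ≤ L) {h : ℝ → ℝ}
    (hc : ContinuousOn h (Ico 0 π)) {A R : ℝ} (hA0 : 0 ≤ A) (hR : R ∈ Ico 0 π)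
    (hA : ∀ t ∈ Icc 0 R, |h t| ≤ A * exp (weightExp n L t)) :
    |∫ s in (0 : ℝ)..R, sinMean n h s| ≤ A / (2 * (L + 1)) * exp (weightExp n L R) := by
  set W' : ℝ → ℝ := fun r => 2 * (L + 1) * kernelConst n * (n / (π - r) ^ (n + 1)) with hW'
  have hK := kernelConst_pos n
  have hWc : ContinuousOn W' (uIcc 0 R) := by
    apply continuousOn_const.mul
    apply continuousOn_const.div (by fun_prop)
    intro x hx
    have := uIcc_subset_Ico hR hx
    exact pow_ne_zero _ (by linarith [this.2])
  have hEc : ContinuousOn (fun r => exp (weightExp n L r)) (uIcc 0 R) := by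
    intro x hx
    exact ((hasDerivAt_weightExp n L (uIcc_subset_Ico hR hx).2).continuousAt.rexp).continuousWithinAt
  have hInt : ∫ s in (0 : ℝ)..R, A / (2 * (L + 1)) * (exp (weightExp n L s) * W' s)
      = A / (2 * (L + 1)) * (exp (weightExp n L R) - exp (weightExp n L 0)) := by
    rw [intervalIntegral.integral_const_mul]
    congr 1
    apply intervalIntegral.integral_eq_sub_of_hasDerivAt
    · intro x hx
      exact (hasDerivAt_weightExp n L (uIcc_subset_Ico hR hx).2).exp
    · exact (hEc.mul hWc).intervalIntegrable
  have hmain : |∫ s in (0 : ℝ)..R, sinMean n h s|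
      ≤ ∫ s in (0 : ℝ)..R, A / (2 * (L + 1)) * (exp (weightExp n L s) * W' s) := by
    refine (intervalIntegral.abs_integral_le_integral_abs hR.1).trans ?_
    apply intervalIntegral.integral_mono_on hR.1
    · exact (((continuousOn_sinMean hc).mono (uIcc_subset_Ico hR)).abs).intervalIntegrable
    · exact (continuousOn_const.mul (hEc.mul hWc)).intervalIntegrable
    · intro s hs
      rcases eq_or_lt_of_le hs.1 with h0 | h0
      · rw [← h0, sinMean_zero, abs_zero]
        have : 0 < π - (0 : ℝ) := by linarith [pi_pos]
        simp only [hW']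
        positivity
      · have hs' : s ∈ Ioo 0 π := ⟨h0, hs.2.trans_lt hR.2⟩
        have hps : 0 < π - s := by linarith [hs'.2]
        have h1 := abs_sinMean_le (n := n) hc hs' (A := A * exp (weightExp n L s)) (by
          intro t ht
          refine (hA t ⟨ht.1, ht.2.trans hs.2⟩).trans ?_
          have := weightExp_mono (n := n) hL ht.2 hs'.2
          gcongr)
        refine h1.trans ?_
        have h2 := sinMean_one_le n hs'
        have hn' : (1 : ℝ) ≤ n := by exact_mod_cast hn
        calc A * exp (weightExp n L s) * ((∫ t in (0 : ℝ)..s, sin t ^ n) / sin s ^ n)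
            ≤ A * exp (weightExp n L s) * (kernelConst n / (π - s) ^ (n + 1)) := by gcongr
          _ ≤ A * exp (weightExp n L s) * (kernelConst n * (n / (π - s) ^ (n + 1))) := by
              have : kernelConst n / (π - s) ^ (n + 1) ≤ kernelConst n * (n / (π - s) ^ (n + 1)) := by
                rw [div_eq_mul_one_div]
                gcongr
              gcongr
          _ = _ := by
              simp only [hW']
              have : L + 1 ≠ 0 := by positivity
              field_simp
  rw [hInt] at hmain
  refine hmain.trans ?_
  have := exp_pos (weightExp n L 0)
  gcongr
  linarith

/-- Gronwall inequality for the singular kernel. -/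
lemma gronwall_sinMean {n : ℕ} (hn : 1 ≤ n) {L ε R : ℝ} (hL : 0 ≤ L) (hε : 0 ≤ ε) (hR : R ∈ Ico 0 π)
    {D h : ℝ → ℝ} (hD : ContinuousOn D (Ico 0 π)) (hc : ContinuousOn h (Ico 0 π))
    (hh : ∀ t ∈ Icc 0 R, |h t| ≤ L * |D t|)
    (hle : ∀ r ∈ Icc 0 R, |D r| ≤ ε + |∫ s in (0 : ℝ)..r, sinMean n h s|) :
    ∀ r ∈ Icc 0 R, |D r| ≤ 2 * ε * exp (weightExp n L r) := by
  have hsub : Icc 0 R ⊆ Ico 0 π := fun x hx => ⟨hx.1, hx.2.trans_lt hR.2⟩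
  have hcont : ContinuousOn (fun r => |D r| * exp (-weightExp n L r)) (Icc 0 R) := by
    apply (hD.mono hsub).abs.mul
    intro x hx
    exact ((hasDerivAt_weightExp n L (hsub hx).2).continuousAt.neg.rexp).continuousWithinAt
  obtain ⟨m, hm, hmax⟩ := isCompact_Icc.exists_isMaxOn ⟨0, le_rfl, hR.1⟩ hcont
  set S := |D m| * exp (-weightExp n L m) with hS
  have hS0 : 0 ≤ S := by positivity
  have hb : ∀ t ∈ Icc 0 R, |D t| ≤ S * exp (weightExp n L t) := by
    intro t ht
    have h1 : |D t| * exp (-weightExp n L t) ≤ S := hmax ht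
    calc |D t| = |D t| * exp (-weightExp n L t) * exp (weightExp n L t) := by
          rw [mul_assoc, ← exp_add]; simp
      _ ≤ _ := by gcongr
  have h2 : |D m| ≤ ε + (L * S) / (2 * (L + 1)) * exp (weightExp n L m) := by
    refine (hle m hm).trans ?_
    gcongr
    apply abs_integral_sinMean_le hn hL hc (by positivity) (hsub hm)
    intro t ht
    have ht' : t ∈ Icc 0 R := ⟨ht.1, ht.2.trans hm.2⟩
    refine (hh t ht').trans ?_
    rw [mul_assoc]
    gcongr
    exact hb t ht'
  have h3 : S ≤ 2 * ε := by
    have e1 : exp (weightExp n L m) * exp (-weightExp n L m) = 1 := by rw [← exp_add]; simp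
    have e2 : exp (-weightExp n L m) ≤ 1 := by
      rw [exp_le_one_iff]; linarith [weightExp_nonneg (n := n) hL (hsub hm).2]
    have h4 : S ≤ ε * exp (-weightExp n L m) + (L * S) / (2 * (L + 1)) := by
      calc S ≤ (ε + (L * S) / (2 * (L + 1)) * exp (weightExp n L m)) * exp (-weightExp n L m) := by
            rw [hS]; gcongr
        _ = ε * exp (-weightExp n L m)
            + (L * S) / (2 * (L + 1)) * (exp (weightExp n L m) * exp (-weightExp n L m)) := by ring
        _ = _ := by rw [e1, mul_one]
    have h5 : (L * S) / (2 * (L + 1)) ≤ S / 2 := by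
      rw [div_le_div_iff₀ (by positivity) (by positivity)]
      nlinarith
    nlinarith
  intro r hr
  refine (hb r hr).trans ?_
  gcongr

end Kernel

section InitialValueProblem

/-- `u` solves `(sinⁿ u')' + sinⁿ f(u) = 0` on `[0, π)` with `u'(0) = 0`, in integrated form. -/
structure IsRadialSol (n : ℕ) (f u : ℝ → ℝ) : Prop where
  cont : ContinuousOn u (Ico 0 π)
  eq : ∀ r ∈ Ico 0 π, u r = u 0 - ∫ s in (0 : ℝ)..r, sinMean n (fun t => f (u t)) s

/-- The flux `sinⁿ u'` of a radial solution. -/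
noncomputable def flux (n : ℕ) (f u : ℝ → ℝ) (r : ℝ) : ℝ :=
  -∫ t in (0 : ℝ)..r, sin t ^ n * f (u t)

lemma flux_zero (n : ℕ) (f u : ℝ → ℝ) : flux n f u 0 = 0 := by simp [flux]

lemma sinMean_sub {n : ℕ} {h k : ℝ → ℝ} (hh : ContinuousOn h (Ico 0 π))
    (hk : ContinuousOn k (Ico 0 π)) {s : ℝ} (hs : s ∈ Ico 0 π) :
    sinMean n (fun t => h t - k t) s = sinMean n h s - sinMean n k s := by
  simp only [sinMean]
  rw [← sub_div, ← intervalIntegral.integral_sub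
    (intervalIntegrable_sin_pow_mul hh hs) (intervalIntegrable_sin_pow_mul hk hs)]
  simp only [mul_sub]

lemma integral_sinMean_sub {n : ℕ} {h k : ℝ → ℝ} (hh : ContinuousOn h (Ico 0 π))
    (hk : ContinuousOn k (Ico 0 π)) {r : ℝ} (hr : r ∈ Ico 0 π) :
    ∫ s in (0 : ℝ)..r, sinMean n (fun t => h t - k t) s
      = (∫ s in (0 : ℝ)..r, sinMean n h s) - ∫ s in (0 : ℝ)..r, sinMean n k s := by
  rw [← intervalIntegral.integral_sub
    ((continuousOn_sinMean hh).mono (uIcc_subset_Ico hr)).intervalIntegrable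
    ((continuousOn_sinMean hk).mono (uIcc_subset_Ico hr)).intervalIntegrable]
  apply intervalIntegral.integral_congr
  intro s hs
  exact sinMean_sub hh hk (uIcc_subset_Ico hr hs)

/-- Extension by zero of a bounded function on `[0, π)`, unweighted by `exp (weightExp n L)`. -/
noncomputable def unweight (n : ℕ) (L : ℝ) (v : Ico (0 : ℝ) π →ᵇ ℝ) (s : ℝ) : ℝ :=
  if h : s ∈ Ico (0 : ℝ) π then exp (weightExp n L s) * v ⟨s, h⟩ else 0

lemma continuousOn_exp_weightExp (n : ℕ) (L : ℝ) :
    ContinuousOn (fun r => exp (weightExp n L r)) (Ico 0 π) := fun _ hx =>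
  ((hasDerivAt_weightExp n L hx.2).continuousAt.rexp).continuousWithinAt

lemma continuousOn_unweight (n : ℕ) (L : ℝ) (v : Ico (0 : ℝ) π →ᵇ ℝ) :
    ContinuousOn (unweight n L v) (Ico 0 π) := by
  rw [continuousOn_iff_continuous_domRestrict]
  have h1 := continuousOn_iff_continuous_domRestrict.1 (continuousOn_exp_weightExp n L)
  refine (h1.mul v.continuous).congr ?_
  rintro ⟨x, hx⟩
  have hx' : 0 ≤ x ∧ x < π := hx
  simp [unweight, hx']

lemma exists_isRadialSol {n : ℕ} (hn : 1 ≤ n) {L : ℝ≥0} {f : ℝ → ℝ} (hf : LipschitzWith L f)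
    (α : ℝ) : ∃ u, IsRadialSol n f u ∧ u 0 = α := by
  have hfl : ∀ x y, |f x - f y| ≤ L * |x - y| := fun x y => by
    simpa [Real.dist_eq] using hf.dist_le_mul x y
  have hL : (0 : ℝ) ≤ L := L.2
  let U := unweight n L
  have hU : ∀ v, ContinuousOn (U v) (Ico 0 π) := continuousOn_unweight n L
  have hfU : ∀ v, ContinuousOn (fun t => f (U v t)) (Ico 0 π) := fun v =>
    hf.continuous.comp_continuousOn (hU v)
  let G : (Ico (0 : ℝ) π →ᵇ ℝ) → ℝ → ℝ := fun v r =>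
    α - ∫ s in (0 : ℝ)..r, sinMean n (fun t => f (U v t)) s
  have hG : ∀ v, ContinuousOn (G v) (Ico 0 π) := fun v =>
    continuousOn_const.sub (continuousOn_integral_of_continuousOn (continuousOn_sinMean (hfU v)))
  have hUb : ∀ v : Ico (0 : ℝ) π →ᵇ ℝ, ∀ s ∈ Ico 0 π, |U v s| ≤ ‖v‖ * exp (weightExp n L s) := by
    intro v s hs
    have hs' : 0 ≤ s ∧ s < π := hs
    have := v.norm_coe_le_norm ⟨s, hs⟩
    rw [Real.norm_eq_abs] at this
    simp only [U, unweight, mem_Ico, hs', and_self, dite_true, abs_mul, abs_exp]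
    rw [mul_comm]
    gcongr
  have hbd : ∀ v : Ico (0 : ℝ) π →ᵇ ℝ, ∀ r : Ico (0 : ℝ) π,
      ‖exp (-weightExp n L r) * G v r‖ ≤ |α| + (|f 0| + L * ‖v‖) / (2 * (L + 1)) := by
    rintro v ⟨r, hr⟩
    have h1 : |∫ s in (0 : ℝ)..r, sinMean n (fun t => f (U v t)) s|
        ≤ (|f 0| + L * ‖v‖) / (2 * (L + 1)) * exp (weightExp n L r) := by
      apply abs_integral_sinMean_le hn hL (hfU v) (by positivity) hr
      intro t ht
      have ht' : t ∈ Ico 0 π := ⟨ht.1, ht.2.trans_lt hr.2⟩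
      have h1 := hfl (U v t) 0
      have h2 : |f (U v t)| ≤ |f 0| + |f (U v t) - f 0| := by
        have := abs_add_le (f 0) (f (U v t) - f 0); simpa using this
      rw [sub_zero] at h1
      have h3 := hUb v t ht'
      have h4 : 1 ≤ exp (weightExp n L t) := one_le_exp (weightExp_nonneg hL ht'.2)
      calc |f (U v t)| ≤ |f 0| * exp (weightExp n L t) + L * (‖v‖ * exp (weightExp n L t)) := by
            refine h2.trans (add_le_add ?_ (h1.trans ?_))
            · exact le_mul_of_one_le_right (abs_nonneg _) h4
            · gcongr
        _ = _ := by ring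
    have e1 : exp (-weightExp n L r) * exp (weightExp n L r) = 1 := by rw [← exp_add]; simp
    have e2 : exp (-weightExp n L r) ≤ 1 := by
      rw [exp_le_one_iff]; linarith [weightExp_nonneg (n := n) hL hr.2]
    rw [Real.norm_eq_abs, abs_mul, abs_exp]
    calc exp (-weightExp n L r) * |G v r|
        ≤ exp (-weightExp n L r) *
          (|α| + (|f 0| + L * ‖v‖) / (2 * (L + 1)) * exp (weightExp n L r)) := by
          gcongr
          exact (abs_sub _ _).trans (by gcongr)
      _ = exp (-weightExp n L r) * |α| + (|f 0| + L * ‖v‖) / (2 * (L + 1)) *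
          (exp (-weightExp n L r) * exp (weightExp n L r)) := by ring
      _ ≤ _ := by
          rw [e1, mul_one]
          gcongr
          exact mul_le_of_le_one_left (abs_nonneg _) e2
  have hScont : ∀ v : Ico (0 : ℝ) π →ᵇ ℝ,
      Continuous fun r : Ico (0 : ℝ) π => exp (-weightExp n L r) * G v r := by
    intro v
    have : ContinuousOn (fun r => exp (-weightExp n L r) * G v r) (Ico 0 π) := by
      refine ContinuousOn.mul ?_ (hG v)
      exact fun _ hx =>
        ((hasDerivAt_weightExp n L hx.2).continuousAt.neg.rexp).continuousWithinAt
    exact continuousOn_iff_continuous_domRestrict.1 this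
  let S : (Ico (0 : ℝ) π →ᵇ ℝ) → (Ico (0 : ℝ) π →ᵇ ℝ) := fun v =>
    BoundedContinuousFunction.ofNormedAddCommGroup
      (fun r : Ico (0 : ℝ) π => exp (-weightExp n L r) * G v r) (hScont v) _ (hbd v)
  have hcontr : ContractingWith (1 / 2) S := by
    refine ⟨by rw [← NNReal.coe_lt_coe]; norm_num, LipschitzWith.of_dist_le_mul fun v w => ?_⟩
    rw [BoundedContinuousFunction.dist_le (by positivity)]
    rintro ⟨r, hr⟩
    have hdiff : G v r - G w r = -∫ s in (0 : ℝ)..r, sinMean n (fun t => f (U v t) - f (U w t)) s := by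
      rw [integral_sinMean_sub (hfU v) (hfU w) hr]
      simp only [G]; ring
    have h1 : |G v r - G w r| ≤ (L * dist v w) / (2 * (L + 1)) * exp (weightExp n L r) := by
      rw [hdiff, abs_neg]
      apply abs_integral_sinMean_le hn hL ((hfU v).sub (hfU w)) (by positivity) hr
      intro t ht
      have ht' : t ∈ Ico 0 π := ⟨ht.1, ht.2.trans_lt hr.2⟩
      have h5 : 0 ≤ t ∧ t < π := ht'
      refine (hfl _ _).trans ?_
      rw [mul_assoc]
      gcongr
      simp only [U, unweight, mem_Ico, h5, and_self, dite_true]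
      rw [← mul_sub, abs_mul, abs_exp, mul_comm]
      gcongr
      exact BoundedContinuousFunction.dist_coe_le_dist (f := v) (g := w) ⟨t, ht'⟩
    have e1 : exp (-weightExp n L r) * exp (weightExp n L r) = 1 := by rw [← exp_add]; simp
    simp only [S, BoundedContinuousFunction.coe_ofNormedAddCommGroup]
    rw [Real.dist_eq, ← mul_sub, abs_mul, abs_exp]
    calc exp (-weightExp n L r) * |G v r - G w r|
        ≤ exp (-weightExp n L r) * ((L * dist v w) / (2 * (L + 1)) * exp (weightExp n L r)) := by
          gcongr
      _ = (L * dist v w) / (2 * (L + 1)) *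
          (exp (-weightExp n L r) * exp (weightExp n L r)) := by ring
      _ ≤ _ := by
          rw [e1, mul_one]
          have : (0 : ℝ) ≤ dist v w := dist_nonneg
          push_cast
          rw [div_le_iff₀ (by positivity)]
          nlinarith
  obtain ⟨v, hv⟩ : ∃ v, S v = v := ⟨_, hcontr.fixedPoint_isFixedPt⟩
  have hUG : ∀ r ∈ Ico 0 π, U v r = G v r := by
    intro r hr
    have hr' : 0 ≤ r ∧ r < π := hr
    have h1 : exp (-weightExp n L r) * G v r = v ⟨r, hr⟩ :=
      DFunLike.congr_fun hv ⟨r, hr⟩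
    simp only [U, unweight, mem_Ico, hr', and_self, dite_true]
    rw [← h1, ← mul_assoc, ← exp_add]; simp
  have hU0 : U v 0 = α := by
    rw [hUG 0 ⟨le_rfl, pi_pos⟩]; simp [G]
  exact ⟨U v, ⟨hU v, fun r hr => by rw [hU0]; exact hUG r hr⟩, hU0⟩

namespace IsRadialSol

variable {n : ℕ} {f u : ℝ → ℝ}

lemma continuousOn_comp (hu : IsRadialSol n f u) (hf : Continuous f) :
    ContinuousOn (fun t => f (u t)) (Ico 0 π) :=
  hf.comp_continuousOn hu.cont

lemma hasDerivAt_flux (hu : IsRadialSol n f u) (hf : Continuous f) {r : ℝ} (hr : r ∈ Ioo 0 π) :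
    HasDerivAt (flux n f u) (-(sin r ^ n * f (u r))) r :=
  (hasDerivAt_integral_of_continuousOn
    (continuousOn_sin_pow_mul (n := n) (hu.continuousOn_comp hf)) hr).neg

lemma continuousOn_flux (hu : IsRadialSol n f u) (hf : Continuous f) :
    ContinuousOn (flux n f u) (Ico 0 π) :=
  (continuousOn_integral_of_continuousOn
    (continuousOn_sin_pow_mul (n := n) (hu.continuousOn_comp hf))).neg

lemma hasDerivAt (hu : IsRadialSol n f u) (hf : Continuous f) {r : ℝ} (hr : r ∈ Ioo 0 π) :
    HasDerivAt u (flux n f u r / sin r ^ n) r := by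
  have h1 := (hasDerivAt_integral_of_continuousOn
    (continuousOn_sinMean (n := n) (hu.continuousOn_comp hf)) hr).const_sub (u 0)
  have h2 : -sinMean n (fun t => f (u t)) r = flux n f u r / sin r ^ n := by
    simp [sinMean, flux, neg_div]
  rw [h2] at h1
  refine h1.congr_of_eventuallyEq ?_
  filter_upwards [isOpen_Ioo.mem_nhds hr] with x hx
  exact hu.eq x ⟨hx.1.le, hx.2⟩

end IsRadialSol

lemma IsRadialSol.of_hasDerivAt {n : ℕ} {f u : ℝ → ℝ} (hf : Continuous f)
    (hu : ContinuousOn u (Ico 0 π))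
    (hd : ∀ r ∈ Ioo 0 π, HasDerivAt u (flux n f u r / sin r ^ n) r) : IsRadialSol n f u := by
  refine ⟨hu, fun r hr => ?_⟩
  have hfu : ContinuousOn (fun t => f (u t)) (Ico 0 π) := hf.comp_continuousOn hu
  have hc := (continuousOn_sinMean (n := n) hfu).mono (uIcc_subset_Ico hr)
  have h := intervalIntegral.integral_eq_sub_of_hasDerivAt_of_le hr.1
    (hu.mono fun x hx => ⟨hx.1, hx.2.trans_lt hr.2⟩)
    (f' := fun s => -sinMean n (fun t => f (u t)) s) (fun x hx => by
      have := hd x ⟨hx.1, hx.2.trans hr.2⟩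
      simpa [sinMean, flux, neg_div] using this) hc.neg.intervalIntegrable
  rw [intervalIntegral.integral_neg] at h
  linarith

/-- Lipschitz dependence on the initial value. -/
lemma abs_sub_le_of_isRadialSol {n : ℕ} (hn : 1 ≤ n) {L : ℝ≥0} {f u v : ℝ → ℝ}
    (hf : LipschitzWith L f) (hu : IsRadialSol n f u) (hv : IsRadialSol n f v) {r : ℝ}
    (hr : r ∈ Ico 0 π) : |u r - v r| ≤ 2 * |u 0 - v 0| * exp (weightExp n L r) := by
  refine gronwall_sinMean hn L.2 (abs_nonneg _) hr (hu.cont.sub hv.cont)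
    ((hu.continuousOn_comp hf.continuous).sub (hv.continuousOn_comp hf.continuous))
    (fun t _ => ?_) (fun s hs => ?_) r ⟨hr.1, le_rfl⟩
  · simpa [Real.dist_eq] using hf.dist_le_mul (u t) (v t)
  · have hs' : s ∈ Ico 0 π := ⟨hs.1, hs.2.trans_lt hr.2⟩
    have hsub := integral_sinMean_sub (n := n) (hu.continuousOn_comp hf.continuous)
      (hv.continuousOn_comp hf.continuous) hs'
    have h : u s - v s = (u 0 - v 0) - ((∫ s in (0 : ℝ)..s, sinMean n (fun t => f (u t)) s)
      - ∫ s in (0 : ℝ)..s, sinMean n (fun t => f (v t)) s) := by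
      rw [hu.eq s hs', hv.eq s hs']; ring
    rw [← hsub] at h
    show |u s - v s| ≤ _
    rw [h]
    exact abs_sub _ _

/-- A solution with vanishing flux at an interior point where it takes an equilibrium value is
constant. -/
lemma IsRadialSol.eq_const_of_flux_eq_zero {n : ℕ} {L : ℝ≥0} {f u : ℝ → ℝ}
    (hf : LipschitzWith L f) (hu : IsRadialSol n f u) {c r₀ : ℝ} (hc : f c = 0)
    (hr₀ : r₀ ∈ Ioo 0 π) (h0 : u r₀ = c) (hz0 : flux n f u r₀ = 0) : ∀ r ∈ Ico 0 π, u r = c := by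
  have hopen : ∀ r ∈ Ioo 0 π, u r = c := by
    intro r hr
    set a := min r r₀
    set b := max r r₀
    have ha : 0 < a := lt_min hr.1 hr₀.1
    have hb : b < π := max_lt hr.2 hr₀.2
    have hsub : Icc a b ⊆ Ioo 0 π := fun x hx => ⟨ha.trans_le hx.1, hx.2.trans_lt hb⟩
    obtain ⟨K, hK⟩ : ∃ K, ∀ x ∈ Icc a b, 1 / sin x ^ n + L * sin x ^ n ≤ K := by
      have hcont : ContinuousOn (fun x => 1 / sin x ^ n + L * sin x ^ n) (Icc a b) := by
        apply ContinuousOn.add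
        · exact continuousOn_const.div (by fun_prop) fun x hx => (sin_pow_pos (hsub hx)).ne'
        · fun_prop
      obtain ⟨K, hK⟩ := isCompact_Icc.exists_bound_of_continuousOn hcont
      exact ⟨K, fun x hx => (le_abs_self _).trans (hK x hx)⟩
    let z := flux n f u
    let E : ℝ → ℝ := fun x => (u x - c) ^ 2 + z x ^ 2
    let E' : ℝ → ℝ := fun x => 2 * (u x - c) * (z x / sin x ^ n) + 2 * z x * -(sin x ^ n * f (u x))
    have hE : ∀ x ∈ Icc a b, HasDerivAt E (E' x) x := by
      intro x hx
      have h1 := ((hu.hasDerivAt hf.continuous (hsub hx)).sub_const c).pow 2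
      have h2 := (hu.hasDerivAt_flux hf.continuous (hsub hx)).pow 2
      refine (h1.add h2).congr_deriv ?_
      simp [E', z]
    have hE' : ∀ x ∈ Icc a b, |E' x| ≤ K * E x := by
      intro x hx
      have hg := sin_pow_pos (n := n) (hsub hx)
      have h1 : |f (u x)| ≤ L * |u x - c| := by
        simpa [Real.dist_eq, hc] using hf.dist_le_mul (u x) c
      have h2 : 2 * (|u x - c| * |z x|) ≤ E x := by
        have := two_mul_le_add_sq |u x - c| |z x|
        simp only [sq_abs] at this
        simp only [E]; linarith
      calc |E' x| ≤ |2 * (u x - c) * (z x / sin x ^ n)| + |2 * z x * -(sin x ^ n * f (u x))| :=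
            abs_add_le _ _
        _ = 2 * (|u x - c| * |z x|) * (1 / sin x ^ n) + 2 * |z x| * (sin x ^ n * |f (u x)|) := by
            simp only [abs_mul, abs_div, abs_neg, abs_of_pos hg, abs_two]; ring
        _ ≤ 2 * (|u x - c| * |z x|) * (1 / sin x ^ n) + 2 * |z x| * (sin x ^ n * (L * |u x - c|)) := by
            gcongr
        _ = (1 / sin x ^ n + L * sin x ^ n) * (2 * (|u x - c| * |z x|)) := by ring
        _ ≤ K * E x := by
            have h3 := hK x hx
            have h4 : 0 ≤ 1 / sin x ^ n + L * sin x ^ n := by positivity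
            have h5 := h4.trans h3
            gcongr
    have hE0 : E r₀ = 0 := by simp [E, z, h0, hz0]
    have hEr : E r ≤ 0 := by
      have hra : r ∈ Icc a b := ⟨min_le_left _ _, le_max_left _ _⟩
      have hr₀a : r₀ ∈ Icc a b := ⟨min_le_right _ _, le_max_right _ _⟩
      rcases le_total r₀ r with h | h
      · have hanti : AntitoneOn (fun x => E x * exp (-K * x)) (Icc a b) := by
          apply antitoneOn_of_hasDerivWithinAt_nonpos (convex_Icc a b)
            (f' := fun x => E' x * exp (-K * x) + E x * (exp (-K * x) * -K))
          · intro x hx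
            exact ((hE x hx).continuousAt.mul (by fun_prop)).continuousWithinAt
          · intro x hx
            have hx' := interior_subset hx
            have h1 : HasDerivAt (fun x => exp (-K * x)) (exp (-K * x) * -K) x := by
              simpa using ((hasDerivAt_id x).const_mul (-K)).exp
            exact ((hE x hx').mul h1).hasDerivWithinAt
          · intro x hx
            have h1 := (abs_le.1 (hE' x (interior_subset hx))).2
            nlinarith [exp_pos (-K * x)]
        have := hanti hr₀a hra h
        simp only [hE0, zero_mul] at this
        nlinarith [exp_pos (-K * r)]
      · have hmono : MonotoneOn (fun x => E x * exp (K * x)) (Icc a b) := by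
          apply monotoneOn_of_hasDerivWithinAt_nonneg (convex_Icc a b)
            (f' := fun x => E' x * exp (K * x) + E x * (exp (K * x) * K))
          · intro x hx
            exact ((hE x hx).continuousAt.mul (by fun_prop)).continuousWithinAt
          · intro x hx
            have hx' := interior_subset hx
            have h1 : HasDerivAt (fun x => exp (K * x)) (exp (K * x) * K) x := by
              simpa using ((hasDerivAt_id x).const_mul K).exp
            exact ((hE x hx').mul h1).hasDerivWithinAt
          · intro x hx
            have h1 := (abs_le.1 (hE' x (interior_subset hx))).1
            nlinarith [exp_pos (K * x)]
        have := hmono hra hr₀a h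
        simp only [hE0, zero_mul] at this
        nlinarith [exp_pos (K * r)]
    have h3 : (u r - c) ^ 2 ≤ 0 := by
      have : 0 ≤ z r ^ 2 := sq_nonneg _
      simp only [E] at hEr; linarith
    have h4 : (u r - c) ^ 2 = 0 := le_antisymm h3 (sq_nonneg _)
    linarith [pow_eq_zero_iff (two_ne_zero) |>.1 h4]
  intro r hr
  rcases eq_or_lt_of_le hr.1 with h | h
  · subst h
    have h1 : Tendsto u (𝓝[>] 0) (𝓝 (u 0)) := by
      refine (hu.cont 0 hr).tendsto.mono_left ?_
      rw [← nhdsWithin_Ioo_eq_nhdsGT pi_pos]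
      exact nhdsWithin_mono _ Ioo_subset_Ico_self
    have h2 : Tendsto u (𝓝[>] 0) (𝓝 c) := by
      refine tendsto_const_nhds.congr' ?_
      filter_upwards [Ioo_mem_nhdsGT pi_pos] with x hx
      exact (hopen x hx).symm
    exact tendsto_nhds_unique h1 h2
  · exact hopen r ⟨h, hr.2⟩

end InitialValueProblem

section Linear

lemma tendsto_atTop_of_flux_ge {n : ℕ} (hn : 1 ≤ n) {u z : ℝ → ℝ} {a c : ℝ} (ha : a ∈ Ioo 0 π)
    (hd : ∀ r ∈ Ico a π, HasDerivAt u (z r / sin r ^ n) r) (hc : 0 < c)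
    (hz : ∀ r ∈ Ico a π, c ≤ z r) : Tendsto u (𝓝[<] π) atTop := by
  have hmono : MonotoneOn (fun r => u r + c * log (π - r)) (Ico a π) := by
    have hder : ∀ r ∈ Ico a π, HasDerivAt (fun r => u r + c * log (π - r))
        (z r / sin r ^ n + c * (-1 / (π - r))) r := by
      intro r hr
      have h1 : HasDerivAt (fun r : ℝ => π - r) (-1) r := by
        simpa using (hasDerivAt_id r).const_sub π
      exact (hd r hr).add ((h1.log (by linarith [hr.2])).const_mul c)
    apply monotoneOn_of_hasDerivWithinAt_nonneg (convex_Ico a π)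
    · exact fun r hr => (hder r hr).continuousAt.continuousWithinAt
    · exact fun r hr => (hder r (interior_subset hr)).hasDerivWithinAt
    · intro r hr
      have hr := interior_subset hr
      have hr' : r ∈ Ioo 0 π := ⟨ha.1.trans_le hr.1, hr.2⟩
      have hg := sin_pow_pos (n := n) hr'
      have hs : 0 < sin r := sin_pos_of_pos_of_lt_pi hr'.1 hr'.2
      have hp : 0 < π - r := by linarith [hr.2]
      have h1 : sin r ^ n ≤ π - r :=
        calc sin r ^ n ≤ sin r ^ 1 := pow_le_pow_of_le_one hs.le (sin_le_one r) hn
          _ = sin (π - r) := by rw [pow_one, sin_pi_sub]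
          _ ≤ π - r := (sin_lt hp).le
      have h2 : c / (π - r) ≤ z r / sin r ^ n := by
        have := hz r hr
        have hz0 := hc.le.trans this
        gcongr
      have h3 : c * (-1 / (π - r)) = -(c / (π - r)) := by ring
      rw [h3]; linarith
  have hlog : Tendsto (fun r => -(c * log (π - r))) (𝓝[<] π) atTop := by
    have h1 : Tendsto (fun r : ℝ => π - r) (𝓝[<] π) (𝓝[>] 0) := by
      apply tendsto_nhdsWithin_of_tendsto_nhds_of_eventually_within
      · have : Tendsto (fun r : ℝ => π - r) (𝓝 π) (𝓝 (π - π)) :=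
          (continuous_const.sub continuous_id).tendsto π
        rw [sub_self] at this
        exact this.mono_left nhdsWithin_le_nhds
      · filter_upwards [self_mem_nhdsWithin] with r hr
        have : r < π := hr
        simpa using this
    have h2 := (tendsto_log_nhdsGT_zero.comp h1).const_mul_atBot hc
    exact tendsto_neg_atBot_atTop.comp h2
  have hb : Tendsto (fun r => (u a + c * log (π - a)) + -(c * log (π - r))) (𝓝[<] π) atTop :=
    tendsto_atTop_add_const_left _ _ hlog
  refine tendsto_atTop_mono' _ ?_ hb
  filter_upwards [Ioo_mem_nhdsLT ha.2] with r hr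
  have := hmono ⟨le_rfl, ha.2⟩ ⟨hr.1.le, hr.2⟩ hr.1.le
  simp only at this
  linarith

/-- `y` takes values of alternating signs `+, -, +, …` at `m + 1` increasing points of `(0, π)`. -/
def Alternates (y : ℝ → ℝ) (m : ℕ) : Prop :=
  ∃ s : ℕ → ℝ, (∀ i ≤ m, s i ∈ Ioo 0 π) ∧ (∀ i < m, s i < s (i + 1)) ∧
    ∀ i ≤ m, 0 < (-1) ^ i * y (s i)

lemma tendsto_nhdsGT_zero_of_continuousOn {u : ℝ → ℝ} (hu : ContinuousOn u (Ico 0 π)) :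
    Tendsto u (𝓝[>] 0) (𝓝 (u 0)) := by
  refine (hu 0 ⟨le_rfl, pi_pos⟩).tendsto.mono_left ?_
  rw [← nhdsWithin_Ioo_eq_nhdsGT pi_pos]
  exact nhdsWithin_mono _ Ioo_subset_Ico_self

lemma continuousOn_Ico_of_tendsto {u : ℝ → ℝ} (h0 : Tendsto u (𝓝[>] 0) (𝓝 (u 0)))
    (h : ∀ r ∈ Ioo 0 π, ContinuousAt u r) : ContinuousOn u (Ico 0 π) := by
  intro r hr
  rcases eq_or_lt_of_le hr.1 with h1 | h1
  · subst h1
    have : ContinuousWithinAt u (Ici 0) 0 := by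
      rw [← continuousWithinAt_Ioi_iff_Ici]
      exact h0
    exact this.mono fun x hx => hx.1
  · exact (h r ⟨h1, hr.2⟩).continuousWithinAt

lemma IsRadialSol.tendsto_flux_div {n : ℕ} {f u : ℝ → ℝ} (hu : IsRadialSol n f u)
    (hf : Continuous f) :
    Tendsto (fun r => flux n f u r / sin r ^ (n + 1)) (𝓝[>] 0) (𝓝 (-f (u 0) / (n + 1))) := by
  have hev : ∀ᶠ r in 𝓝[>] (0 : ℝ), r ∈ Ioo 0 (π / 2) := Ioo_mem_nhdsGT (by positivity)
  have hsub : ∀ r ∈ Ioo (0 : ℝ) (π / 2), r ∈ Ioo 0 π := fun r hr =>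
    ⟨hr.1, by linarith [hr.2, pi_pos]⟩
  apply HasDerivAt.lhopital_zero_nhdsGT (f' := fun r => -(sin r ^ n * f (u r)))
    (g' := fun r => (n + 1) * sin r ^ n * cos r)
  · filter_upwards [hev] with r hr using hu.hasDerivAt_flux hf (hsub r hr)
  · filter_upwards with r
    have := (hasDerivAt_sin r).fun_pow (n + 1)
    simpa using this
  · filter_upwards [hev] with r hr
    have h1 := sin_pow_pos (n := n) (hsub r hr)
    have h2 : 0 < cos r := cos_pos_of_mem_Ioo ⟨by linarith [hr.1, pi_pos], hr.2⟩
    positivity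
  · have := tendsto_nhdsGT_zero_of_continuousOn (hu.continuousOn_flux hf)
    rwa [flux_zero] at this
  · have : Tendsto (fun r => sin r ^ (n + 1)) (𝓝 0) (𝓝 (sin 0 ^ (n + 1))) :=
      (by fun_prop : Continuous fun r => sin r ^ (n + 1)).tendsto 0
    simp only [sin_zero, ne_eq, Nat.add_eq_zero_iff, one_ne_zero, and_false, not_false_eq_true,
      zero_pow] at this
    exact this.mono_left nhdsWithin_le_nhds
  · have h1 : Tendsto (fun r => -f (u r) / ((n + 1) * cos r)) (𝓝[>] 0)
        (𝓝 (-f (u 0) / ((n + 1) * cos 0))) := by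
      apply Tendsto.div
      · exact ((hf.tendsto _).comp (tendsto_nhdsGT_zero_of_continuousOn hu.cont)).neg
      · exact ((by fun_prop : Continuous fun r => ((n : ℝ) + 1) * cos r).tendsto 0).mono_left
          nhdsWithin_le_nhds
      · rw [cos_zero]; positivity
    rw [cos_zero, mul_one] at h1
    refine h1.congr' ?_
    filter_upwards [hev] with r hr
    have h1 := sin_pow_pos (n := n) (hsub r hr)
    have h2 : 0 < cos r := cos_pos_of_mem_Ioo ⟨by linarith [hr.1, pi_pos], hr.2⟩
    field_simp

lemma lipschitzWith_mul (ν : ℝ) : LipschitzWith ‖ν‖₊ (fun x : ℝ => ν * x) :=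
  LipschitzWith.of_dist_le_mul fun x y => by
    rw [Real.dist_eq, Real.dist_eq, ← mul_sub, abs_mul]; simp

lemma exists_pos_of_flux {n : ℕ} (hn : 1 ≤ n) {ν σ a : ℝ} (hν : 0 < ν) {φ : ℝ → ℝ}
    (hφ : IsRadialSol n (fun x => ν * x) φ) (ha : a ∈ Ioo 0 π)
    (hpos : 0 < σ * flux n (fun x => ν * x) φ a) :
    (∀ b ∈ Ioo a π, σ * flux n (fun x => ν * x) φ b < 0 → ∃ t ∈ Ioo a b, 0 < σ * φ t) ∧
      ∃ t ∈ Ioo a π, 0 < σ * φ t := by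
  have hf : Continuous fun x : ℝ => ν * x := by fun_prop
  have hmono : ∀ b ∈ Ioo a π, (∀ t ∈ Ioo a b, σ * φ t ≤ 0) →
      σ * flux n (fun x => ν * x) φ a ≤ σ * flux n (fun x => ν * x) φ b := by
    intro b hb hneg
    have hsub : ∀ r ∈ Icc a b, r ∈ Ioo 0 π := fun r hr =>
      ⟨ha.1.trans_le hr.1, hr.2.trans_lt hb.2⟩
    have : MonotoneOn (fun r => σ * flux n (fun x => ν * x) φ r) (Icc a b) := by
      apply monotoneOn_of_hasDerivWithinAt_nonneg (convex_Icc a b)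
        (f' := fun r => σ * -(sin r ^ n * (ν * φ r)))
      · exact fun r hr =>
          ((hφ.hasDerivAt_flux hf (hsub r hr)).const_mul σ).continuousAt.continuousWithinAt
      · exact fun r hr =>
          ((hφ.hasDerivAt_flux hf (hsub r (interior_subset hr))).const_mul σ).hasDerivWithinAt
      · intro r hr
        have hg := sin_pow_pos (n := n) (hsub r (interior_subset hr))
        rw [interior_Icc] at hr
        have := hneg r hr
        have h2 : σ * -(sin r ^ n * (ν * φ r)) = sin r ^ n * ν * -(σ * φ r) := by ring
        rw [h2]
        have : 0 ≤ -(σ * φ r) := by linarith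
        positivity
    exact this ⟨le_rfl, hb.1.le⟩ ⟨hb.1.le, le_rfl⟩ hb.1.le
  constructor
  · intro b hb hbneg
    by_contra! hcon
    linarith [hmono b hb hcon]
  · by_contra! hcon
    have hlim : Tendsto (fun r => σ * φ r) (𝓝[<] π) atTop := by
      apply tendsto_atTop_of_flux_ge hn ha (z := fun r => σ * flux n (fun x => ν * x) φ r) _ hpos
      · intro r hr
        rcases eq_or_lt_of_le hr.1 with h | h
        · rw [h]
        · exact hmono r ⟨h, hr.2⟩ fun t ht => hcon t ⟨ht.1, ht.2.trans hr.2⟩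
      · intro r hr
        rw [mul_div_assoc]
        exact (hφ.hasDerivAt hf ⟨ha.1.trans_le hr.1, hr.2⟩).const_mul σ
    obtain ⟨r, hr, hr'⟩ := ((hlim.eventually_gt_atTop 0).and (Ioo_mem_nhdsLT ha.2)).exists
    linarith [hcon r hr']

lemma exists_pos_near_zero {φ : ℝ → ℝ} (hφ : ContinuousOn φ (Ico 0 π)) (h0 : 0 < φ 0) {b : ℝ}
    (hb : b ∈ Ioc 0 π) : ∃ a ∈ Ioo 0 b, ∀ r ∈ Icc 0 a, 0 < φ r := by
  have h1 : ∀ᶠ r in 𝓝[>] (0 : ℝ), 0 < φ r ∧ r < b := by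
    have h2 := (tendsto_nhdsGT_zero_of_continuousOn hφ).eventually (lt_mem_nhds h0)
    filter_upwards [h2, Ioo_mem_nhdsGT hb.1] with r hr hr'
    exact ⟨hr, hr'.2⟩
  obtain ⟨c, hc, hc'⟩ := mem_nhdsGT_iff_exists_Ioc_subset.1 h1
  refine ⟨c, ⟨hc, (hc' ⟨hc, le_rfl⟩).2⟩, fun r hr => ?_⟩
  rcases eq_or_lt_of_le hr.1 with h | h
  · rwa [← h]
  · exact (hc' ⟨h, hr.2⟩).1

/-- If `φ` solves the linear equation with weight `sinⁿ`, then `-φ' / sin` solves one with weight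
`sinⁿ⁺²`. -/
lemma isRadialSol_derivative {n : ℕ} {ν : ℝ} {φ : ℝ → ℝ}
    (hφ : IsRadialSol n (fun x => ν * x) φ) :
    ∃ χ : ℝ → ℝ, IsRadialSol (n + 2) (fun x => (ν - (n + 1)) * x) χ ∧
      χ 0 = ν * φ 0 / (n + 1) ∧
      ∀ r ∈ Ioo 0 π, χ r = -(flux n (fun x => ν * x) φ r / sin r ^ (n + 1)) := by
  have hf : Continuous fun x : ℝ => ν * x := by fun_prop
  set z := flux n (fun x => ν * x) φ with hzdef
  let χ : ℝ → ℝ := fun r => if r = 0 then ν * φ 0 / (n + 1) else -(z r / sin r ^ (n + 1))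
  have hχ : ∀ r ∈ Ioo 0 π, χ r = -(z r / sin r ^ (n + 1)) := fun r hr => by
    simp [χ, hr.1.ne']
  let K : ℝ → ℝ := fun r => ν * sin r ^ (n + 1) * φ r + (n + 1) * cos r * z r
  have hz : ∀ r ∈ Ioo 0 π, HasDerivAt z (-(sin r ^ n * (ν * φ r))) r := fun r hr =>
    hφ.hasDerivAt_flux hf hr
  have hφd : ∀ r ∈ Ioo 0 π, HasDerivAt φ (z r / sin r ^ n) r := fun r hr => hφ.hasDerivAt hf hr
  have hsinpow : ∀ r, HasDerivAt (fun r => sin r ^ (n + 1)) ((n + 1) * sin r ^ n * cos r) r := by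
    intro r
    simpa using (hasDerivAt_sin r).fun_pow (n + 1)
  have hχd : ∀ r ∈ Ioo 0 π, HasDerivAt χ (K r / sin r ^ (n + 2)) r := by
    intro r hr
    have hs : 0 < sin r := sin_pos_of_pos_of_lt_pi hr.1 hr.2
    have h1 := ((hz r hr).div (hsinpow r) (by positivity)).neg
    have h2 : HasDerivAt χ _ r := h1.congr_of_eventuallyEq (by
      filter_upwards [isOpen_Ioo.mem_nhds hr] with x hx
      exact hχ x hx)
    refine h2.congr_deriv ?_
    simp only [K]
    field_simp
    ring
  have hχc : ContinuousOn χ (Ico 0 π) := by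
    apply continuousOn_Ico_of_tendsto
    · have h1 := (hφ.tendsto_flux_div hf).neg
      have h2 : χ 0 = -(-(ν * φ 0) / (n + 1)) := by simp [χ, neg_div]
      rw [h2]
      refine h1.congr' ?_
      filter_upwards [Ioo_mem_nhdsGT pi_pos] with r hr
      exact (hχ r hr).symm
    · exact fun r hr => (hχd r hr).continuousAt
  have hflux : ∀ r ∈ Ico 0 π, flux (n + 2) (fun x => (ν - (n + 1)) * x) χ r = K r := by
    intro r hr
    have hKd : ∀ x ∈ Ioo 0 π,
        HasDerivAt K (-(sin x ^ (n + 2) * ((ν - (n + 1)) * χ x))) x := by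
      intro x hx
      have hs : 0 < sin x := sin_pos_of_pos_of_lt_pi hx.1 hx.2
      have h1 := (((hsinpow x).const_mul ν).mul (hφd x hx)).add
        (((hasDerivAt_cos x).const_mul ((n : ℝ) + 1)).mul (hz x hx))
      refine h1.congr_deriv ?_
      rw [hχ x hx]
      field_simp
      ring
    have hKc : ContinuousOn K (Ico 0 π) := by
      have h1 := hφ.cont
      have h2 : ContinuousOn z (Ico 0 π) := hφ.continuousOn_flux hf
      fun_prop
    have hcts : ContinuousOn (fun x => -(sin x ^ (n + 2) * ((ν - (n + 1)) * χ x))) (Ico 0 π) := by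
      fun_prop
    have h := intervalIntegral.integral_eq_sub_of_hasDerivAt_of_le hr.1
      (hKc.mono fun x hx => ⟨hx.1, hx.2.trans_lt hr.2⟩)
      (fun x hx => hKd x ⟨hx.1, hx.2.trans hr.2⟩)
      (hcts.mono (uIcc_subset_Ico hr)).intervalIntegrable
    have hK0 : K 0 = 0 := by simp [K, hzdef, flux_zero]
    rw [intervalIntegral.integral_neg, hK0, sub_zero] at h
    exact h
  refine ⟨χ, ?_, by simp [χ], hχ⟩
  apply IsRadialSol.of_hasDerivAt (by fun_prop) hχc
  intro r hr
  rw [hflux r ⟨hr.1.le, hr.2⟩]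
  exact hχd r hr

/-- Past the `k`-th eigenvalue `k (k + n)` the regular solution of the linear equation has at least
`k + 1` sign changes. -/
lemma alternates_of_eigenvalue_lt (k : ℕ) : ∀ {n : ℕ}, 1 ≤ n → ∀ {ν : ℝ}, (k : ℝ) * (k + n) < ν →
    ∀ {φ : ℝ → ℝ}, IsRadialSol n (fun x => ν * x) φ → 0 < φ 0 → Alternates φ (k + 1) := by
  induction k with
  | zero =>
    intro n hn ν hν φ hφ h0
    have hν : 0 < ν := by simpa using hν
    obtain ⟨a, ha, hpos⟩ := exists_pos_near_zero hφ.cont h0 ⟨pi_pos, le_rfl⟩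
    have hflux : flux n (fun x => ν * x) φ a < 0 := by
      unfold flux
      rw [neg_lt_zero]
      apply intervalIntegral.intervalIntegral_pos_of_pos_on
      · exact intervalIntegrable_sin_pow_mul (hφ.continuousOn_comp (by fun_prop)) ⟨ha.1.le, ha.2⟩
      · intro x hx
        have h1 := sin_pow_pos (n := n) ⟨hx.1, hx.2.trans ha.2⟩
        have h2 := hpos x ⟨hx.1.le, hx.2.le⟩
        positivity
      · exact ha.1
    obtain ⟨t, ht, htn⟩ := (exists_pos_of_flux hn hν hφ ha (σ := -1) (by linarith)).2
    refine ⟨fun i => if i = 0 then a else t, ?_, ?_, ?_⟩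
    · intro i _
      by_cases h : i = 0
      · simpa [h] using ha
      · simpa [h] using ⟨ha.1.trans ht.1, ht.2⟩
    · intro i hi
      have : i = 0 := by omega
      simpa [this] using ht.1
    · intro i hi
      have : i = 0 ∨ i = 1 := by omega
      rcases this with h | h
      · simpa [h] using hpos a ⟨ha.1.le, le_rfl⟩
      · simpa [h] using htn
  | succ k ih =>
    intro n hn ν hν φ hφ h0
    have hn1 : (0 : ℝ) < n + 1 := by positivity
    have hν0 : 0 < ν := lt_of_le_of_lt (by positivity) hν
    obtain ⟨χ, hχ, hχ0, hχr⟩ := isRadialSol_derivative hφ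
    obtain ⟨s, hs, hsm, hss⟩ := ih (by omega : 1 ≤ n + 2) (ν := ν - (n + 1))
      (by push_cast at hν ⊢; linarith) hχ (by rw [hχ0]; positivity)
    set z := flux n (fun x => ν * x) φ with hz
    have hzs : ∀ i ≤ k + 1, 0 < (-1) ^ (i + 1) * z (s i) := by
      intro i hi
      have h1 := hss i hi
      have h2 := sin_pow_pos (n := n + 1) (hs i hi)
      rw [hχr _ (hs i hi)] at h1
      have h3 : (-1) ^ (i + 1) * z (s i)
          = ((-1) ^ i * -(z (s i) / sin (s i) ^ (n + 1))) * sin (s i) ^ (n + 1) := by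
        rw [pow_succ]; field_simp
      rw [h3]; positivity
    obtain ⟨a, ha, hpos⟩ := exists_pos_near_zero hφ.cont h0 ⟨(hs 0 (by omega)).1, (hs 0 (by omega)).2.le⟩
    have hstep : ∀ i, ∃ t, i ≤ k + 1 →
        s i < t ∧ t < π ∧ (i < k + 1 → t < s (i + 1)) ∧ 0 < (-1) ^ (i + 1) * φ t := by
      intro i
      by_cases hi : i ≤ k + 1
      · have h := exists_pos_of_flux hn hν0 hφ (hs i hi) (hzs i hi)
        by_cases hi' : i < k + 1
        · obtain ⟨t, ht, htp⟩ := h.1 (s (i + 1)) ⟨hsm i hi', (hs (i + 1) hi').2⟩ (by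
            have := hzs (i + 1) hi'
            rw [pow_succ] at this
            linarith)
          exact ⟨t, fun _ => ⟨ht.1, ht.2.trans (hs (i + 1) hi').2, fun _ => ht.2, htp⟩⟩
        · obtain ⟨t, ht, htp⟩ := h.2
          exact ⟨t, fun _ => ⟨ht.1, ht.2, fun h => absurd h hi', htp⟩⟩
      · exact ⟨0, fun h => absurd h hi⟩
    choose t ht using hstep
    refine ⟨fun i => if i = 0 then a else t (i - 1), ?_, ?_, ?_⟩
    · intro i hi
      rcases i with _ | i
      · simpa using ⟨ha.1, ha.2.trans (hs 0 (by omega)).2⟩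
      · have := ht i (by omega)
        simpa using ⟨(hs i (by omega)).1.trans this.1, this.2.1⟩
    · intro i hi
      rcases i with _ | i
      · simpa using ha.2.trans (ht 0 (by omega)).1
      · have h1 := (ht i (by omega)).2.2.1 (by omega)
        have h2 := (ht (i + 1) (by omega)).1
        simpa using h1.trans h2
    · intro i hi
      rcases i with _ | i
      · simpa using hpos a ⟨ha.1.le, le_rfl⟩
      · simpa using (ht i (by omega)).2.2.2

end Linear

section Linearization

lemma sinMean_zero_fun (n : ℕ) (s : ℝ) : sinMean n (fun _ => 0) s = 0 := by simp [sinMean]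

lemma isRadialSol_const (n : ℕ) {f : ℝ → ℝ} {c : ℝ} (hc : f c = 0) :
    IsRadialSol n f fun _ => c :=
  ⟨continuousOn_const, fun r _ => by simp [hc, sinMean_zero_fun]⟩

lemma sinMean_const_mul (n : ℕ) (a : ℝ) (h : ℝ → ℝ) (s : ℝ) :
    sinMean n (fun t => a * h t) s = a * sinMean n h s := by
  simp only [sinMean, mul_left_comm _ a, intervalIntegral.integral_const_mul, mul_div_assoc]

/-- Solutions starting near an equilibrium are governed by the linearized equation. -/
lemma tendsto_linearization {n : ℕ} (hn : 1 ≤ n) {L : ℝ≥0} {f : ℝ → ℝ} (hf : LipschitzWith L f)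
    {w ν : ℝ} (hw : f w = 0) (hν : HasDerivAt f ν w) {φ : ℝ → ℝ}
    (hφ : IsRadialSol n (fun x => ν * x) φ) (hφ0 : φ 0 = 1) {u : ℝ → ℝ → ℝ}
    (hu : ∀ α, IsRadialSol n f (u α)) (hu0 : ∀ α, u α 0 = α) {R : ℝ} (hR : R ∈ Ico 0 π) :
    Tendsto (fun α => (u α R - w) / (α - w)) (𝓝[≠] w) (𝓝 (φ R)) := by
  let M : ℝ≥0 := L + ‖ν‖₊
  have hfM : LipschitzWith M f := hf.weaken le_self_add
  have hνM : |ν| ≤ M := by simp [M]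
  set W := weightExp n M
  have hsub : ∀ t ∈ Icc 0 R, t ∈ Ico 0 π := fun t ht => ⟨ht.1, ht.2.trans_lt hR.2⟩
  rw [Metric.tendsto_nhds]
  intro ε hε
  set C := exp (W R) with hC
  have hC0 : 0 < C := exp_pos _
  obtain ⟨δ, hδ, hδC⟩ : ∃ δ > 0, 2 * (δ * C) * C < ε :=
    ⟨ε / (4 * C * C), by positivity, by field_simp; linarith⟩
  have hlin : ∀ᶠ x in 𝓝 w, |f x - ν * (x - w)| ≤ δ * |x - w| := by
    have := (hasDerivAt_iff_isLittleO.1 hν).def hδ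
    filter_upwards [this] with x hx
    simpa [hw, mul_comm] using hx
  obtain ⟨η, hη, hηl⟩ := Metric.eventually_nhds_iff.1 hlin
  have hnear : ∀ᶠ α in 𝓝[≠] w, |α - w| < η / (2 * C) := by
    have : ∀ᶠ α in 𝓝 w, dist α w < η / (2 * C) := Metric.ball_mem_nhds w (by positivity)
    exact (this.filter_mono nhdsWithin_le_nhds)
  filter_upwards [hnear, self_mem_nhdsWithin] with α hα hαw
  have hαw : α - w ≠ 0 := sub_ne_zero.2 hαw
  have habs : 0 < |α - w| := abs_pos.2 hαw
  have hY : ∀ t ∈ Icc 0 R, |u α t - w| ≤ 2 * |α - w| * exp (W t) := by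
    intro t ht
    have := abs_sub_le_of_isRadialSol hn hfM (hu α) (isRadialSol_const n hw) (hsub t ht)
    simpa [hu0] using this
  let Y : ℝ → ℝ := fun t => (α - w)⁻¹ * (u α t - w)
  let D : ℝ → ℝ := fun t => Y t - φ t
  let p : ℝ → ℝ := fun t => (α - w)⁻¹ * f (u α t)
  have hpc : ContinuousOn p (Ico 0 π) :=
    continuousOn_const.mul ((hu α).continuousOn_comp hf.continuous)
  have hYc : ContinuousOn Y (Ico 0 π) := continuousOn_const.mul ((hu α).cont.sub continuousOn_const)
  have hDc : ContinuousOn D (Ico 0 π) := hYc.sub hφ.cont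
  have hνD : ContinuousOn (fun t => ν * D t) (Ico 0 π) := continuousOn_const.mul hDc
  have hrest : ContinuousOn (fun t => p t - ν * Y t) (Ico 0 π) := hpc.sub (continuousOn_const.mul hYc)
  have hDeq : ∀ r ∈ Icc 0 R, D r = -(∫ s in (0 : ℝ)..r, sinMean n (fun t => p t - ν * Y t) s)
      - ∫ s in (0 : ℝ)..r, sinMean n (fun t => ν * D t) s := by
    intro r hr
    have e1 : Y r = 1 - ∫ s in (0 : ℝ)..r, sinMean n p s := by
      simp only [Y, p, sinMean_const_mul, intervalIntegral.integral_const_mul]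
      rw [(hu α).eq r (hsub r hr), hu0]
      field_simp
      ring
    have e2 : φ r = 1 - ∫ s in (0 : ℝ)..r, sinMean n (fun t => ν * φ t) s := by
      rw [hφ.eq r (hsub r hr), hφ0]
    have e3 := integral_sinMean_sub (n := n) hpc (hφ.continuousOn_comp (f := fun x => ν * x)
      (by fun_prop)) (hsub r hr)
    have e4 := integral_sinMean_sub (n := n) (hpc.sub (hφ.continuousOn_comp (f := fun x => ν * x)
      (by fun_prop))) hνD (hsub r hr)
    have e5 : (fun t => (p - fun t => ν * φ t) t - ν * D t) = fun t => p t - ν * Y t := by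
      funext t; simp only [D, Pi.sub_apply]; ring
    rw [e5] at e4
    have e6 : (p - fun t => ν * φ t) = fun t => p t - ν * φ t := rfl
    rw [e6, e3] at e4
    rw [e4]
    show Y r - φ r = _
    rw [e1, e2]; ring
  have hrestb : ∀ r ∈ Icc 0 R,
      |∫ s in (0 : ℝ)..r, sinMean n (fun t => p t - ν * Y t) s| ≤ δ * C := by
    intro r hr
    have h1 := abs_integral_sinMean_le (n := n) (L := M) hn M.2 hrest (A := 2 * δ) (by positivity)
      (hsub r hr) (by
        intro t ht
        have ht' : t ∈ Icc 0 R := ⟨ht.1, ht.2.trans hr.2⟩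
        have h2 := hY t ht'
        have h3 : exp (W t) ≤ C := exp_le_exp.2 (weightExp_mono M.2 ht'.2 hR.2)
        have h4 : |u α t - w| < η := by
          calc |u α t - w| ≤ 2 * |α - w| * C := h2.trans (by gcongr)
            _ < 2 * (η / (2 * C)) * C := by gcongr
            _ = η := by field_simp
        have h5 := hηl (y := u α t) (by rwa [Real.dist_eq])
        have h6 : p t - ν * Y t = (α - w)⁻¹ * (f (u α t) - ν * (u α t - w)) := by
          simp only [p, Y]; ring
        rw [h6, abs_mul, abs_inv, inv_mul_le_iff₀ habs]
        calc |f (u α t) - ν * (u α t - w)| ≤ δ * |u α t - w| := h5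
          _ ≤ δ * (2 * |α - w| * exp (W t)) := by gcongr
          _ = _ := by ring)
    refine h1.trans ?_
    have h3 : exp (W r) ≤ C := exp_le_exp.2 (weightExp_mono M.2 hr.2 hR.2)
    have h4 : 2 * δ / (2 * ((M : ℝ) + 1)) ≤ δ := by
      rw [div_le_iff₀ (by positivity)]
      nlinarith [mul_nonneg hδ.le M.2]
    gcongr
  have hgr := gronwall_sinMean (n := n) hn (L := M) (ε := δ * C) M.2 (by positivity) hR hDc hνD
    (fun t _ => by rw [abs_mul]; gcongr) (fun r hr => by
      rw [hDeq r hr]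
      refine (abs_sub _ _).trans ?_
      rw [abs_neg]
      gcongr
      exact hrestb r hr) R ⟨hR.1, le_rfl⟩
  rw [Real.dist_eq]
  have : (u α R - w) / (α - w) - φ R = D R := by simp only [D, Y]; ring
  rw [this]
  exact hgr.trans_lt hδC

end Linearization

lemma exists_first_nonneg {h : ℝ → ℝ} {a b : ℝ} (hab : a ≤ b) (hc : ContinuousOn h (Icc a b))
    (ha : h a < 0) (hb : 0 ≤ h b) : ∃ c ∈ Ioc a b, h c = 0 ∧ ∀ s ∈ Ico a c, h s < 0 := by
  have hcl : IsCompact (Icc a b ∩ h ⁻¹' Ici 0) :=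
    isCompact_Icc.of_isClosed_subset (hc.preimage_isClosed_of_isClosed isClosed_Icc isClosed_Ici)
      inter_subset_left
  obtain ⟨c, ⟨hc1, hc2⟩, hmin⟩ := hcl.exists_isLeast ⟨b, ⟨hab, le_rfl⟩, hb⟩
  have hc2' : 0 ≤ h c := hc2
  have hlt : ∀ s ∈ Ico a c, h s < 0 := by
    intro s hs
    by_contra! hcon
    exact absurd (hmin ⟨⟨hs.1, hs.2.le.trans hc1.2⟩, hcon⟩) (not_le.2 hs.2)
  have hac : a < c := by
    rcases eq_or_lt_of_le hc1.1 with h1 | h1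
    · subst h1; linarith
    · exact h1
  refine ⟨c, ⟨hac, hc1.2⟩, ?_, hlt⟩
  by_contra hne
  have hpos : 0 < h c := lt_of_le_of_ne hc2' (Ne.symm hne)
  obtain ⟨t, ht, ht0⟩ := intermediate_value_Ioo hac.le (hc.mono (Icc_subset_Icc_right hc1.2))
    ⟨ha, hpos⟩
  have := hlt t ⟨ht.1.le, ht.2⟩
  linarith

section Counting

variable {x d : ℝ → ℝ}

lemma finite_zeros (hx : ContinuousOn x (Ico 0 π)) (h0 : x 0 ≠ 0)
    (hd : ∀ r ∈ Ioo 0 π, HasDerivAt x (d r) r) (hs : ∀ r ∈ Ioo 0 π, x r = 0 → d r ≠ 0)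
    {R : ℝ} (hR : R < π) : {r | r ∈ Ioc 0 R ∧ x r = 0}.Finite := by
  by_contra hinf
  obtain ⟨c, hc, hacc⟩ := Set.Infinite.exists_accPt_of_subset_isCompact hinf
    (isCompact_Icc (a := (0 : ℝ)) (b := R)) (fun r hr => Ioc_subset_Icc_self hr.1)
  rw [accPt_iff_frequently_nhdsNE] at hacc
  rcases eq_or_lt_of_le hc.1 with h1 | h1
  · subst h1
    have hev : ∀ᶠ r in 𝓝[Ico 0 π] (0 : ℝ), x r ≠ 0 :=
      (hx 0 ⟨le_rfl, pi_pos⟩).eventually_ne h0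
    rw [eventually_nhdsWithin_iff] at hev
    refine hacc ((hev.filter_mono nhdsWithin_le_nhds).mono fun r hr hr' => ?_)
    exact hr ⟨hr'.1.1.le, hr'.1.2.trans_lt hR⟩ hr'.2
  · have hc' : c ∈ Ioo 0 π := ⟨h1, hc.2.trans_lt hR⟩
    by_cases hxc : x c = 0
    · exact hacc (((hd c hc').eventually_ne (hs c hc' hxc)).mono fun r hr hr' => hr hr'.2)
    · exact hacc ((((hd c hc').continuousAt.eventually_ne hxc).filter_mono
        nhdsWithin_le_nhds).mono fun r hr hr' => hr hr'.2)

lemma pos_of_ne_zero_of_pos {y : ℝ → ℝ} {a b : ℝ} (hc : ContinuousOn y (Icc a b))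
    (hne : ∀ r ∈ Icc a b, y r ≠ 0) (hb : 0 < y a ∨ 0 < y b) : ∀ r ∈ Icc a b, 0 < y r := by
  intro r hr
  by_contra! hcon
  have hz : ∃ t ∈ Icc a b, y t = 0 := by
    rcases hb with hb | hb
    · obtain ⟨t, ht, h⟩ := intermediate_value_Icc' hr.1 (hc.mono (Icc_subset_Icc_right hr.2))
        ⟨hcon, hb.le⟩
      exact ⟨t, ⟨ht.1, ht.2.trans hr.2⟩, h⟩
    · obtain ⟨t, ht, h⟩ := intermediate_value_Icc hr.2 (hc.mono (Icc_subset_Icc_left hr.1))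
        ⟨hcon, hb.le⟩
      exact ⟨t, ⟨hr.1.trans ht.1, ht.2⟩, h⟩
  obtain ⟨t, ht, h⟩ := hz
  exact hne t ht h

lemma exists_alternation (hx : ContinuousOn x (Ico 0 π)) (h0 : 0 < x 0)
    (hd : ∀ r ∈ Ioo 0 π, HasDerivAt x (d r) r) (hs : ∀ r ∈ Ioo 0 π, x r = 0 → d r ≠ 0) (m : ℕ) :
    ∀ R ∈ Ioo 0 π, x R ≠ 0 → {r | r ∈ Ioo 0 R ∧ x r = 0}.ncard = m →
      ∃ s : ℕ → ℝ, (∀ i ≤ m, s i ∈ Ioo 0 π) ∧ (∀ i < m, s i < s (i + 1)) ∧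
        (∀ i ≤ m, 0 < (-1) ^ i * x (s i)) ∧ s m = R := by
  have hfin : ∀ R < π, {r | r ∈ Ioo 0 R ∧ x r = 0}.Finite := fun R hR =>
    (finite_zeros hx h0.ne' hd hs hR).subset fun r hr => ⟨Ioo_subset_Ioc_self hr.1, hr.2⟩
  induction m with
  | zero =>
    intro R hR hxR hcard
    rw [Set.ncard_eq_zero (hfin R hR.2)] at hcard
    refine ⟨fun _ => R, fun _ _ => hR, fun i hi => absurd hi (Nat.not_lt_zero i), ?_, rfl⟩
    intro i hi
    obtain rfl : i = 0 := Nat.le_zero.1 hi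
    have := pos_of_ne_zero_of_pos (hx.mono fun t ht => ⟨ht.1, ht.2.trans_lt hR.2⟩) (by
      intro r hr hr0
      rcases eq_or_lt_of_le hr.1 with h1 | h1
      · rw [← h1] at hr0; exact h0.ne' hr0
      rcases eq_or_lt_of_le hr.2 with h2 | h2
      · rw [h2] at hr0; exact hxR hr0
      exact (Set.eq_empty_iff_forall_notMem.1 hcard r) ⟨⟨h1, h2⟩, hr0⟩) (Or.inl h0) R
        ⟨hR.1.le, le_rfl⟩
    simpa using this
  | succ m ih =>
    intro R hR hxR hcard
    have hne : {r | r ∈ Ioo 0 R ∧ x r = 0}.Nonempty := by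
      rw [← Set.ncard_pos (hfin R hR.2)]; omega
    obtain ⟨ζ, ⟨hζ, hxζ⟩, hmax⟩ := (hfin R hR.2).exists_maximalFor id _ hne
    have hmax' : ∀ r ∈ Ioo 0 R, x r = 0 → r ≤ ζ := fun r hr hr0 => by
      by_contra! hcon
      exact absurd (hmax (j := r) ⟨hr, hr0⟩ hcon.le) (not_le.2 hcon)
    have hζπ : ζ ∈ Ioo 0 π := ⟨hζ.1, hζ.2.trans hR.2⟩
    have hder := hd ζ hζπ
    have hdne := hs ζ hζπ hxζ
    have hev : ∀ᶠ r in 𝓝[<] ζ, x r ≠ 0 ∧ 0 < r := by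
      refine ((hder.eventually_ne hdne).filter_mono ?_).and ?_
      · exact nhdsWithin_mono _ fun r hr => ne_of_lt hr
      · exact nhdsWithin_le_nhds (lt_mem_nhds hζ.1)
    obtain ⟨R', hR', hR'sub⟩ := mem_nhdsLT_iff_exists_Ico_subset.1 hev
    have hR'0 : 0 < R' := (hR'sub ⟨le_rfl, hR'⟩).2
    have hR'ζ : R' < ζ := hR'
    have hset : {r | r ∈ Ioo 0 R ∧ x r = 0} = insert ζ {r | r ∈ Ioo 0 R' ∧ x r = 0} := by
      ext r
      rw [mem_insert_iff]
      constructor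
      · rintro ⟨hr, hr0⟩
        rcases eq_or_lt_of_le (hmax' r hr hr0) with h1 | h1
        · exact Or.inl h1
        · refine Or.inr ⟨⟨hr.1, ?_⟩, hr0⟩
          by_contra! hcon
          exact (hR'sub ⟨hcon, h1⟩).1 hr0
      · rintro (rfl | ⟨hr, hr0⟩)
        · exact ⟨hζ, hxζ⟩
        · exact ⟨⟨hr.1, hr.2.trans (hR'ζ.trans hζ.2)⟩, hr0⟩
    have hcard' : {r | r ∈ Ioo 0 R' ∧ x r = 0}.ncard = m := by
      rw [hset, Set.ncard_insert_of_notMem (fun h => absurd h.1.2 (not_lt.2 hR'ζ.le))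
        (hfin R' (hR'ζ.trans hζπ.2))] at hcard
      omega
    obtain ⟨s, hs1, hs2, hs3, hs4⟩ := ih R' ⟨hR'0, hR'ζ.trans hζπ.2⟩
      (hR'sub ⟨le_rfl, hR'⟩).1 hcard'
    have hsign : (-1 : ℝ) ^ m * x R < 0 := by
      by_contra! hcon
      have hσ : (-1 : ℝ) ^ m ≠ 0 := pow_ne_zero _ (by norm_num)
      have hRpos : 0 < (-1 : ℝ) ^ m * x R := lt_of_le_of_ne hcon (mul_ne_zero hσ hxR).symm
      have hR'pos : 0 < (-1 : ℝ) ^ m * x R' := by simpa [hs4] using hs3 m le_rfl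
      have hcσ : ContinuousOn (fun r => (-1 : ℝ) ^ m * x r) (Ico 0 π) := continuousOn_const.mul hx
      have hloc : IsLocalMin (fun r => (-1 : ℝ) ^ m * x r) ζ := by
        filter_upwards [Ioo_mem_nhds hR'ζ hζ.2] with r hr
        simp only [hxζ, mul_zero]
        rcases lt_trichotomy r ζ with h1 | h1 | h1
        · refine (pos_of_ne_zero_of_pos (y := fun r => (-1 : ℝ) ^ m * x r)
            (hcσ.mono fun t ht => ⟨hR'0.le.trans ht.1, ht.2.trans_lt (h1.trans hζπ.2)⟩)
            (fun t ht => mul_ne_zero hσ (hR'sub ⟨ht.1, ht.2.trans_lt h1⟩).1)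
            (Or.inl hR'pos) r ⟨hr.1.le, le_rfl⟩).le
        · simp [h1, hxζ]
        · refine (pos_of_ne_zero_of_pos (y := fun r => (-1 : ℝ) ^ m * x r)
            (hcσ.mono fun t ht => ⟨(hζ.1.trans h1).le.trans ht.1, ht.2.trans_lt hR.2⟩)
            (fun t ht => mul_ne_zero hσ fun ht0 => ?_)
            (Or.inr hRpos) r ⟨le_rfl, hr.2.le⟩).le
          rcases eq_or_lt_of_le ht.2 with h2 | h2
          · rw [h2] at ht0; exact hxR ht0
          · exact absurd (hmax' t ⟨(hζ.1.trans h1).trans_le ht.1, h2⟩ ht0)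
              (not_le.2 (h1.trans_le ht.1))
      exact mul_ne_zero hσ hdne (hloc.hasDerivAt_eq_zero (hder.const_mul _))
    refine ⟨fun i => if i ≤ m then s i else R, ?_, ?_, ?_, by simp⟩
    · intro i hi
      simp only
      split_ifs with h
      · exact hs1 i h
      · exact hR
    · intro i hi
      simp only
      by_cases h : i + 1 ≤ m
      · rw [if_pos (by omega), if_pos h]; exact hs2 i (by omega)
      · rw [if_pos (by omega), if_neg h]
        obtain rfl : i = m := by omega
        rw [hs4]; exact hR'ζ.trans hζ.2
    · intro i hi
      simp only
      split_ifs with h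
      · exact hs3 i h
      · obtain rfl : i = m + 1 := by omega
        rw [pow_succ]; linarith

lemma Alternates.mono {m M : ℕ} (hmM : m ≤ M) (h : Alternates x M) : Alternates x m := by
  obtain ⟨s, h1, h2, h3⟩ := h
  exact ⟨s, fun i hi => h1 i (hi.trans hmM), fun i hi => h2 i (hi.trans_le hmM),
    fun i hi => h3 i (hi.trans hmM)⟩

lemma exists_zeros_of_not_alternates (hx : ContinuousOn x (Ico 0 π)) (h0 : 0 < x 0)
    (hd : ∀ r ∈ Ioo 0 π, HasDerivAt x (d r) r) (hs : ∀ r ∈ Ioo 0 π, x r = 0 → d r ≠ 0) {m : ℕ}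
    (hm : ¬ Alternates x m) :
    ∃ Z : Finset ℝ, (∀ r, r ∈ Z ↔ r ∈ Ioo 0 π ∧ x r = 0) ∧ Z.card < m := by
  set S : Set ℝ := {r | r ∈ Ioo 0 π ∧ x r = 0} with hS
  have key : ∀ T : Finset ℝ, (T : Set ℝ) ⊆ S → T.card < m := by
    intro T hT
    by_contra! hcon
    apply hm
    set R₀ := (insert (π / 2) T).max' ⟨π / 2, Finset.mem_insert_self _ _⟩ with hR₀
    have hR₀mem : R₀ ∈ insert (π / 2) T := Finset.max'_mem _ _
    have hR₀' : R₀ ∈ Ioo 0 π := by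
      rcases Finset.mem_insert.1 hR₀mem with h | h
      · rw [h]; exact ⟨by positivity, by linarith [pi_pos]⟩
      · exact (hT h).1
    obtain ⟨R₁, hR₁, hR₁π⟩ := exists_between hR₀'.2
    obtain ⟨R, hR, hRn⟩ := (Ioo_infinite hR₁).exists_notMem_finite
      (finite_zeros hx h0.ne' hd hs hR₁π)
    have hRπ : R ∈ Ioo 0 π := ⟨hR₀'.1.trans hR.1, hR.2.trans hR₁π⟩
    have hxR : x R ≠ 0 := fun h => hRn ⟨⟨hRπ.1, hR.2.le⟩, h⟩
    have hfin : {r | r ∈ Ioo 0 R ∧ x r = 0}.Finite :=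
      (finite_zeros hx h0.ne' hd hs hRπ.2).subset fun r hr => ⟨Ioo_subset_Ioc_self hr.1, hr.2⟩
    obtain ⟨s, h1, h2, h3, -⟩ := exists_alternation hx h0 hd hs _ R hRπ hxR rfl
    refine Alternates.mono (hcon.trans ?_) ⟨s, h1, h2, h3⟩
    rw [← Set.ncard_coe_finset]
    refine Set.ncard_le_ncard (fun t ht => ⟨⟨(hT ht).1.1, ?_⟩, (hT ht).2⟩) hfin
    exact ((Finset.le_max' _ t (Finset.mem_insert_of_mem ht))).trans_lt hR.1
  have hfin : S.Finite := by
    by_contra hinf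
    obtain ⟨T, hT, hc⟩ := Set.Infinite.exists_subset_card_eq hinf m
    exact absurd (key T hT) (by omega)
  exact ⟨hfin.toFinset, fun r => hfin.mem_toFinset, key _ hfin.coe_toFinset.subset⟩

lemma Alternates.exists_zeros (hx : ContinuousOn x (Ico 0 π)) {m : ℕ} (h : Alternates x m) :
    ∃ ζ : Fin m → ℝ, StrictMono ζ ∧ ∀ q, ζ q ∈ Ioo 0 π ∧ x (ζ q) = 0 := by
  obtain ⟨s, h1, h2, h3⟩ := h
  have hz : ∀ q : Fin m, ∃ t ∈ Ioo (s q) (s (q + 1)), x t = 0 := by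
    intro q
    have hq := q.2
    have hlt := h2 q hq
    have hc : ContinuousOn (fun r => (-1 : ℝ) ^ (q : ℕ) * x r) (Icc (s q) (s (q + 1))) :=
      continuousOn_const.mul (hx.mono fun t ht =>
        ⟨(h1 q hq.le).1.le.trans ht.1, ht.2.trans_lt (h1 (q + 1) hq).2⟩)
    have ha := h3 q hq.le
    have hb := h3 (q + 1) hq
    rw [pow_succ] at hb
    obtain ⟨t, ht, ht0⟩ := intermediate_value_Ioo' hlt.le hc
      (show (0 : ℝ) ∈ Ioo _ _ from ⟨by linarith, ha⟩)
    refine ⟨t, ht, ?_⟩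
    exact (mul_eq_zero.1 ht0).resolve_left (pow_ne_zero _ (by norm_num))
  choose ζ hζ hζ0 using hz
  have hmono : ∀ i j, i ≤ j → j ≤ m → s i ≤ s j := by
    intro i j hij
    induction j, hij using Nat.le_induction with
    | base => exact fun _ => le_rfl
    | succ j hij ih => exact fun hj => (ih (by omega)).trans (h2 j hj).le
  refine ⟨ζ, fun a b hab => ?_, fun q => ⟨⟨?_, ?_⟩, hζ0 q⟩⟩
  · exact (hζ a).2.trans_le ((hmono _ _ hab b.2.le).trans (hζ b).1.le)
  · exact (h1 q q.2.le).1.trans (hζ q).1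
  · exact (hζ q).2.trans (h1 (q + 1) q.2).2

end Counting

lemma abs_flux_sub_le {n : ℕ} (hn : 1 ≤ n) {L : ℝ≥0} {f u v : ℝ → ℝ}
    (hf : LipschitzWith L f) (hu : IsRadialSol n f u) (hv : IsRadialSol n f v) {r : ℝ}
    (hr : r ∈ Ico 0 π) :
    |flux n f u r - flux n f v r| ≤ L * (2 * |u 0 - v 0| * exp (weightExp n L r)) * π := by
  have h1 : flux n f u r - flux n f v r
      = ∫ t in (0 : ℝ)..r, (sin t ^ n * f (v t) - sin t ^ n * f (u t)) := by
    rw [intervalIntegral.integral_sub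
      (intervalIntegrable_sin_pow_mul (hv.continuousOn_comp hf.continuous) hr)
      (intervalIntegrable_sin_pow_mul (hu.continuousOn_comp hf.continuous) hr)]
    simp only [flux]; ring
  rw [h1, ← Real.norm_eq_abs]
  refine (intervalIntegral.norm_integral_le_of_norm_le_const
    (C := L * (2 * |u 0 - v 0| * exp (weightExp n L r))) fun t ht => ?_).trans ?_
  · rw [uIoc_of_le hr.1] at ht
    have ht' : t ∈ Ico 0 π := ⟨ht.1.le, ht.2.trans_lt hr.2⟩
    rw [← mul_sub, norm_mul, Real.norm_eq_abs, Real.norm_eq_abs]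
    have h2 : |sin t ^ n| ≤ 1 := by
      rw [abs_pow]; exact pow_le_one₀ (abs_nonneg _) (abs_sin_le_one t)
    have h3 : |f (v t) - f (u t)| ≤ L * |u t - v t| := by
      rw [abs_sub_comm (u t)]
      simpa [Real.dist_eq] using hf.dist_le_mul (v t) (u t)
    have h4 := abs_sub_le_of_isRadialSol hn hf hu hv ht'
    have h5 := exp_le_exp.2 (weightExp_mono (n := n) L.2 ht.2 hr.2)
    calc |sin t ^ n| * |f (v t) - f (u t)| ≤ 1 * (L * |u t - v t|) := by gcongr
      _ ≤ L * (2 * |u 0 - v 0| * exp (weightExp n L r)) := by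
        rw [one_mul]
        refine mul_le_mul_of_nonneg_left (h4.trans ?_) L.2
        exact mul_le_mul_of_nonneg_left h5 (by positivity)
  · rw [sub_zero, abs_of_nonneg hr.1]
    exact mul_le_mul_of_nonneg_left hr.2.le (by have := L.2; positivity)

lemma tendsto_family {P : ℝ → ℝ → ℝ} {C R : ℝ}
    (hP : ∀ α β, ∀ r ∈ Icc 0 R, |P α r - P β r| ≤ C * |α - β|)
    (hc : ∀ α, ContinuousOn (P α) (Icc 0 R)) {αs rs : ℕ → ℝ} {α r : ℝ}
    (hα : Tendsto αs atTop (𝓝 α)) (hrs : ∀ i, rs i ∈ Icc 0 R) (hr : Tendsto rs atTop (𝓝 r)) :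
    Tendsto (fun i => P (αs i) (rs i)) atTop (𝓝 (P α r)) := by
  have hrmem : r ∈ Icc 0 R := isClosed_Icc.mem_of_tendsto hr (Eventually.of_forall hrs)
  have h1 : Tendsto (fun i => P α (rs i)) atTop (𝓝 (P α r)) :=
    (hc α r hrmem).tendsto.comp
      (tendsto_nhdsWithin_iff.2 ⟨hr, Eventually.of_forall hrs⟩)
  have h2 : Tendsto (fun i => P (αs i) (rs i) - P α (rs i)) atTop (𝓝 0) := by
    apply squeeze_zero_norm (a := fun i => C * |αs i - α|)
    · exact fun i => hP _ _ _ (hrs i)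
    · have := ((hα.sub_const α).abs).const_mul C
      simpa using this
  simpa using h2.add h1

lemma flux_ne_zero_of_eq {n : ℕ} {L : ℝ≥0} {f u : ℝ → ℝ} (hf : LipschitzWith L f)
    (hu : IsRadialSol n f u) {w r : ℝ} (hw : f w = 0) (h0 : u 0 ≠ w) (hr : r ∈ Ioo 0 π)
    (hur : u r = w) : flux n f u r ≠ 0 := fun hz =>
  h0 (hu.eq_const_of_flux_eq_zero hf hw hr hur hz 0 ⟨le_rfl, pi_pos⟩)

lemma exists_flux_eq_zero {n : ℕ} {f u : ℝ → ℝ} (hf : Continuous f) (hu : IsRadialSol n f u)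
    {a b : ℝ} (ha : 0 < a) (hab : a < b) (hb : b < π) (h : u a = u b) :
    ∃ c ∈ Ioo a b, flux n f u c = 0 := by
  obtain ⟨c, hc, hc0⟩ := exists_hasDerivAt_eq_zero hab
    (hu.cont.mono fun t ht => ⟨ha.le.trans ht.1, ht.2.trans_lt hb⟩) h
    (fun t ht => hu.hasDerivAt hf ⟨ha.trans ht.1, ht.2.trans hb⟩)
  refine ⟨c, hc, ?_⟩
  have := sin_pow_pos (n := n) ⟨ha.trans hc.1, hc.2.trans hb⟩
  exact (div_eq_zero_iff.1 hc0).resolve_right this.ne'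

lemma exists_zeros_of_frequently {n : ℕ} (hn : 1 ≤ n) {L : ℝ≥0} {f : ℝ → ℝ}
    (hf : LipschitzWith L f) {w : ℝ} (hw : f w = 0) {u : ℝ → ℝ → ℝ}
    (hu : ∀ α, IsRadialSol n f (u α)) (hu0 : ∀ α, u α 0 = α) {β R : ℝ} (hβ : β ≠ w) (hR : R < π)
    {m : ℕ} (h : ∃ᶠ α in 𝓝 β, ∃ ζ : Fin m → ℝ, StrictMono ζ ∧ ∀ q, ζ q ∈ Ioc 0 R ∧ u α (ζ q) = w) :
    ∃ ζ : Fin m → ℝ, StrictMono ζ ∧ ∀ q, ζ q ∈ Ioc 0 R ∧ u β (ζ q) = w := by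
  obtain ⟨αs, hαs, hζ⟩ := exists_seq_forall_of_frequently h
  choose ζ hmono hζ using hζ
  have hmem : ∀ i, ζ i ∈ Icc (fun _ => 0 : Fin m → ℝ) (fun _ => R) := fun i =>
    ⟨fun q => (hζ i q).1.1.le, fun q => (hζ i q).1.2⟩
  obtain ⟨Z, hZ, φ, hφ, hlim⟩ := isCompact_Icc.tendsto_subseq hmem
  have hlim' : ∀ q, Tendsto (fun i => ζ (φ i) q) atTop (𝓝 (Z q)) := tendsto_pi_nhds.1 hlim
  have hα' : Tendsto (fun i => αs (φ i)) atTop (𝓝 β) := hαs.comp hφ.tendsto_atTop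
  have hsub : Icc 0 R ⊆ Ico 0 π := fun r hr => ⟨hr.1, hr.2.trans_lt hR⟩
  have hexp : ∀ r ∈ Icc 0 R, weightExp n L r ≤ weightExp n L R := fun r hr =>
    weightExp_mono L.2 hr.2 hR
  have hu1 : ∀ α γ, ∀ r ∈ Icc 0 R, |u α r - u γ r| ≤ 2 * exp (weightExp n L R) * |α - γ| := by
    intro α γ r hr
    have := abs_sub_le_of_isRadialSol hn hf (hu α) (hu γ) (hsub hr)
    rw [hu0, hu0] at this
    refine this.trans ?_
    rw [mul_right_comm]
    gcongr
    exact hexp r hr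
  have hz1 : ∀ α γ, ∀ r ∈ Icc 0 R, |flux n f (u α) r - flux n f (u γ) r|
      ≤ L * (2 * exp (weightExp n L R)) * π * |α - γ| := by
    intro α γ r hr
    have := abs_flux_sub_le hn hf (hu α) (hu γ) (hsub hr)
    rw [hu0, hu0] at this
    refine this.trans ?_
    calc L * (2 * |α - γ| * exp (weightExp n L r)) * π
        ≤ L * (2 * |α - γ| * exp (weightExp n L R)) * π := by
          gcongr
          exact hexp r hr
      _ = _ := by ring
  have huZ : ∀ q, u β (Z q) = w := by
    intro q
    have h1 := tendsto_family hu1 (fun α => (hu α).cont.mono hsub) hα'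
      (fun i => Ioc_subset_Icc_self (hζ (φ i) q).1) (hlim' q)
    refine tendsto_nhds_unique h1 ?_
    simp only [(hζ _ _).2]
    exact tendsto_const_nhds
  have hZ0 : ∀ q, Z q ∈ Ioc 0 R := by
    intro q
    refine ⟨lt_of_le_of_ne (hZ.1 q) fun h0 => hβ ?_, hZ.2 q⟩
    rw [← huZ q, ← h0, hu0]
  refine ⟨Z, fun q q' hqq => ?_, fun q => ⟨hZ0 q, huZ q⟩⟩
  have hle : Z q ≤ Z q' := le_of_tendsto_of_tendsto' (hlim' q) (hlim' q')
    fun i => (hmono (φ i) hqq).le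
  refine lt_of_le_of_ne hle fun heq => ?_
  have hc : ∀ i, ∃ c ∈ Ioo (ζ (φ i) q) (ζ (φ i) q'), flux n f (u (αs (φ i))) c = 0 := fun i =>
    exists_flux_eq_zero hf.continuous (hu _) (hζ _ q).1.1 (hmono _ hqq)
      ((hζ _ q').1.2.trans_lt hR) ((hζ _ q).2.trans (hζ _ q').2.symm)
  choose c hc hc0 using hc
  have hclim : Tendsto c atTop (𝓝 (Z q)) :=
    tendsto_of_tendsto_of_tendsto_of_le_of_le (hlim' q) (heq ▸ hlim' q')
      (fun i => (hc i).1.le) (fun i => (hc i).2.le)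
  have h1 := tendsto_family hz1 (fun α => ((hu α).continuousOn_flux hf.continuous).mono hsub) hα'
    (fun i => ⟨(hζ _ q).1.1.le.trans (hc i).1.le, (hc i).2.le.trans (hζ _ q').1.2⟩) hclim
  simp only [hc0] at h1
  have h2 := tendsto_nhds_unique tendsto_const_nhds h1
  exact flux_ne_zero_of_eq hf (hu β) hw (by rwa [hu0]) ⟨(hZ0 q).1, (hZ0 q).2.trans_lt hR⟩ (huZ q)
    h2.symm

lemma sin_pow_le_sin_pow {n : ℕ} {r s : ℝ} (hr : π / 2 ≤ r) (hrs : r ≤ s) (hs : s ≤ π) :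
    sin s ^ n ≤ sin r ^ n := by
  refine pow_le_pow_left₀ (sin_nonneg_of_nonneg_of_le_pi (by linarith [pi_pos]) hs) ?_ n
  rw [← sin_pi_sub s, ← sin_pi_sub r]
  exact sin_le_sin_of_le_of_le_pi_div_two (by linarith) (by linarith) (by linarith)

lemma flux_ne_zero_after {n : ℕ} {L : ℝ≥0} {f u : ℝ → ℝ} (hf : LipschitzWith L f)
    (hu : IsRadialSol n f u) {w a c : ℝ} (hw : f w = 0) (h0 : u 0 ≠ w) (ha : π / 2 ≤ a)
    (hac : a < c) (hc : c < π) (hL : L * (π - a) ^ 2 < 1) (hua : u a = w) :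
    flux n f u c ≠ 0 := by
  intro hzc
  have hπ := pi_pos
  have hsub : Icc a c ⊆ Ioo 0 π := fun t ht => ⟨by linarith [ht.1], ht.2.trans_lt hc⟩
  have hcont : ContinuousOn (fun t => |u t - w|) (Icc a c) :=
    ((hu.cont.mono (hsub.trans Ioo_subset_Ico_self)).sub continuousOn_const).abs
  obtain ⟨m, hm, hmax⟩ := isCompact_Icc.exists_isMaxOn ⟨a, le_rfl, hac.le⟩ hcont
  set Y := |u m - w| with hY
  have hY0 : 0 ≤ Y := abs_nonneg _
  have hmax' : ∀ t ∈ Icc a c, |u t - w| ≤ Y := fun t ht => hmax ht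
  have hL0 : (0 : ℝ) ≤ L := L.2
  have hflux : ∀ s ∈ Icc a c, |flux n f u s| ≤ sin s ^ n * (L * Y) * (c - s) := by
    intro s hs
    have h1 := (convex_Icc s c).norm_image_sub_le_of_norm_hasDerivWithin_le
      (f := flux n f u) (f' := fun t => -(sin t ^ n * f (u t))) (C := sin s ^ n * (L * Y))
      (x := c) (y := s)
      (fun t ht => (hu.hasDerivAt_flux hf.continuous
        (hsub ⟨hs.1.trans ht.1, ht.2⟩)).hasDerivWithinAt) (fun t ht => by
        have ht' : t ∈ Icc a c := ⟨hs.1.trans ht.1, ht.2⟩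
        have h2 : |f (u t)| ≤ L * Y := by
          have := hf.dist_le_mul (u t) w
          rw [Real.dist_eq, Real.dist_eq, hw, sub_zero] at this
          exact this.trans (mul_le_mul_of_nonneg_left (hmax' t ht') hL0)
        have h3 := sin_pow_pos (n := n) (hsub ht')
        rw [norm_neg, norm_mul, Real.norm_eq_abs, Real.norm_eq_abs, abs_of_pos h3]
        exact mul_le_mul (sin_pow_le_sin_pow (ha.trans hs.1) ht.1 (ht.2.trans hc.le)) h2
          (abs_nonneg _) (sin_pow_pos (hsub hs)).le) ⟨hs.2, le_rfl⟩ ⟨le_rfl, hs.2⟩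
    rw [hzc, sub_zero, Real.norm_eq_abs, Real.norm_eq_abs, abs_sub_comm,
      abs_of_nonneg (by linarith [hs.2] : 0 ≤ c - s)] at h1
    exact h1
  have h1 := (convex_Icc a c).norm_image_sub_le_of_norm_hasDerivWithin_le
    (f := u) (f' := fun t => flux n f u t / sin t ^ n) (C := L * Y * (π - a)) (x := a) (y := m)
    (fun t ht => (hu.hasDerivAt hf.continuous (hsub ht)).hasDerivWithinAt) (fun t ht => by
      have h3 := sin_pow_pos (n := n) (hsub ht)
      rw [norm_div, Real.norm_eq_abs, Real.norm_eq_abs, abs_of_pos h3, div_le_iff₀ h3]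
      refine (hflux t ht).trans ?_
      calc sin t ^ n * (L * Y) * (c - t) ≤ sin t ^ n * (L * Y) * (π - a) := by
            have : c - t ≤ π - a := by linarith [ht.1]
            gcongr
        _ = _ := by ring) ⟨le_rfl, hac.le⟩ hm
  rw [hua, Real.norm_eq_abs, Real.norm_eq_abs, ← hY, abs_of_nonneg (by linarith [hm.1])] at h1
  have h2 : L * Y * (π - a) * (m - a) ≤ L * (π - a) ^ 2 * Y := by
    have : m - a ≤ π - a := by linarith [hm.2]
    have h5 : 0 ≤ π - a := by linarith
    calc L * Y * (π - a) * (m - a) ≤ L * Y * (π - a) * (π - a) := by gcongr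
      _ = _ := by ring
  have hY1 : Y = 0 := by nlinarith
  have h3 := hflux a ⟨le_rfl, hac.le⟩
  rw [hY1] at h3
  have h4 : flux n f u a = 0 := abs_eq_zero.1 (le_antisymm (by simpa using h3) (abs_nonneg _))
  exact flux_ne_zero_of_eq hf hu hw h0 (hsub ⟨le_rfl, hac.le⟩) hua h4

lemma card_le_of_strictMono {m : ℕ} {ζ : Fin m → ℝ} (hζ : StrictMono ζ) {Z : Finset ℝ}
    (h : ∀ q, ζ q ∈ Z) : m ≤ Z.card := by
  simpa using Finset.card_le_card_of_injOn (s := Finset.univ) ζ (fun q _ => h q)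
    hζ.injective.injOn

section Family

variable {n : ℕ} {L : ℝ≥0} {f : ℝ → ℝ} {w : ℝ} {u : ℝ → ℝ → ℝ}

lemma continuous_family (hn : 1 ≤ n) (hf : LipschitzWith L f)
    (hu : ∀ α, IsRadialSol n f (u α)) (hu0 : ∀ α, u α 0 = α) {r : ℝ} (hr : r ∈ Ico 0 π) :
    Continuous fun α => u α r := by
  refine (LipschitzWith.of_dist_le' (K := 2 * exp (weightExp n L r)) fun α β => ?_).continuous
  rw [Real.dist_eq, Real.dist_eq]
  refine (abs_sub_le_of_isRadialSol hn hf (hu α) (hu β) hr).trans (le_of_eq ?_)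
  rw [hu0, hu0]; ring

lemma continuous_flux_family (hn : 1 ≤ n) (hf : LipschitzWith L f)
    (hu : ∀ α, IsRadialSol n f (u α)) (hu0 : ∀ α, u α 0 = α) {r : ℝ} (hr : r ∈ Ico 0 π) :
    Continuous fun α => flux n f (u α) r := by
  refine (LipschitzWith.of_dist_le' (K := L * (2 * exp (weightExp n L r)) * π)
    fun α β => ?_).continuous
  rw [Real.dist_eq, Real.dist_eq]
  refine (abs_flux_sub_le hn hf (hu α) (hu β) hr).trans (le_of_eq ?_)
  rw [hu0, hu0]; ring

lemma isOpen_alternates (hn : 1 ≤ n) (hf : LipschitzWith L f)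
    (hu : ∀ α, IsRadialSol n f (u α)) (hu0 : ∀ α, u α 0 = α) (m : ℕ) :
    IsOpen {α | Alternates (fun r => w - u α r) m} := by
  rw [isOpen_iff_mem_nhds]
  rintro α ⟨s, h1, h2, h3⟩
  have hev : ∀ i ∈ Iic m, ∀ᶠ β in 𝓝 α, 0 < (-1) ^ i * (w - u β (s i)) := by
    intro i hi
    have hi : i ≤ m := hi
    have hc : Continuous fun β => (-1) ^ i * (w - u β (s i)) :=
      continuous_const.mul (continuous_const.sub
        (continuous_family hn hf hu hu0 (Ioo_subset_Ico_self (h1 i hi))))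
    exact hc.continuousAt.eventually (lt_mem_nhds (h3 i hi))
  rw [← Filter.eventually_all_finite (finite_Iic m)] at hev
  filter_upwards [hev] with β hβ
  exact ⟨s, h1, h2, fun i hi => hβ i hi⟩

lemma eventually_alternates (hn : 1 ≤ n) (hf : LipschitzWith L f) (hw : f w = 0) {ν : ℝ}
    (hν : HasDerivAt f ν w) (hu : ∀ α, IsRadialSol n f (u α)) (hu0 : ∀ α, u α 0 = α) {k : ℕ}
    (hk : (k : ℝ) * (k + n) < ν) :
    ∀ᶠ α in 𝓝[<] w, Alternates (fun r => w - u α r) (k + 1) := by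
  obtain ⟨φ, hφ, hφ0⟩ := exists_isRadialSol hn (lipschitzWith_mul ν) 1
  obtain ⟨s, h1, h2, h3⟩ := alternates_of_eigenvalue_lt k hn hk hφ (by rw [hφ0]; exact one_pos)
  have hev : ∀ i ∈ Iic (k + 1), ∀ᶠ α in 𝓝[<] w, 0 < (-1) ^ i * (w - u α (s i)) := by
    intro i hi
    have hi : i ≤ k + 1 := hi
    have ht := (tendsto_linearization hn hf hw hν hφ hφ0 hu hu0
      (Ioo_subset_Ico_self (h1 i hi))).const_mul ((-1) ^ i)
    have ht' := (ht.eventually (lt_mem_nhds (h3 i hi))).filter_mono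
      (nhdsWithin_mono w (s := Iio w) fun α hα => ne_of_lt hα)
    filter_upwards [ht', self_mem_nhdsWithin] with α hα hαw
    have hαw : α < w := hαw
    have h4 := mul_pos hα (by linarith : 0 < w - α)
    have h5 : (-1) ^ i * ((u α (s i) - w) / (α - w)) * (w - α) = (-1) ^ i * (w - u α (s i)) := by
      have : α - w ≠ 0 := by linarith
      field_simp
      ring
    rwa [h5] at h4
  rw [← Filter.eventually_all_finite (finite_Iic _)] at hev
  filter_upwards [hev] with β hβ
  exact ⟨s, h1, h2, fun i hi => hβ i hi⟩

lemma exists_endpoint (L : ℝ≥0) : ∃ a, π / 2 ≤ a ∧ a < π ∧ L * (π - a) ^ 2 < 1 := by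
  have hL : (0 : ℝ) ≤ L := L.2
  have hπ := pi_gt_three
  refine ⟨π - 1 / (L + 1), ?_, ?_, ?_⟩
  · have : 1 / ((L : ℝ) + 1) ≤ 1 := by rw [div_le_one (by positivity)]; linarith
    linarith
  · have : 0 < 1 / ((L : ℝ) + 1) := by positivity
    linarith
  · rw [sub_sub_cancel, div_pow, one_pow, mul_one_div, div_lt_one (by positivity)]
    nlinarith

lemma not_both_eq {n : ℕ} {L : ℝ≥0} {f u : ℝ → ℝ} (hf : LipschitzWith L f)
    (hu : IsRadialSol n f u) {w e a b : ℝ} (hw : f w = 0) (h0 : u 0 ≠ w) (he : π / 2 ≤ e)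
    (hL : L * (π - e) ^ 2 < 1) (hea : e ≤ a) (hab : a < b) (hb : b < π) (hua : u a = w) :
    u b ≠ w := by
  intro hub
  have ha0 : 0 < a := by linarith [pi_pos]
  obtain ⟨c, hc, hc0⟩ := exists_flux_eq_zero hf.continuous hu ha0 hab hb (hua.trans hub.symm)
  refine flux_ne_zero_after hf hu hw h0 (he.trans hea) hc.1 (hc.2.trans hb) ?_ hua hc0
  refine lt_of_le_of_lt ?_ hL
  have : π - a ≤ π - e := by linarith
  have : 0 ≤ π - a := by linarith
  have := L.2
  gcongr

lemma eventually_not_alternates (hn : 1 ≤ n) (hf : LipschitzWith L f) (hw0 : 0 < w) (hw : f w = 0)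
    (hf0 : f 0 = 0) (hu : ∀ α, IsRadialSol n f (u α)) (hu0 : ∀ α, u α 0 = α) :
    ∀ᶠ α in 𝓝 0, ¬ Alternates (fun r => w - u α r) 2 := by
  obtain ⟨a, ha, haπ, hL⟩ := exists_endpoint L
  have ha0 : 0 < a := by linarith [pi_pos]
  have hsmall : ∀ᶠ α in 𝓝 (0 : ℝ), 2 * |α| * exp (weightExp n L a) < w := by
    have hc : Continuous fun α : ℝ => 2 * |α| * exp (weightExp n L a) := by fun_prop
    apply hc.continuousAt.eventually (gt_mem_nhds _)
    simpa using hw0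
  filter_upwards [hsmall, gt_mem_nhds hw0] with α hα hαw halt
  have hcont : ContinuousOn (fun r => w - u α r) (Ico 0 π) := continuousOn_const.sub (hu α).cont
  obtain ⟨ζ, hζ, hζ0⟩ := halt.exists_zeros hcont
  have hζw : ∀ q, u α (ζ q) = w := fun q => (sub_eq_zero.1 (hζ0 q).2).symm
  have hgt : ∀ q, a ≤ ζ q := by
    intro q
    by_contra! hcon
    have h1 := abs_sub_le_of_isRadialSol hn hf (hu α) (isRadialSol_const n hf0)
      (Ioo_subset_Ico_self (hζ0 q).1)
    rw [hu0, sub_zero, sub_zero] at h1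
    rw [hζw q, abs_of_pos hw0] at h1
    have h3 : 2 * |α| * exp (weightExp n L (ζ q)) ≤ 2 * |α| * exp (weightExp n L a) :=
      mul_le_mul_of_nonneg_left (exp_le_exp.2 (weightExp_mono L.2 hcon.le haπ)) (by positivity)
    linarith
  have h01 : ζ 0 < ζ 1 := hζ (by simp)
  exact not_both_eq hf (hu α) hw (by rw [hu0]; exact hαw.ne) ha hL (hgt 0) h01 (hζ0 1).1.2
    (hζw 0) (hζw 1)

lemma exists_threshold (hn : 1 ≤ n) (hf : LipschitzWith L f) (hw0 : 0 < w) (hw : f w = 0)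
    (hf0 : f 0 = 0) {ν : ℝ} (hν : HasDerivAt f ν w) (hu : ∀ α, IsRadialSol n f (u α))
    (hu0 : ∀ α, u α 0 = α) {k : ℕ} (hk : (k : ℝ) * (k + n) < ν) {j : ℕ} (hj : 1 ≤ j)
    (hjk : j ≤ k) :
    ∃ β ∈ Ioo 0 w, ¬ Alternates (fun r => w - u β r) (j + 1) ∧
      ∃ᶠ α in 𝓝 β, α ≠ w ∧ Alternates (fun r => w - u α r) (j + 1) := by
  set U := {α | Alternates (fun r => w - u α r) (j + 1)} with hU
  have hUo : IsOpen U := isOpen_alternates hn hf hu hu0 (j + 1)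
  have hne : (Ioo 0 w ∩ U).Nonempty := by
    have h1 : ∀ᶠ α in 𝓝[<] w, α ∈ U :=
      (eventually_alternates hn hf hw hν hu hu0 hk).mono fun α hα => hα.mono (by omega)
    obtain ⟨α, hα1, hα2⟩ := (h1.and (Ioo_mem_nhdsLT hw0)).exists
    exact ⟨α, hα2, hα1⟩
  have hnot : ¬ Ioo 0 w ⊆ U := by
    intro hsub
    have h1 := (eventually_not_alternates hn hf hw0 hw hf0 hu hu0).filter_mono
      (nhdsWithin_le_nhds (s := Ioi 0))
    obtain ⟨α, hα1, hα2⟩ := (h1.and (Ioo_mem_nhdsGT hw0)).exists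
    exact hα1 (Alternates.mono (by omega) (hsub hα2))
  by_contra! hcon
  refine hnot (isPreconnected_Ioo.subset_of_closure_inter_subset hUo hne ?_)
  rintro β ⟨hβ1, hβ2⟩
  by_contra hβU
  have h2 := hcon β hβ2 hβU
  have h3 : ∀ᶠ α in 𝓝 β, α ≠ w := isOpen_ne.mem_nhds hβ2.2.ne
  rw [mem_closure_iff_frequently] at hβ1
  exact hβ1 ((h2.and h3).mono fun α h hα => h.1 h.2 hα)

end Family

lemma exists_flux_limit {n : ℕ} {f u : ℝ → ℝ} (hf : Continuous f) (hu : IsRadialSol n f u) {B : ℝ}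
    (hB : ∀ x, |f x| ≤ B) :
    (∀ r ∈ Ico (π / 2) π, ∀ s ∈ Ico r π,
        |flux n f u s - flux n f u r| ≤ B * sin r ^ n * (s - r)) ∧
      ∃ c, Tendsto (flux n f u) (𝓝[<] π) (𝓝 c) ∧
        ∀ r ∈ Ico (π / 2) π, |flux n f u r - c| ≤ B * sin r ^ n * (π - r) := by
  have hπ := pi_pos
  have hB0 : 0 ≤ B := (abs_nonneg _).trans (hB 0)
  have hbd : ∀ r ∈ Ico (π / 2) π, ∀ s ∈ Ico r π,
      |flux n f u s - flux n f u r| ≤ B * sin r ^ n * (s - r) := by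
    intro r hr s hs
    have hsub : ∀ t ∈ Icc r s, t ∈ Ioo 0 π := fun t ht =>
      ⟨by linarith [hr.1, ht.1], ht.2.trans_lt hs.2⟩
    have h1 := (convex_Icc r s).norm_image_sub_le_of_norm_hasDerivWithin_le
      (f := flux n f u) (f' := fun t => -(sin t ^ n * f (u t))) (C := B * sin r ^ n)
      (x := r) (y := s)
      (fun t ht => (hu.hasDerivAt_flux hf (hsub t ht)).hasDerivWithinAt) (fun t ht => by
        have h3 := sin_pow_pos (n := n) (hsub t ht)
        rw [norm_neg, norm_mul, Real.norm_eq_abs, Real.norm_eq_abs, abs_of_pos h3, mul_comm]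
        exact mul_le_mul (hB _) (sin_pow_le_sin_pow hr.1 ht.1 (ht.2.trans hs.2.le)) h3.le hB0)
      ⟨le_rfl, hs.1⟩ ⟨hs.1, le_rfl⟩
    rwa [Real.norm_eq_abs, Real.norm_eq_abs, abs_of_nonneg (by linarith [hs.1] : 0 ≤ s - r)] at h1
  refine ⟨hbd, ?_⟩
  have hlip : LipschitzOnWith (Real.toNNReal B) (flux n f u) (Ico (π / 2) π) := by
    refine LipschitzOnWith.of_dist_le_mul fun r hr s hs => ?_
    rw [Real.dist_eq, Real.dist_eq, Real.coe_toNNReal _ hB0]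
    have hone : ∀ t, B * sin t ^ n ≤ B := fun t => by
      have : sin t ^ n ≤ 1 := (le_abs_self _).trans (by
        rw [abs_pow]; exact pow_le_one₀ (abs_nonneg _) (abs_sin_le_one t))
      nlinarith
    rcases le_total r s with h | h
    · rw [abs_sub_comm, abs_sub_comm r, abs_of_nonneg (by linarith : 0 ≤ s - r)]
      exact (hbd r hr s ⟨h, hs.2⟩).trans (mul_le_mul_of_nonneg_right (hone r) (by linarith))
    · rw [abs_of_nonneg (by linarith : 0 ≤ r - s)]
      exact (hbd s hs r ⟨h, hr.2⟩).trans (mul_le_mul_of_nonneg_right (hone s) (by linarith))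
  obtain ⟨g, hg, hgeq⟩ := hlip.extend_real
  have hlim : Tendsto (flux n f u) (𝓝[<] π) (𝓝 (g π)) := by
    refine (hg.continuous.continuousAt.tendsto.mono_left nhdsWithin_le_nhds).congr' ?_
    filter_upwards [Ico_mem_nhdsLT (by linarith : π / 2 < π)] with r hr using (hgeq hr).symm
  refine ⟨g π, hlim, fun r hr => ?_⟩
  have h1 : Tendsto (fun s => |flux n f u s - flux n f u r|) (𝓝[<] π)
      (𝓝 |g π - flux n f u r|) := (hlim.sub_const _).abs
  have h2 : Tendsto (fun s => B * sin r ^ n * (s - r)) (𝓝[<] π) (𝓝 (B * sin r ^ n * (π - r))) := by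
    have : Continuous fun s => B * sin r ^ n * (s - r) := by fun_prop
    exact this.continuousAt.tendsto.mono_left nhdsWithin_le_nhds
  rw [abs_sub_comm]
  refine le_of_tendsto_of_tendsto h1 h2 ?_
  filter_upwards [Ico_mem_nhdsLT hr.2] with s hs using hbd r hr s hs

/-- If the flux vanishes at `π`, the solution extends to `π` and its reflection is a solution. -/
lemma IsRadialSol.exists_reflection {n : ℕ} {f u : ℝ → ℝ} (hf : Continuous f)
    (hu : IsRadialSol n f u) {B : ℝ}
    (hz : ∀ r ∈ Ico (π / 2) π, |flux n f u r| ≤ B * sin r ^ n * (π - r)) :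
    ∃ v, IsRadialSol n f v ∧ IsRadialSol n f (fun r => v (π - r)) ∧ EqOn u v (Ico 0 π) := by
  have hπ := pi_pos
  have hsub : ∀ r ∈ Ico (π / 2) π, r ∈ Ioo 0 π := fun r hr => ⟨by linarith [hr.1], hr.2⟩
  have hder : ∀ r ∈ Ico (π / 2) π, |flux n f u r / sin r ^ n| ≤ B * (π - r) := by
    intro r hr
    have h3 := sin_pow_pos (n := n) (hsub r hr)
    rw [abs_div, abs_of_pos h3, div_le_iff₀ h3]
    linarith [hz r hr]
  have hB0 : 0 ≤ B := by
    have := (abs_nonneg _).trans (hder (π / 2) ⟨le_rfl, by linarith⟩)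
    by_contra! hcon
    nlinarith
  have hlip : LipschitzOnWith (Real.toNNReal (B * π)) u (Ico (π / 2) π) := by
    refine Convex.lipschitzOnWith_of_nnnorm_hasDerivWithin_le (convex_Ico _ _)
      (fun r hr => (hu.hasDerivAt hf (hsub r hr)).hasDerivWithinAt) fun r hr => ?_
    rw [← NNReal.coe_le_coe, coe_nnnorm, Real.coe_toNNReal _ (by positivity), Real.norm_eq_abs]
    refine (hder r hr).trans (mul_le_mul_of_nonneg_left ?_ hB0)
    linarith [(hsub r hr).1]
  obtain ⟨g, hg, hgeq⟩ := hlip.extend_real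
  have hlim : Tendsto u (𝓝[<] π) (𝓝 (g π)) := by
    refine (hg.continuous.continuousAt.tendsto.mono_left nhdsWithin_le_nhds).congr' ?_
    filter_upwards [Ico_mem_nhdsLT (by linarith : π / 2 < π)] with r hr using (hgeq hr).symm
  have hzlim : Tendsto (flux n f u) (𝓝[<] π) (𝓝 0) := by
    apply squeeze_zero_norm' (a := fun r => B * sin r ^ n * (π - r))
    · filter_upwards [Ico_mem_nhdsLT (by linarith : π / 2 < π)] with r hr using hz r hr
    · have : Continuous fun r => B * sin r ^ n * (π - r) := by fun_prop
      have h := this.continuousAt.tendsto.mono_left (nhdsWithin_le_nhds (a := π) (s := Iio π))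
      simpa using h
  set v : ℝ → ℝ := Function.update u π (g π) with hv
  have huv : EqOn u v (Ico 0 π) := fun r hr => by
    rw [hv, Function.update_of_ne hr.2.ne]
  have hfluxuv : ∀ r ∈ Ico 0 π, flux n f v r = flux n f u r := by
    intro r hr
    simp only [flux]
    congr 1
    apply intervalIntegral.integral_congr
    intro t ht
    simp only
    rw [huv (uIcc_subset_Ico hr ht)]
  have hvsol : IsRadialSol n f v := by
    refine IsRadialSol.of_hasDerivAt hf (hu.cont.congr huv.symm) fun r hr => ?_
    rw [hfluxuv r (Ioo_subset_Ico_self hr)]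
    refine (hu.hasDerivAt hf hr).congr_of_eventuallyEq ?_
    filter_upwards [isOpen_Ioo.mem_nhds hr] with t ht using
      (huv (Ioo_subset_Ico_self ht)).symm
  refine ⟨v, hvsol, ?_, huv⟩
  have hvπ : v π = g π := by rw [hv, Function.update_self]
  have hrefl : Tendsto (fun r : ℝ => π - r) (𝓝[>] 0) (𝓝[<] π) := by
    apply tendsto_nhdsWithin_of_tendsto_nhds_of_eventually_within
    · have : Tendsto (fun r : ℝ => π - r) (𝓝 0) (𝓝 (π - 0)) :=
        (continuous_const.sub continuous_id).tendsto 0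
      rw [sub_zero] at this
      exact this.mono_left nhdsWithin_le_nhds
    · filter_upwards [self_mem_nhdsWithin] with r hr
      have : 0 < r := hr
      change π - r < π
      linarith
  have hmem : ∀ r ∈ Ioo 0 π, π - r ∈ Ioo 0 π := fun r hr => ⟨by linarith [hr.2], by linarith [hr.1]⟩
  have hd : ∀ r ∈ Ioo 0 π, HasDerivAt (fun r => v (π - r)) (-(flux n f v (π - r) / sin r ^ n)) r := by
    intro r hr
    have h1 := hvsol.hasDerivAt hf (hmem r hr)
    rw [sin_pi_sub] at h1
    exact h1.comp_const_sub π r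
  have hcont : ContinuousOn (fun r => v (π - r)) (Ico 0 π) := by
    apply continuousOn_Ico_of_tendsto
    · simp only [sub_zero, hvπ]
      refine (hlim.comp hrefl).congr' ?_
      filter_upwards [Ioo_mem_nhdsGT hπ] with r hr using huv (Ioo_subset_Ico_self (hmem r hr))
    · exact fun r hr => (hd r hr).continuousAt
  refine IsRadialSol.of_hasDerivAt hf hcont fun r hr => ?_
  convert hd r hr using 1
  rw [← neg_div]
  congr 1
  have hfc : ContinuousOn (fun t => f (v (π - t))) (Ico 0 π) := hf.comp_continuousOn hcont
  have key := intervalIntegral.integral_eq_sub_of_hasDerivAt_of_tendsto hr.1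
    (f := fun t => flux n f v (π - t)) (f' := fun t => sin t ^ n * f (v (π - t)))
    (fa := 0) (fb := flux n f v (π - r)) (fun t ht => by
      have h1 := hvsol.hasDerivAt_flux hf (hmem t ⟨ht.1, ht.2.trans hr.2⟩)
      rw [sin_pi_sub] at h1
      simpa using h1.comp_const_sub π t)
    (intervalIntegrable_sin_pow_mul hfc (Ioo_subset_Ico_self hr)) (by
      refine (hzlim.comp hrefl).congr' ?_
      filter_upwards [Ioo_mem_nhdsGT hπ] with t ht using
        (hfluxuv _ (Ioo_subset_Ico_self (hmem t ht))).symm) (by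
      have h1 := hvsol.hasDerivAt_flux hf (hmem r hr)
      have h2 := (h1.continuousAt.comp (f := fun t : ℝ => π - t) (x := r)
        (by fun_prop)).tendsto
      exact h2.mono_left nhdsWithin_le_nhds)
  simp only [flux] at key ⊢
  rw [key]
  ring

lemma flux_limit_eq_zero {n : ℕ} {L : ℝ≥0} {f : ℝ → ℝ} {w : ℝ} {u : ℝ → ℝ → ℝ} (hn : 1 ≤ n)
    (hf : LipschitzWith L f) (hw : f w = 0) {B : ℝ} (hB : ∀ x, |f x| ≤ B)
    (hu : ∀ α, IsRadialSol n f (u α)) (hu0 : ∀ α, u α 0 = α) {β : ℝ} (hβ : β ≠ w) {m : ℕ}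
    {Z : Finset ℝ} (hZ : ∀ r, r ∈ Z ↔ r ∈ Ioo 0 π ∧ u β r = w) (hcard : Z.card < m)
    (hfreq : ∃ᶠ α in 𝓝 β, ∃ ζ : Fin m → ℝ, StrictMono ζ ∧ ∀ q, ζ q ∈ Ioo 0 π ∧ u α (ζ q) = w)
    {c : ℝ} (hc : Tendsto (flux n f (u β)) (𝓝[<] π) (𝓝 c)) : c = 0 := by
  by_contra hc0
  have hπ := pi_pos
  have hB0 : 0 ≤ B := (abs_nonneg _).trans (hB 0)
  obtain ⟨σ, hσ, hσc⟩ : ∃ σ : ℝ, |σ| = 1 ∧ 0 < σ * c := by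
    rcases lt_or_gt_of_ne hc0 with h | h
    · exact ⟨-1, by simp, by linarith⟩
    · exact ⟨1, by simp, by linarith⟩
  have hc' : Tendsto (fun r => σ * flux n f (u β) r) (𝓝[<] π) (𝓝 (σ * c)) := hc.const_mul σ
  have hup : Tendsto (fun r => σ * u β r) (𝓝[<] π) atTop := by
    have h1 : ∀ᶠ r in 𝓝[<] π, σ * c / 2 ≤ σ * flux n f (u β) r ∧ π / 2 < r := by
      refine (hc'.eventually (le_mem_nhds (by linarith))).and ?_
      exact nhdsWithin_le_nhds (lt_mem_nhds (by linarith))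
    obtain ⟨a, ha, hasub⟩ := mem_nhdsLT_iff_exists_Ico_subset.1 h1
    have ha0 : π / 2 < a := (hasub ⟨le_rfl, ha⟩).2
    refine tendsto_atTop_of_flux_ge hn (z := fun r => σ * flux n f (u β) r) (a := a)
      (c := σ * c / 2) ⟨by linarith, ha⟩ (fun r hr => ?_) (by linarith)
      (fun r hr => (hasub hr).1)
    have := ((hu β).hasDerivAt hf.continuous (r := r) ⟨by linarith [hr.1], hr.2⟩).const_mul σ
    rwa [← mul_div_assoc] at this
  have hBlim : Tendsto (fun r => σ * flux n f (u β) r - B * (π - r)) (𝓝[<] π) (𝓝 (σ * c)) := by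
    have h1 : Continuous fun r => B * (π - r) := by fun_prop
    have h2 := h1.continuousAt.tendsto.mono_left (nhdsWithin_le_nhds (a := π) (s := Iio π))
    simpa using hc'.sub h2
  obtain ⟨R, ⟨hR1, hR2⟩, hR3⟩ := (((hup.eventually (eventually_gt_atTop (σ * w))).and
    (hBlim.eventually (lt_mem_nhds hσc))).and
    (Ico_mem_nhdsLT (by linarith : π / 2 < π))).exists
  have hRπ : R ∈ Ioo 0 π := ⟨by linarith [hR3.1], hR3.2⟩
  have hRI := Ioo_subset_Ico_self hRπ
  have hev : ∀ᶠ α in 𝓝 β, σ * w < σ * u α R ∧ 0 < σ * flux n f (u α) R - B * (π - R) := by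
    have c1 : Continuous fun α => σ * u α R :=
      continuous_const.mul (continuous_family hn hf hu hu0 hRI)
    have c2 : Continuous fun α => σ * flux n f (u α) R - B * (π - R) :=
      (continuous_const.mul (continuous_flux_family hn hf hu hu0 hRI)).sub continuous_const
    exact (c1.continuousAt.eventually (lt_mem_nhds hR1)).and
      (c2.continuousAt.eventually (lt_mem_nhds hR2))
  have hno : ∀ α, σ * w < σ * u α R ∧ 0 < σ * flux n f (u α) R - B * (π - R) →
      ∀ r ∈ Ico R π, σ * w < σ * u α r := by
    rintro α ⟨h1, h2⟩ r hr
    have hmono : StrictMonoOn (fun r => σ * u α r) (Ico R π) := by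
      have hder : ∀ s ∈ Ico R π, HasDerivAt (fun r => σ * u α r)
          (σ * (flux n f (u α) s / sin s ^ n)) s := fun s hs =>
        ((hu α).hasDerivAt hf.continuous ⟨hRπ.1.trans_le hs.1, hs.2⟩).const_mul σ
      apply strictMonoOn_of_deriv_pos (convex_Ico R π)
      · exact fun s hs => (hder s hs).continuousAt.continuousWithinAt
      · intro s hs
        have hs := interior_subset hs
        rw [(hder s hs).deriv, ← mul_div_assoc]
        have hg := sin_pow_pos (n := n) ⟨hRπ.1.trans_le hs.1, hs.2⟩
        refine div_pos ?_ hg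
        have h3 := (exists_flux_limit hf.continuous (hu α) hB).1 R hR3 s hs
        have h4 : |σ * (flux n f (u α) s - flux n f (u α) R)| ≤ B * sin R ^ n * (s - R) := by
          rw [abs_mul, hσ, one_mul]; exact h3
        have h5 := neg_le_of_abs_le h4
        have h6 : B * sin R ^ n * (s - R) ≤ B * (π - R) := by
          have : sin R ^ n ≤ 1 := pow_le_one₀ (sin_pos_of_pos_of_lt_pi hRπ.1 hRπ.2).le
            (sin_le_one R)
          have : B * sin R ^ n ≤ B := by nlinarith
          exact mul_le_mul this (by linarith [hs.2]) (by linarith [hs.1]) hB0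
        linarith
    exact h1.trans_le (hmono.monotoneOn ⟨le_rfl, hRπ.2⟩ hr hr.1)
  have hfreq' := (hfreq.and_eventually hev).mono fun α hα => by
    obtain ⟨⟨ζ, hζ, hζ0⟩, hα2⟩ := hα
    refine (⟨ζ, hζ, fun q => ⟨⟨(hζ0 q).1.1, ?_⟩, (hζ0 q).2⟩⟩ :
      ∃ ζ : Fin m → ℝ, StrictMono ζ ∧ ∀ q, ζ q ∈ Ioc 0 R ∧ u α (ζ q) = w)
    by_contra! hcon
    have := hno α hα2 (ζ q) ⟨hcon.le, (hζ0 q).1.2⟩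
    rw [(hζ0 q).2] at this
    exact lt_irrefl _ this
  obtain ⟨ζ, hζ, hζ0⟩ := exists_zeros_of_frequently hn hf hw hu hu0 hβ hRπ.2 hfreq'
  have := card_le_of_strictMono hζ (Z := Z) fun q =>
    (hZ _).2 ⟨⟨(hζ0 q).1.1, (hζ0 q).1.2.trans_lt hRπ.2⟩, (hζ0 q).2⟩
  omega

lemma le_card_of_frequently {n : ℕ} {L : ℝ≥0} {f : ℝ → ℝ} {w : ℝ} {u : ℝ → ℝ → ℝ} (hn : 1 ≤ n)
    (hf : LipschitzWith L f) (hw : f w = 0)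
    (hu : ∀ α, IsRadialSol n f (u α)) (hu0 : ∀ α, u α 0 = α) {β : ℝ} (hβ : β ≠ w) {j : ℕ}
    {Z : Finset ℝ} (hZ : ∀ r, r ∈ Z ↔ r ∈ Ioo 0 π ∧ u β r = w)
    (hfreq : ∃ᶠ α in 𝓝 β, α ≠ w ∧
      ∃ ζ : Fin (j + 1) → ℝ, StrictMono ζ ∧ ∀ q, ζ q ∈ Ioo 0 π ∧ u α (ζ q) = w) :
    j ≤ Z.card := by
  obtain ⟨e, he, heπ, hL⟩ := exists_endpoint L
  have hfreq' := hfreq.mono fun α hα => by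
    obtain ⟨hαw, ζ, hζ, hζ0⟩ := hα
    refine (⟨fun q => ζ q.castSucc, hζ.comp Fin.strictMono_castSucc,
      fun q => ⟨⟨(hζ0 _).1.1, ?_⟩, (hζ0 _).2⟩⟩ :
      ∃ ζ : Fin j → ℝ, StrictMono ζ ∧ ∀ q, ζ q ∈ Ioc 0 e ∧ u α (ζ q) = w)
    by_contra! hcon
    exact not_both_eq hf (hu α) hw (by rwa [hu0]) he hL hcon.le
      (hζ (Fin.castSucc_lt_last q)) (hζ0 _).1.2 (hζ0 _).2 (hζ0 _).2
  obtain ⟨ζ, hζ, hζ0⟩ := exists_zeros_of_frequently hn hf hw hu hu0 hβ heπ hfreq'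
  exact card_le_of_strictMono hζ (Z := Z) fun q =>
    (hZ _).2 ⟨⟨(hζ0 q).1.1, (hζ0 q).1.2.trans_lt heπ⟩, (hζ0 q).2⟩

lemma pos_of_flux_tendsto_zero {n : ℕ} {L : ℝ≥0} {f u : ℝ → ℝ} (hf : LipschitzWith L f)
    (hneg : ∀ x ≤ 0, f x = 0) (hu : IsRadialSol n f u) (h0 : 0 < u 0)
    (hlim : Tendsto (flux n f u) (𝓝[<] π) (𝓝 0)) : ∀ r ∈ Ico 0 π, 0 < u r := by
  intro b hb
  by_contra! hcon
  have hb0 : 0 < b := lt_of_le_of_ne hb.1 fun h => by rw [← h] at hcon; linarith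
  obtain ⟨a, ha, hua, hpos⟩ := exists_first_nonneg (h := fun r => -u r) hb.1
    ((hu.cont.mono fun t ht => ⟨ht.1, ht.2.trans_lt hb.2⟩).neg) (by simpa using h0)
    (by simpa using hcon)
  have hua : u a = 0 := neg_eq_zero.1 hua
  have haπ : a ∈ Ioo 0 π := ⟨ha.1, ha.2.trans_lt hb.2⟩
  have hza : flux n f u a < 0 := by
    refine lt_of_le_of_ne ?_ (flux_ne_zero_of_eq hf hu (hneg 0 le_rfl) h0.ne' haπ hua)
    by_contra! hpz
    have hder := hu.hasDerivAt hf.continuous haπ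
    have hd : 0 < flux n f u a / sin a ^ n := div_pos hpz (sin_pow_pos haπ)
    have hev : ∀ᶠ r in 𝓝[<] a, u r < 0 := by
      have h1 := hasDerivAt_iff_tendsto_slope.1 hder
      have h2 : ∀ᶠ r in 𝓝[<] a, 0 < slope u a r :=
        (h1.eventually (lt_mem_nhds hd)).filter_mono
          (nhdsWithin_mono a (s := Iio a) fun r hr => ne_of_lt hr)
      filter_upwards [h2, self_mem_nhdsWithin] with r hr hra
      have hra : r < a := hra
      rw [slope_def_field, hua, sub_zero] at hr
      by_contra! h
      exact absurd hr (not_lt.2 (div_nonpos_of_nonneg_of_nonpos h (by linarith)))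
    obtain ⟨r, hr, hr'⟩ := (hev.and (Ico_mem_nhdsLT ha.1)).exists
    have := hpos r hr'
    linarith
  have h2 : ∀ᶠ r in 𝓝[<] π, flux n f u a / 2 < flux n f u r :=
    hlim.eventually (lt_mem_nhds (by linarith))
  obtain ⟨d, hd, hd'⟩ := (h2.and (Ioo_mem_nhdsLT haπ.2)).exists
  have hsub : ∀ t ∈ Icc a d, t ∈ Ioo 0 π := fun t ht => ⟨ha.1.trans_le ht.1, ht.2.trans_lt hd'.2⟩
  obtain ⟨c, hc, hzc, hlt⟩ := exists_first_nonneg (h := fun r => flux n f u r - flux n f u a / 2)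
    hd'.1.le (((hu.continuousOn_flux hf.continuous).mono
      fun t ht => Ioo_subset_Ico_self (hsub t ht)).sub continuousOn_const)
    (by linarith) (by linarith)
  have hsub' : ∀ t ∈ Icc a c, t ∈ Ioo 0 π := fun t ht => hsub t ⟨ht.1, ht.2.trans hc.2⟩
  have hanti : AntitoneOn u (Icc a c) := by
    have hder : ∀ s ∈ Icc a c, HasDerivAt u (flux n f u s / sin s ^ n) s := fun s hs =>
      hu.hasDerivAt hf.continuous (hsub' s hs)
    refine antitoneOn_of_deriv_nonpos (convex_Icc a c)
      (fun s hs => (hder s hs).continuousAt.continuousWithinAt)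
      (fun s hs => (hder s (interior_subset hs)).differentiableAt.differentiableWithinAt)
      fun s hs => ?_
    have hs' := interior_subset hs
    rw [interior_Icc] at hs
    rw [(hder s hs').deriv]
    have h3 := hlt s ⟨hs.1.le, hs.2⟩
    exact div_nonpos_of_nonpos_of_nonneg (by linarith) (sin_pow_pos (hsub' s hs')).le
  have hconst := constant_of_derivWithin_zero (f := flux n f u) (a := a) (b := c)
    (fun s hs => (hu.hasDerivAt_flux hf.continuous
      (hsub' s hs)).differentiableAt.differentiableWithinAt) (fun s hs => by
      have hs' : s ∈ Icc a c := ⟨hs.1, hs.2.le⟩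
      have h3 : u s ≤ 0 := by rw [← hua]; exact hanti ⟨le_rfl, hc.1.le⟩ hs' hs.1
      have h4 := hu.hasDerivAt_flux hf.continuous (hsub' s hs')
      rw [h4.hasDerivWithinAt.derivWithin (uniqueDiffOn_Icc hc.1 s hs'), hneg _ h3]
      simp) c ⟨hc.1.le, le_rfl⟩
  linarith

theorem exists_radial_solution {n : ℕ} (hn : 1 ≤ n) {L : ℝ≥0} {f : ℝ → ℝ}
    (hf : LipschitzWith L f) {w ν B : ℝ} (hw0 : 0 < w) (hw : f w = 0) (hν : HasDerivAt f ν w)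
    (hB : ∀ x, |f x| ≤ B) (hneg : ∀ x ≤ 0, f x = 0) {j k : ℕ} (hj : 1 ≤ j) (hjk : j ≤ k)
    (hk : (k : ℝ) * (k + n) < ν) :
    ∃ u, IsRadialSol n f u ∧ IsRadialSol n f (fun r => u (π - r)) ∧ (∀ r ∈ Icc 0 π, 0 < u r) ∧
      u 0 ∈ Ioo 0 w ∧ u π ≠ w ∧
      ∃ Z : Finset ℝ, (∀ r, r ∈ Z ↔ r ∈ Ioo 0 π ∧ u r = w) ∧ Z.card = j := by
  have hπ := pi_pos
  choose u hu hu0 using exists_isRadialSol hn hf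
  obtain ⟨β, hβ, hnot, hfreq⟩ :=
    exists_threshold hn hf hw0 hw (hneg 0 le_rfl) hν hu hu0 hk hj hjk
  have hcont : ∀ α, ContinuousOn (fun r => w - u α r) (Ico 0 π) := fun α =>
    continuousOn_const.sub (hu α).cont
  obtain ⟨Z, hZ, hZcard⟩ := exists_zeros_of_not_alternates (hcont β)
    (d := fun r => -(flux n f (u β) r / sin r ^ n)) (by rw [hu0]; linarith [hβ.2])
    (fun r hr => ((hu β).hasDerivAt hf.continuous hr).const_sub w)
    (fun r hr h => neg_ne_zero.2 (div_ne_zero (flux_ne_zero_of_eq hf (hu β) hw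
      (by rw [hu0]; exact hβ.2.ne) hr (sub_eq_zero.1 h).symm) (sin_pow_pos hr).ne')) hnot
  have hZ' : ∀ r, r ∈ Z ↔ r ∈ Ioo 0 π ∧ u β r = w := fun r => by
    rw [hZ, sub_eq_zero, eq_comm (a := w)]
  have hfreq' : ∃ᶠ α in 𝓝 β, α ≠ w ∧
      ∃ ζ : Fin (j + 1) → ℝ, StrictMono ζ ∧ ∀ q, ζ q ∈ Ioo 0 π ∧ u α (ζ q) = w := by
    refine hfreq.mono fun α hα => ⟨hα.1, ?_⟩
    obtain ⟨ζ, hζ, hζ0⟩ := hα.2.exists_zeros (hcont α)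
    exact ⟨ζ, hζ, fun q => ⟨(hζ0 q).1, (sub_eq_zero.1 (hζ0 q).2).symm⟩⟩
  have hcard : Z.card = j :=
    le_antisymm (Nat.lt_succ_iff.1 hZcard)
      (le_card_of_frequently hn hf hw hu hu0 hβ.2.ne hZ' hfreq')
  obtain ⟨-, c, hc, hcb⟩ := exists_flux_limit hf.continuous (hu β) hB
  obtain rfl : c = 0 := flux_limit_eq_zero hn hf hw hB hu hu0 hβ.2.ne hZ' hZcard
    (hfreq'.mono fun α hα => hα.2) hc
  simp only [sub_zero] at hcb
  obtain ⟨v, hv, hv', huv⟩ := (hu β).exists_reflection hf.continuous hcb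
  have hpos := pos_of_flux_tendsto_zero hf hneg (hu β) (by rw [hu0]; exact hβ.1) hc
  have h0mem : (0 : ℝ) ∈ Ico 0 π := ⟨le_rfl, hπ⟩
  have hv0 : v 0 = β := by rw [← huv h0mem, hu0]
  have hne : ∀ c, f c = 0 → v π = c → ∀ r ∈ Ioo 0 π, v r = c := by
    intro c hc hvc r hr
    have h1 := abs_sub_le_of_isRadialSol hn hf hv' (isRadialSol_const n hc) (r := π - r)
      ⟨by linarith [hr.2], by linarith [hr.1]⟩
    simp only [sub_zero, sub_sub_cancel, hvc, sub_self, abs_zero, mul_zero, zero_mul] at h1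
    exact sub_eq_zero.1 (abs_eq_zero.1 (le_antisymm h1 (abs_nonneg _)))
  have hmid : π / 2 ∈ Ioo 0 π := ⟨by linarith, by linarith⟩
  have hvw : v π ≠ w := by
    intro h
    have hall := hne w hw h
    have hinf : (Ioo (0 : ℝ) π) ⊆ Z := fun r hr =>
      (hZ' r).2 ⟨hr, (huv (Ioo_subset_Ico_self hr)).trans (hall r hr)⟩
    exact (Ioo_infinite hπ) (Z.finite_toSet.subset hinf)
  refine ⟨v, hv, hv', ?_, hv0 ▸ hβ, hvw, Z, fun r => ?_, hcard⟩
  · intro r hr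
    rcases eq_or_lt_of_le hr.2 with h | h
    · subst h
      have hge : 0 ≤ v π := by
        have h1 := tendsto_nhdsGT_zero_of_continuousOn hv'.cont
        simp only [sub_zero] at h1
        refine ge_of_tendsto h1 ?_
        filter_upwards [Ioo_mem_nhdsGT hπ] with t ht
        have ht' : π - t ∈ Ico 0 π := ⟨by linarith [ht.2], by linarith [ht.1]⟩
        rw [← huv ht']
        exact (hpos _ ht').le
      refine lt_of_le_of_ne hge fun h => ?_
      have h2 := hne 0 (hneg 0 le_rfl) h.symm _ hmid
      rw [← huv (Ioo_subset_Ico_self hmid)] at h2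
      exact (hpos _ (Ioo_subset_Ico_self hmid)).ne' h2
    · rw [← huv ⟨hr.1, h⟩]
      exact hpos r ⟨hr.1, h⟩
  · rw [hZ']
    exact and_congr_right fun hr => by rw [huv (Ioo_subset_Ico_self hr)]

section

/-- The mechanical energy of a radial solution. -/
noncomputable def energy (n : ℕ) (f F u : ℝ → ℝ) (r : ℝ) : ℝ :=
  (flux n f u r / sin r ^ n) ^ 2 / 2 + F (u r)

/-- The Pohozaev functional of a radial solution. -/
noncomputable def pohozaev (n : ℕ) (f F u : ℝ → ℝ) (r : ℝ) : ℝ :=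
  sin r * flux n f u r ^ 2 / (2 * sin r ^ n) + sin r ^ (n + 1) * F (u r)
    + ((n : ℝ) - 1) / 2 * (cos r * u r * flux n f u r)
    + ((n : ℝ) - 1) / 4 * (sin r ^ (n + 1) * u r ^ 2)

variable {n : ℕ} {f F u : ℝ → ℝ}

lemma IsRadialSol.tendsto_flux_div_pow (hu : IsRadialSol n f u) (hf : Continuous f) :
    Tendsto (fun r => flux n f u r / sin r ^ n) (𝓝[>] 0) (𝓝 0) := by
  have h1 := hu.tendsto_flux_div hf
  have h2 : Tendsto sin (𝓝[>] 0) (𝓝 0) := by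
    have := continuous_sin.continuousAt.tendsto (x := (0 : ℝ))
    rw [sin_zero] at this
    exact this.mono_left nhdsWithin_le_nhds
  have h3 := h1.mul h2
  rw [mul_zero] at h3
  refine h3.congr' ?_
  filter_upwards [Ioo_mem_nhdsGT pi_pos] with r hr
  have := sin_pos_of_pos_of_lt_pi hr.1 hr.2
  field_simp
  ring

lemma hasDerivAt_sin_pow_succ (n : ℕ) (r : ℝ) :
    HasDerivAt (fun r => sin r ^ (n + 1)) ((n + 1) * sin r ^ n * cos r) r := by
  simpa using (hasDerivAt_sin r).fun_pow (n + 1)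

lemma hasDerivAt_sin_pow (n : ℕ) {r : ℝ} (hr : r ∈ Ioo 0 π) :
    HasDerivAt (fun r => sin r ^ n) (n * cos r * sin r ^ n / sin r) r := by
  have hs := sin_pos_of_pos_of_lt_pi hr.1 hr.2
  have h := (hasDerivAt_sin r).fun_pow n
  refine h.congr_deriv ?_
  rcases n with _ | n
  · simp
  · rw [Nat.add_sub_cancel, pow_succ]
    field_simp

lemma IsRadialSol.hasDerivAt_flux_div (hu : IsRadialSol n f u) (hf : Continuous f) {r : ℝ}
    (hr : r ∈ Ioo 0 π) :
    HasDerivAt (fun r => flux n f u r / sin r ^ n)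
      (-f (u r) - n * cos r / sin r * (flux n f u r / sin r ^ n)) r := by
  have hs := sin_pos_of_pos_of_lt_pi hr.1 hr.2
  have hg := sin_pow_pos (n := n) hr
  refine ((hu.hasDerivAt_flux hf hr).fun_div (hasDerivAt_sin_pow n hr) hg.ne').congr_deriv ?_
  field_simp

lemma IsRadialSol.continuousOn_energy (hu : IsRadialSol n f u) (hf : Continuous f)
    (hF : Continuous F) : ContinuousOn (energy n f F u) (Ico 0 π) := by
  refine ContinuousOn.add (ContinuousOn.div_const (ContinuousOn.pow ?_ 2) 2)
    (hF.comp_continuousOn hu.cont)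
  apply continuousOn_Ico_of_tendsto
  · simpa [flux_zero] using hu.tendsto_flux_div_pow hf
  · exact fun r hr => (hu.hasDerivAt_flux_div hf hr).continuousAt

lemma IsRadialSol.antitoneOn_energy (hu : IsRadialSol n f u) (hf : Continuous f)
    (hF : ∀ x, HasDerivAt F (f x) x) :
    AntitoneOn (energy n f F u) (Icc 0 (π / 2)) := by
  have hπ := pi_pos
  have hder : ∀ r ∈ Ioo 0 π, HasDerivAt (energy n f F u)
      (-(n * cos r / sin r * (flux n f u r / sin r ^ n) ^ 2)) r := by
    intro r hr
    have h1 := ((hu.hasDerivAt_flux_div hf hr).fun_pow 2).div_const 2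
    have h2 := (hF (u r)).comp r (hu.hasDerivAt hf hr)
    refine HasDerivAt.congr_deriv (f := energy n f F u) (h1.add h2) ?_
    ring
  have hFc : Continuous F := continuous_iff_continuousAt.2 fun x => (hF x).continuousAt
  have hsub : Icc 0 (π / 2) ⊆ Ico 0 π := fun r hr => ⟨hr.1, by linarith [hr.2]⟩
  have hsub' : interior (Icc 0 (π / 2)) ⊆ Ioo 0 π := by
    rw [interior_Icc]; exact fun r hr => ⟨hr.1, by linarith [hr.2]⟩
  refine antitoneOn_of_deriv_nonpos (convex_Icc _ _)
    ((hu.continuousOn_energy hf hFc).mono hsub)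
    (fun r hr => (hder r (hsub' hr)).differentiableAt.differentiableWithinAt) fun r hr => ?_
  rw [(hder r (hsub' hr)).deriv]
  have hs := sin_pos_of_pos_of_lt_pi (hsub' hr).1 (hsub' hr).2
  rw [interior_Icc] at hr
  have hc : 0 < cos r := cos_pos_of_mem_Ioo ⟨by linarith [hr.1], hr.2⟩
  have : 0 ≤ n * cos r / sin r * (flux n f u r / sin r ^ n) ^ 2 := by positivity
  linarith

lemma IsRadialSol.energy_le (hu : IsRadialSol n f u) (hf : Continuous f)
    (hF : ∀ x, HasDerivAt F (f x) x) {r : ℝ} (hr : r ∈ Icc 0 (π / 2)) :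
    energy n f F u r ≤ F (u 0) := by
  have h := hu.antitoneOn_energy hf hF ⟨le_rfl, hr.1.trans hr.2⟩ hr hr.1
  simpa [energy, flux_zero] using h

lemma IsRadialSol.potential_le (hu : IsRadialSol n f u) (hf : Continuous f)
    (hF : ∀ x, HasDerivAt F (f x) x) {r : ℝ} (hr : r ∈ Icc 0 (π / 2)) :
    F (u r) ≤ F (u 0) := by
  have h1 := hu.energy_le hf hF hr
  have h2 : 0 ≤ (flux n f u r / sin r ^ n) ^ 2 / 2 := by positivity
  unfold energy at h1
  linarith

lemma IsRadialSol.hasDerivAt_pohozaev (hu : IsRadialSol n f u) (hf : Continuous f)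
    (hF : ∀ x, HasDerivAt F (f x) x) {r : ℝ} (hr : r ∈ Ioo 0 π) :
    HasDerivAt (pohozaev n f F u) (sin r ^ n * cos r * ((n + 1) * F (u r)
      - ((n : ℝ) - 1) / 2 * (u r * f (u r)) + (n + 1) * ((n : ℝ) - 1) / 4 * u r ^ 2)) r := by
  have hs := sin_pos_of_pos_of_lt_pi hr.1 hr.2
  have hg := sin_pow_pos (n := n) hr
  have hz := hu.hasDerivAt_flux hf hr
  have hv := hu.hasDerivAt hf hr
  have h1 := ((hasDerivAt_sin r).fun_mul (hz.fun_pow 2)).fun_div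
    ((hasDerivAt_sin_pow n hr).const_mul 2) (by positivity)
  have h2 := (hasDerivAt_sin_pow_succ n r).fun_mul ((hF (u r)).comp r hv)
  have h3 := (((hasDerivAt_cos r).fun_mul hv).fun_mul hz).const_mul (((n : ℝ) - 1) / 2)
  have h4 := ((hasDerivAt_sin_pow_succ n r).fun_mul (hv.fun_pow 2)).const_mul (((n : ℝ) - 1) / 4)
  refine HasDerivAt.congr_deriv (f := pohozaev n f F u) (((h1.add h2).add h3).add h4) ?_
  simp only [Function.comp, pow_succ]
  field_simp
  ring

lemma IsRadialSol.continuousOn_pohozaev (hu : IsRadialSol n f u) (hf : Continuous f)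
    (hF : ∀ x, HasDerivAt F (f x) x) :
    ContinuousOn (pohozaev n f F u) (Ico 0 π) := by
  apply continuousOn_Ico_of_tendsto
  · have hFc : Continuous F := continuous_iff_continuousAt.2 fun x => (hF x).continuousAt
    have hz := tendsto_nhdsGT_zero_of_continuousOn (hu.continuousOn_flux hf)
    have hv := tendsto_nhdsGT_zero_of_continuousOn hu.cont
    have hFv := (hFc.tendsto _).comp hv
    have hs := tendsto_nhdsGT_zero_of_continuousOn continuous_sin.continuousOn
    have hc := tendsto_nhdsGT_zero_of_continuousOn continuous_cos.continuousOn
    have h1 := ((hs.mul hz).mul (hu.tendsto_flux_div_pow hf)).div_const 2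
    have h2 := (hs.pow (n + 1)).mul hFv
    have h3 := ((hc.mul hv).mul hz).const_mul (((n : ℝ) - 1) / 2)
    have h4 := ((hs.pow (n + 1)).mul (hv.pow 2)).const_mul (((n : ℝ) - 1) / 4)
    have h5 := ((h1.add h2).add h3).add h4
    have h6 : pohozaev n f F u 0 = 0 := by simp [pohozaev, flux_zero]
    rw [h6]
    simp only [sin_zero, flux_zero, mul_zero, zero_div, ne_eq, Nat.succ_ne_zero,
      not_false_eq_true, zero_pow, zero_mul, add_zero] at h5
    refine h5.congr fun r => ?_
    simp only [pohozaev, Function.comp]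
    ring
  · exact fun r hr => (hu.hasDerivAt_pohozaev hf hF hr).continuousAt

/-- The Pohozaev identity turned into a quantitative bound on a half sphere. -/
lemma IsRadialSol.pohozaev_bound (hu : IsRadialSol n f u) (hf : Continuous f)
    (hF : ∀ x, HasDerivAt F (f x) x) {G : ℝ → ℝ}
    (hG : ∀ x, G x = (n + 1) * F x - ((n : ℝ) - 1) / 2 * (x * f x)
      + (n + 1) * ((n : ℝ) - 1) / 4 * x ^ 2) {C H K s : ℝ} (hs : s ∈ Ioo 0 (π / 2))
    (hpos : ∀ r ∈ Ico 0 π, 0 < u r) (hC : ∀ x > 0, -C ≤ G x) (hH : ∀ x ≥ K, H ≤ G x)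
    (hK : ∀ r ∈ Icc 0 s, K ≤ u r) :
    (H + C) * sin s ^ (n + 1) - C ≤
      (n + 1) * (energy n f F u (π / 2) + ((n : ℝ) - 1) / 4 * u (π / 2) ^ 2) := by
  have hπ := pi_pos
  have hmono : ∀ (D a b : ℝ), 0 ≤ a → b ≤ π / 2 → a ≤ b → (∀ r ∈ Ioo a b, -D ≤ G (u r)) →
      (n + 1) * pohozaev n f F u a + D * sin a ^ (n + 1)
        ≤ (n + 1) * pohozaev n f F u b + D * sin b ^ (n + 1) := by
    intro D a b ha hb hab hD
    have hsub : Ioo a b ⊆ Ioo 0 π := fun r hr => ⟨ha.trans_lt hr.1, by linarith [hr.2]⟩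
    have hder : ∀ r ∈ Ioo a b, HasDerivAt
        (fun r => (n + 1) * pohozaev n f F u r + D * sin r ^ (n + 1))
        ((n + 1) * (sin r ^ n * cos r) * (G (u r) + D)) r := by
      intro r hr
      refine (((hu.hasDerivAt_pohozaev hf hF (hsub hr)).const_mul ((n : ℝ) + 1)).fun_add
        ((hasDerivAt_sin_pow_succ n r).const_mul D)).congr_deriv ?_
      rw [hG]; ring
    have hm : MonotoneOn (fun r => (n + 1) * pohozaev n f F u r + D * sin r ^ (n + 1))
        (Icc a b) := by
      refine monotoneOn_of_deriv_nonneg (convex_Icc _ _) ?_ ?_ ?_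
      · refine ContinuousOn.add (continuousOn_const.mul
          ((hu.continuousOn_pohozaev hf hF).mono fun r hr => ⟨ha.trans hr.1, ?_⟩)) ?_
        · linarith [hr.2]
        · exact (by fun_prop : Continuous fun r => D * sin r ^ (n + 1)).continuousOn
      · rw [interior_Icc]
        exact fun r hr => (hder r hr).differentiableAt.differentiableWithinAt
      · rw [interior_Icc]
        intro r hr
        rw [(hder r hr).deriv]
        have h1 := sin_pow_pos (n := n) (hsub hr)
        have h2 : 0 < cos r := cos_pos_of_mem_Ioo ⟨by linarith [hr.1], by linarith [hr.2]⟩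
        have h3 : 0 ≤ G (u r) + D := by linarith [hD r hr]
        positivity
    exact hm ⟨le_rfl, hab⟩ ⟨hab, le_rfl⟩ hab
  have h1 := hmono (-H) 0 s le_rfl hs.2.le hs.1.le fun r hr => by
    rw [neg_neg]; exact hH _ (hK r ⟨hr.1.le, hr.2.le⟩)
  have h2 := hmono C s (π / 2) hs.1.le le_rfl hs.2.le fun r hr =>
    hC _ (hpos r ⟨hs.1.le.trans hr.1.le, by linarith [hr.2]⟩)
  have h3 : pohozaev n f F u 0 = 0 := by simp [pohozaev, flux_zero]
  have h4 : pohozaev n f F u (π / 2)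
      = energy n f F u (π / 2) + ((n : ℝ) - 1) / 4 * u (π / 2) ^ 2 := by
    simp [pohozaev, energy]
  rw [h3] at h1
  rw [h4, sin_pi_div_two, one_pow] at h2
  simp only [sin_zero, ne_eq, Nat.succ_ne_zero, not_false_eq_true, zero_pow, mul_zero,
    add_zero] at h1
  linarith

end

section

/-- The nonlinearity `x ^ p - lam * x`. -/
noncomputable def powTerm (p lam x : ℝ) : ℝ := x ^ p - lam * x

/-- The function `f` frozen outside of `[0, M]`. -/
noncomputable def trunc (M : ℝ) (f : ℝ → ℝ) (x : ℝ) : ℝ := f (max 0 (min x M))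

/-- The primitive of `f` vanishing at `0`. -/
noncomputable def primitive (f : ℝ → ℝ) (x : ℝ) : ℝ := ∫ t in (0 : ℝ)..x, f t

lemma trunc_of_mem {M : ℝ} (f : ℝ → ℝ) {x : ℝ} (hx : x ∈ Icc 0 M) : trunc M f x = f x := by
  rw [trunc, min_eq_left hx.2, max_eq_right hx.1]

lemma trunc_of_ge {M : ℝ} (f : ℝ → ℝ) (hM : 0 ≤ M) {x : ℝ} (hx : M ≤ x) :
    trunc M f x = f M := by
  rw [trunc, min_eq_right hx, max_eq_right hM]

lemma trunc_of_nonpos {M : ℝ} (f : ℝ → ℝ) {x : ℝ} (hx : x ≤ 0) : trunc M f x = f 0 := by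
  rw [trunc, max_eq_left ((min_le_left _ _).trans hx)]

lemma clamp_mem {M : ℝ} (hM : 0 ≤ M) (x : ℝ) : max 0 (min x M) ∈ Icc 0 M :=
  ⟨le_max_left _ _, max_le hM (min_le_right _ _)⟩

lemma hasDerivAt_primitive {f : ℝ → ℝ} (hf : Continuous f) (x : ℝ) :
    HasDerivAt (primitive f) (f x) x :=
  hf.integral_hasStrictDerivAt 0 x |>.hasDerivAt

variable {p lam : ℝ}

lemma hasDerivAt_powTerm (hp : 1 < p) (x : ℝ) :
    HasDerivAt (powTerm p lam) (p * x ^ (p - 1) - lam) x := by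
  refine ((hasDerivAt_rpow_const (Or.inr hp.le)).sub
    ((hasDerivAt_id x).const_mul lam)).congr_deriv ?_
  simp

lemma continuous_powTerm (hp : 1 < p) : Continuous (powTerm p lam) :=
  continuous_iff_continuousAt.2 fun x => (hasDerivAt_powTerm hp x).continuousAt

lemma powTerm_zero (hp : 1 < p) : powTerm p lam 0 = 0 := by
  simp [powTerm, zero_rpow (by linarith : p ≠ 0)]

lemma exists_lipschitzWith_trunc_powTerm (hp : 1 < p) (hlam : 0 < lam) {M : ℝ} (hM : 0 ≤ M) :
    ∃ L, LipschitzWith L (trunc M (powTerm p lam)) := by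
  have h1 : LipschitzOnWith (p * M ^ (p - 1) + lam).toNNReal (powTerm p lam) (Icc 0 M) := by
    refine (convex_Icc 0 M).lipschitzOnWith_of_nnnorm_hasDerivWithin_le
      (fun x _ => (hasDerivAt_powTerm hp x).hasDerivWithinAt) fun x hx => ?_
    rw [← NNReal.coe_le_coe, coe_nnnorm, Real.norm_eq_abs, Real.coe_toNNReal _ (by positivity)]
    have h2 : x ^ (p - 1) ≤ M ^ (p - 1) := rpow_le_rpow hx.1 hx.2 (by linarith)
    have h3 : 0 ≤ x ^ (p - 1) := rpow_nonneg hx.1 _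
    rw [abs_le]
    constructor <;> nlinarith
  have h2 : LipschitzWith 1 fun x : ℝ => max 0 (min x M) :=
    (LipschitzWith.id.min_const M).const_max 0
  exact ⟨_, lipschitzOnWith_univ.1
    (h1.comp (lipschitzOnWith_univ.2 h2) fun x _ => clamp_mem hM x)⟩

lemma powTerm_eq (hp : 1 < p) {x : ℝ} (hx : 0 ≤ x) :
    powTerm p lam x = x * (x ^ (p - 1) - lam) := by
  have : x ^ p = x * x ^ (p - 1) := by
    rw [← rpow_one_add' hx (by linarith)]; ring_nf
  rw [powTerm, this]; ring

lemma abs_powTerm_le (hp : 1 < p) (hlam : 0 < lam) {M x : ℝ} (hM : lam ≤ M ^ (p - 1))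
    (hx : x ∈ Icc 0 M) : |powTerm p lam x| ≤ M ^ p := by
  have h0 : 0 ≤ M := hx.1.trans hx.2
  have h1 : M ^ p = M * M ^ (p - 1) := by
    rw [← rpow_one_add' h0 (by linarith)]; ring_nf
  have h2 : x ^ (p - 1) ≤ M ^ (p - 1) := rpow_le_rpow hx.1 hx.2 (by linarith)
  have h3 : 0 ≤ x ^ (p - 1) := rpow_nonneg hx.1 _
  rw [powTerm_eq hp hx.1, h1, abs_mul, abs_of_nonneg hx.1]
  exact mul_le_mul hx.2 (abs_le.2 ⟨by linarith, by linarith⟩) (abs_nonneg _) h0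

lemma primitive_trunc_powTerm_of_mem (hp : 1 < p) {M x : ℝ} (hx : x ∈ Icc 0 M) :
    primitive (trunc M (powTerm p lam)) x = x ^ 2 * (x ^ (p - 1) / (p + 1) - lam / 2) := by
  have h1 : primitive (trunc M (powTerm p lam)) x = ∫ t in (0 : ℝ)..x, (t ^ p - lam * t) := by
    refine intervalIntegral.integral_congr fun t ht => ?_
    rw [uIcc_of_le hx.1] at ht
    exact trunc_of_mem _ ⟨ht.1, ht.2.trans hx.2⟩
  have h2 : x ^ (p + 1) = x ^ 2 * x ^ (p - 1) := by
    rw [← rpow_natCast, ← rpow_add' hx.1 (by push_cast; linarith)]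
    congr 1; push_cast; ring
  rw [h1, intervalIntegral.integral_sub
      ((continuous_rpow_const (by linarith : 0 ≤ p)).intervalIntegrable _ _)
      ((continuous_const_mul lam).intervalIntegrable _ _),
    integral_rpow (Or.inl (by linarith)), intervalIntegral.integral_const_mul, integral_id,
    zero_rpow (by linarith), h2]
  ring

lemma continuous_trunc {f : ℝ → ℝ} (hf : Continuous f) (M : ℝ) : Continuous (trunc M f) := by
  unfold trunc; fun_prop

lemma primitive_trunc_of_ge {f : ℝ → ℝ} (hf : Continuous f) {M x : ℝ} (hM : 0 ≤ M) (hx : M ≤ x) :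
    primitive (trunc M f) x = primitive (trunc M f) M + f M * (x - M) := by
  have hc := continuous_trunc hf M
  have h1 : ∫ t in M..x, trunc M f t = f M * (x - M) := by
    have : ∫ t in M..x, trunc M f t = ∫ t in M..x, f M := by
      refine intervalIntegral.integral_congr fun t ht => ?_
      rw [uIcc_of_le hx] at ht
      exact trunc_of_ge f hM ht.1
    rw [this, intervalIntegral.integral_const, smul_eq_mul, mul_comm]
  rw [primitive, primitive, ← h1, intervalIntegral.integral_add_adjacent_intervals
    (hc.intervalIntegrable _ _) (hc.intervalIntegrable _ _)]

end

section

variable {p lam : ℝ}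

lemma powTerm_nonneg (hp : 1 < p) {x : ℝ} (hx : 0 ≤ x) (h : lam ≤ x ^ (p - 1)) :
    0 ≤ powTerm p lam x := by
  rw [powTerm_eq hp hx]; exact mul_nonneg hx (by linarith)

/-- Below the level `M`, the potential is smaller than at `M`. -/
lemma primitive_trunc_powTerm_lt (hp : 1 < p) {M x : ℝ}
    (hM : lam * (p + 1) / 2 < M ^ (p - 1)) (hx : 0 ≤ x) (hxM : x < M) :
    primitive (trunc M (powTerm p lam)) x < primitive (trunc M (powTerm p lam)) M := by
  have hM0 : 0 < M := hx.trans_lt hxM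
  rw [primitive_trunc_powTerm_of_mem hp ⟨hx, hxM.le⟩,
    primitive_trunc_powTerm_of_mem hp ⟨hM0.le, le_rfl⟩]
  have h1 : 0 < M ^ (p - 1) / (p + 1) - lam / 2 := by
    rw [sub_pos, lt_div_iff₀ (by linarith)]; linarith
  have h2 : x ^ (p - 1) / (p + 1) ≤ M ^ (p - 1) / (p + 1) :=
    div_le_div_of_nonneg_right (rpow_le_rpow hx hxM.le (by linarith)) (by linarith)
  have h3 : x ^ 2 < M ^ 2 := by nlinarith
  nlinarith [sq_nonneg x]

lemma primitive_trunc_powTerm_monotone (hp : 1 < p) {M x : ℝ} (hM0 : 0 ≤ M)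
    (hM : lam ≤ M ^ (p - 1)) (hxM : M ≤ x) :
    primitive (trunc M (powTerm p lam)) M ≤ primitive (trunc M (powTerm p lam)) x := by
  rw [primitive_trunc_of_ge (continuous_powTerm hp) hM0 hxM]
  have := powTerm_nonneg hp hM0 hM
  nlinarith

lemma lt_of_primitive_neg (hp : 1 < p) (hlam : 0 < lam) {M x : ℝ}
    (hM0 : 0 ≤ M) (hM : lam * (p + 1) / 2 < M ^ (p - 1)) (hx : 0 ≤ x)
    (h : primitive (trunc M (powTerm p lam)) x < 0) :
    x < (lam * (p + 1) / 2) ^ ((1 : ℝ) / (p - 1)) := by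
  have hp1 : (0 : ℝ) < p - 1 := by linarith
  have hxM : x < M := by
    by_contra! hc
    have h1 := primitive_trunc_powTerm_monotone (lam := lam) hp hM0 (by nlinarith) hc
    have h2 : 0 ≤ primitive (trunc M (powTerm p lam)) M := by
      rw [primitive_trunc_powTerm_of_mem hp ⟨hM0, le_rfl⟩]
      refine mul_nonneg (sq_nonneg _) ?_
      rw [sub_nonneg, le_div_iff₀ (by linarith)]; linarith
    linarith
  rw [primitive_trunc_powTerm_of_mem hp ⟨hx, hxM.le⟩] at h
  have h3 : x ^ (p - 1) / (p + 1) - lam / 2 < 0 := by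
    by_contra! hc
    have := mul_nonneg (sq_nonneg x) hc
    linarith
  rw [sub_neg, div_lt_iff₀ (by linarith)] at h3
  rw [one_div, lt_rpow_inv_iff_of_pos hx (by positivity) hp1]
  linarith

lemma primitive_neg_of_lt (hp : 1 < p) (hlam : 0 < lam) {M x : ℝ} (hx : 0 < x) (hxM : x ≤ M)
    (h : x < lam ^ ((1 : ℝ) / (p - 1))) : primitive (trunc M (powTerm p lam)) x < 0 := by
  have hp1 : (0 : ℝ) < p - 1 := by linarith
  rw [one_div, lt_rpow_inv_iff_of_pos hx.le hlam.le hp1] at h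
  rw [primitive_trunc_powTerm_of_mem hp ⟨hx.le, hxM⟩]
  refine mul_neg_of_pos_of_neg (by positivity) ?_
  rw [sub_neg, div_lt_iff₀ (by linarith)]
  nlinarith

/-- The density appearing in the Pohozaev identity. -/
noncomputable def pohozaevDensity (n : ℕ) (f : ℝ → ℝ) (x : ℝ) : ℝ :=
  (n + 1) * primitive f x - ((n : ℝ) - 1) / 2 * (x * f x) + (n + 1) * ((n : ℝ) - 1) / 4 * x ^ 2

lemma pohozaevDensity_of_mem (n : ℕ) (hp : 1 < p) {M x : ℝ} (hx : x ∈ Icc 0 M) :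
    pohozaevDensity n (trunc M (powTerm p lam)) x =
      x ^ 2 * (((n + 1) / (p + 1) - ((n : ℝ) - 1) / 2) * x ^ (p - 1)
        - (lam - (n + 1) * ((n : ℝ) - 1) / 4)) := by
  rw [pohozaevDensity, primitive_trunc_powTerm_of_mem hp hx, trunc_of_mem _ hx,
    powTerm_eq hp hx.1]
  field_simp
  ring

lemma pohozaevDensity_of_ge {n : ℕ} (hn : 1 ≤ n) (hp : 1 < p) {M x : ℝ} (hM0 : 0 ≤ M)
    (hM : lam ≤ M ^ (p - 1)) (hxM : M ≤ x) :
    pohozaevDensity n (trunc M (powTerm p lam)) M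
      ≤ pohozaevDensity n (trunc M (powTerm p lam)) x := by
  have h1 := powTerm_nonneg hp hM0 hM
  have hn1 : (1 : ℝ) ≤ n := by exact_mod_cast hn
  rw [pohozaevDensity, pohozaevDensity, primitive_trunc_of_ge (continuous_powTerm hp) hM0 hxM,
    trunc_of_ge _ hM0 hxM, trunc_of_ge _ hM0 le_rfl]
  have h2 : 0 ≤ ((n : ℝ) + 3) / 2 * (powTerm p lam M * (x - M)) :=
    mul_nonneg (by positivity) (mul_nonneg h1 (by linarith))
  have h3 : 0 ≤ (n + 1) * ((n : ℝ) - 1) / 4 * (x ^ 2 - M ^ 2) :=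
    mul_nonneg (div_nonneg (mul_nonneg (by positivity) (by linarith)) (by norm_num))
      (by nlinarith)
  linarith

/-- Lower bounds for the Pohozaev density, uniform with respect to the truncation level. -/
lemma exists_pohozaevDensity_bounds {n : ℕ} (hn : 1 ≤ n) (hp : 1 < p)
    (hsub : p * ((n : ℝ) - 1) < n + 3) :
    ∃ K₀ C δ : ℝ, 1 ≤ K₀ ∧ 0 ≤ C ∧ 0 < δ ∧ ∀ M : ℝ, 0 ≤ M → lam ≤ M ^ (p - 1) →
      (∀ x > 0, -C ≤ pohozaevDensity n (trunc M (powTerm p lam)) x) ∧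
      (2 * K₀ ≤ M → ∀ x ≥ M / 2,
        δ * M ^ (p + 1) ≤ pohozaevDensity n (trunc M (powTerm p lam)) x) := by
  have hn1 : (1 : ℝ) ≤ n := by exact_mod_cast hn
  obtain ⟨d, hd⟩ : ∃ d, d = ((n : ℝ) + 1) / (p + 1) - ((n : ℝ) - 1) / 2 := ⟨_, rfl⟩
  obtain ⟨κ, hκ⟩ : ∃ κ, κ = lam - (n + 1) * ((n : ℝ) - 1) / 4 := ⟨_, rfl⟩
  have hd0 : 0 < d := by
    rw [hd, sub_pos, div_lt_div_iff₀ (by norm_num) (by linarith)]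
    linarith
  obtain ⟨K₀, hK1, hK⟩ : ∃ K₀ : ℝ, 1 ≤ K₀ ∧ ∀ x ≥ K₀, 2 * κ / d ≤ x ^ (p - 1) := by
    obtain ⟨K, hK⟩ := ((tendsto_rpow_atTop (by linarith : 0 < p - 1)).eventually_ge_atTop
      (2 * κ / d)).exists_forall_of_atTop
    exact ⟨max 1 K, le_max_left _ _, fun x hx => hK x ((le_max_right _ _).trans hx)⟩
  have hlow : ∀ M x : ℝ, x ∈ Icc 0 M → K₀ ≤ x →
      d / 2 * x ^ (p + 1) ≤ pohozaevDensity n (trunc M (powTerm p lam)) x := by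
    intro M x hx hKx
    rw [pohozaevDensity_of_mem n hp hx, ← hd, ← hκ]
    have h1 := hK x hKx
    rw [div_le_iff₀ hd0] at h1
    have h2 : x ^ (p + 1) = x ^ 2 * x ^ (p - 1) := by
      rw [← rpow_natCast, ← rpow_add' hx.1 (by push_cast; linarith)]
      congr 1; push_cast; ring
    rw [h2]
    nlinarith [sq_nonneg x]
  refine ⟨K₀, |κ| * K₀ ^ 2, d / 2 * (1 / 2) ^ (p + 1), hK1, by positivity, by positivity,
    fun M hM0 hM => ⟨?_, ?_⟩⟩
  · have hmem : ∀ x ∈ Icc 0 M,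
        -(|κ| * K₀ ^ 2) ≤ pohozaevDensity n (trunc M (powTerm p lam)) x := by
      intro x hx
      rcases le_total K₀ x with h | h
      · have h1 := hlow M x hx h
        have h2 : 0 ≤ d / 2 * x ^ (p + 1) := by have := hx.1; positivity
        have h3 : 0 ≤ |κ| * K₀ ^ 2 := by positivity
        linarith
      · rw [pohozaevDensity_of_mem n hp hx, ← hd, ← hκ]
        have h1 : 0 ≤ x ^ 2 * (d * x ^ (p - 1)) := by have := hx.1; positivity
        have h2 : x ^ 2 * κ ≤ K₀ ^ 2 * |κ| :=
          (mul_le_mul_of_nonneg_left (le_abs_self κ) (sq_nonneg x)).trans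
            (mul_le_mul_of_nonneg_right (by nlinarith [hx.1]) (abs_nonneg κ))
        linarith
    intro x hx
    rcases le_total x M with h | h
    · exact hmem x ⟨hx.le, h⟩
    · exact (hmem M ⟨hM0, le_rfl⟩).trans (pohozaevDensity_of_ge hn hp hM0 hM h)
  · intro hKM
    have hmem : ∀ x ∈ Icc 0 M, M / 2 ≤ x →
        d / 2 * (1 / 2) ^ (p + 1) * M ^ (p + 1)
          ≤ pohozaevDensity n (trunc M (powTerm p lam)) x := by
      intro x hx hMx
      refine le_trans ?_ (hlow M x hx (by linarith))
      rw [mul_assoc, ← mul_rpow (by norm_num) hM0]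
      gcongr
      linarith
    intro x hx
    rcases le_total x M with h | h
    · exact hmem x ⟨by linarith [hx], h⟩ hx
    · exact (hmem M ⟨hM0, le_rfl⟩ (by linarith)).trans (pohozaevDensity_of_ge hn hp hM0 hM h)

end

section

variable {p lam : ℝ} {n : ℕ}

/-- A radial solution moves slowly away from its initial value. -/
lemma IsRadialSol.abs_sub_le_mul_sq {f u : ℝ → ℝ} (hu : IsRadialSol n f u) (hf : Continuous f)
    {B : ℝ} (hB : ∀ x, |f x| ≤ B) {r : ℝ} (hr : r ∈ Icc 0 (π / 2)) :
    |u r - u 0| ≤ B * r ^ 2 := by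
  have hπ := pi_pos
  have hB0 : 0 ≤ B := (abs_nonneg _).trans (hB 0)
  rw [hu.eq r ⟨hr.1, by linarith [hr.2]⟩, sub_sub_cancel_left, abs_neg]
  have h := intervalIntegral.norm_integral_le_of_norm_le_const (a := 0) (b := r) (C := B * r)
    (f := sinMean n fun t => f (u t)) fun s hs => by
      rw [uIoc_of_le hr.1] at hs
      have hs' : s ∈ Ioo 0 π := ⟨hs.1, by linarith [hs.2, hr.2]⟩
      have h1 := abs_sinMean_le (n := n) (hu.continuousOn_comp hf) hs' fun t _ => hB (u t)
      refine h1.trans (mul_le_mul_of_nonneg_left ?_ hB0)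
      rw [div_le_iff₀ (sin_pow_pos hs')]
      exact (integral_sin_pow_le n hs.1.le (hs.2.trans hr.2)).trans
        (mul_le_mul_of_nonneg_right hs.2 (sin_pow_pos hs').le)
  rw [Real.norm_eq_abs, sub_zero, abs_of_nonneg hr.1] at h
  calc _ ≤ B * r * r := h
    _ = B * r ^ 2 := by ring

/-- The energies of a solution and of its reflection agree on the equator. -/
lemma energy_reflection {f F u : ℝ → ℝ} (hf : Continuous f) (hu : IsRadialSol n f u)
    (hv : IsRadialSol n f fun r => u (π - r)) :
    energy n f F (fun r => u (π - r)) (π / 2) = energy n f F u (π / 2) := by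
  have hπ := pi_pos
  have hm : π / 2 ∈ Ioo 0 π := ⟨by linarith, by linarith⟩
  have h0 : π - π / 2 = π / 2 := by ring
  have h1 := hv.hasDerivAt hf hm
  have h2 := hu.hasDerivAt hf hm
  rw [← h0] at h2
  have h3 := h2.comp (π / 2) ((hasDerivAt_id (π / 2)).const_sub π)
  have h4 := h1.unique h3
  rw [h0] at h4
  simp only [energy, h4, h0]
  ring

lemma exists_large_truncation (hn : 1 ≤ n) (hp : 1 < p) (hlam : 0 < lam)
    (hsub : p * ((n : ℝ) - 1) < n + 3) :
    ∃ M : ℝ, 0 < M ∧ lam ^ ((1 : ℝ) / (p - 1)) < M ∧ lam * (p + 1) / 2 < M ^ (p - 1) ∧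
      ∀ u : ℝ → ℝ, IsRadialSol n (trunc M (powTerm p lam)) u →
        IsRadialSol n (trunc M (powTerm p lam)) (fun r => u (π - r)) →
        (∀ r ∈ Icc 0 π, 0 < u r) → u 0 ∈ Ioo 0 (lam ^ ((1 : ℝ) / (p - 1))) →
        ∀ r ∈ Icc 0 π, u r ≤ M := by
  have hπ := pi_pos
  have hp1 : (0 : ℝ) < p - 1 := by linarith
  have hn1 : (1 : ℝ) ≤ n := by exact_mod_cast hn
  obtain ⟨K₀, C, δ, hK0, hC0, hδ, hG⟩ := exists_pohozaevDensity_bounds (lam := lam) hn hp hsub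
  obtain ⟨U, hU⟩ : ∃ U, U = (lam * (p + 1) / 2) ^ ((1 : ℝ) / (p - 1)) := ⟨_, rfl⟩
  obtain ⟨e, he⟩ : ∃ e, e = (p + 1) - (p - 1) / 2 * (n + 1) := ⟨_, rfl⟩
  have he0 : 0 < e := by rw [he]; linarith
  have hlim : Tendsto (fun M : ℝ => δ * (1 / 4) ^ (n + 1) * M ^ e) atTop atTop :=
    (tendsto_rpow_atTop he0).const_mul_atTop (by positivity)
  obtain ⟨M, hM1, hMU, hMK, hML⟩ := ((eventually_ge_atTop 1).and ((eventually_gt_atTop U).and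
    ((eventually_ge_atTop (2 * K₀)).and (hlim.eventually_gt_atTop
      (C + (n + 1) * (((n : ℝ) - 1) / 4 * U ^ 2)))))).exists
  have hM0 : 0 < M := by linarith
  have hMp : lam * (p + 1) / 2 < M ^ (p - 1) := by
    rw [hU, one_div, rpow_inv_lt_iff_of_pos (by positivity) hM0.le hp1] at hMU
    exact hMU
  have hMl : lam < M ^ (p - 1) := by nlinarith
  have hwM : lam ^ ((1 : ℝ) / (p - 1)) < M := by
    rw [one_div, rpow_inv_lt_iff_of_pos hlam.le hM0.le hp1]
    exact hMl
  refine ⟨M, hM0, hwM, hMp, fun u hu hv hpos hu0 => ?_⟩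
  obtain ⟨hG1, hG2⟩ := hG M hM0.le hMl.le
  have hf : Continuous (trunc M (powTerm p lam)) := continuous_trunc (continuous_powTerm hp) M
  have hF := hasDerivAt_primitive hf
  have hneg : primitive (trunc M (powTerm p lam)) (u 0) < 0 :=
    primitive_neg_of_lt hp hlam hu0.1 (hu0.2.trans hwM).le hu0.2
  have hhalf : ∀ r ∈ Icc 0 (π / 2), u r < U := fun r hr => hU ▸
    lt_of_primitive_neg hp hlam hM0.le hMp (hpos r ⟨hr.1, by linarith [hr.2]⟩).le
      ((hu.potential_le hf hF hr).trans_lt hneg)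
  intro r hr
  by_contra! hur
  have hr2 : π / 2 < r := by
    by_contra! hc
    linarith [hhalf r ⟨hr.1, hc⟩]
  have hv0 : M ≤ u (π - 0) := by
    by_contra! hc
    have h1 := hv.potential_le hf hF (r := π - r) ⟨by linarith [hr.2], by linarith⟩
    simp only [sub_sub_cancel] at h1
    have h2 := primitive_trunc_powTerm_monotone (lam := lam) hp hM0.le hMl.le hur.le
    have h3 := primitive_trunc_powTerm_lt (lam := lam) hp hMp
      (hpos (π - 0) ⟨by linarith, by linarith⟩).le hc
    linarith
  have hB : ∀ x, |trunc M (powTerm p lam) x| ≤ M ^ p := fun x =>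
    abs_powTerm_le hp hlam hMl.le (clamp_mem hM0.le x)
  obtain ⟨s, hs⟩ : ∃ s, s = M ^ (-(p - 1) / 2) / 2 := ⟨_, rfl⟩
  have hs0 : 0 < s := by rw [hs]; positivity
  have hs1 : s ≤ 1 / 2 := by
    have : M ^ (-(p - 1) / 2) ≤ 1 := rpow_le_one_of_one_le_of_nonpos hM1 (by linarith)
    rw [hs]; linarith
  have hsπ : s < π / 2 := by linarith [pi_gt_three]
  have hss : M ^ p * s ^ 2 = M / 4 := by
    have h1 : M ^ p * (M ^ (-(p - 1) / 2)) ^ 2 = M := by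
      rw [← rpow_natCast, ← rpow_mul hM0.le, ← rpow_add hM0]
      conv_rhs => rw [← rpow_one M]
      congr 1; push_cast; ring
    rw [hs, div_pow, ← mul_div_assoc, h1]; norm_num
  have hKv : ∀ t ∈ Icc 0 s, M / 2 ≤ u (π - t) := by
    intro t ht
    have h1 := hv.abs_sub_le_mul_sq hf hB (r := t) ⟨ht.1, ht.2.trans hsπ.le⟩
    have h2 : M ^ p * t ^ 2 ≤ M ^ p * s ^ 2 :=
      mul_le_mul_of_nonneg_left (pow_le_pow_left₀ ht.1 ht.2 2) (by positivity)
    have h3 := (abs_le.1 h1).1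
    linarith
  have hpoh := hv.pohozaev_bound hf hF (fun _ => rfl) ⟨hs0, hsπ⟩
    (fun t ht => hpos _ ⟨by linarith [ht.2], by linarith [ht.1]⟩) hG1 (hG2 hMK) hKv
  rw [energy_reflection hf hu hv] at hpoh
  have hen := (hu.energy_le hf hF (r := π / 2) ⟨by linarith, le_rfl⟩).trans_lt hneg
  have hmid : π - π / 2 = π / 2 := by ring
  have hum := hhalf (π / 2) ⟨by linarith, le_rfl⟩
  have hum0 := hpos (π / 2) ⟨by linarith, by linarith⟩
  rw [hmid] at hpoh
  have hsin : (1 / 4 * M ^ (-(p - 1) / 2)) ^ (n + 1) ≤ sin s ^ (n + 1) := by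
    refine pow_le_pow_left₀ (by positivity) ?_ _
    have h1 := mul_le_sin hs0.le hsπ.le
    have h2 : (1 : ℝ) / 2 ≤ 2 / π := by
      rw [div_le_div_iff₀ (by norm_num) hπ]; linarith [pi_lt_four]
    calc 1 / 4 * M ^ (-(p - 1) / 2) = 1 / 2 * s := by rw [hs]; ring
      _ ≤ 2 / π * s := mul_le_mul_of_nonneg_right h2 hs0.le
      _ ≤ sin s := h1
  have hmain : δ * (1 / 4) ^ (n + 1) * M ^ e ≤ δ * M ^ (p + 1) * sin s ^ (n + 1) := by
    have h1 : M ^ e = M ^ (p + 1) * (M ^ (-(p - 1) / 2)) ^ (n + 1) := by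
      rw [← rpow_natCast, ← rpow_mul hM0.le, ← rpow_add hM0, he]
      congr 1; push_cast; ring
    calc _ = δ * M ^ (p + 1) * (1 / 4 * M ^ (-(p - 1) / 2)) ^ (n + 1) := by
            rw [h1, mul_pow]; ring
      _ ≤ _ := mul_le_mul_of_nonneg_left hsin (by positivity)
  have hCs : 0 ≤ C * sin s ^ (n + 1) :=
    mul_nonneg hC0 (pow_nonneg (sin_pos_of_pos_of_lt_pi hs0 (by linarith)).le _)
  have hend : (n + 1) * (energy n (trunc M (powTerm p lam))
      (primitive (trunc M (powTerm p lam))) u (π / 2) + ((n : ℝ) - 1) / 4 * u (π / 2) ^ 2)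
      ≤ (n + 1) * (((n : ℝ) - 1) / 4 * U ^ 2) := by
    refine mul_le_mul_of_nonneg_left ?_ (by positivity)
    have h1 : u (π / 2) ^ 2 ≤ U ^ 2 := pow_le_pow_left₀ hum0.le hum.le 2
    have h2 : ((n : ℝ) - 1) / 4 * u (π / 2) ^ 2 ≤ ((n : ℝ) - 1) / 4 * U ^ 2 :=
      mul_le_mul_of_nonneg_left h1 (by linarith)
    linarith
  linarith

lemma IsRadialSol.congr {f g u : ℝ → ℝ} (hu : IsRadialSol n f u)
    (h : ∀ r ∈ Ico 0 π, f (u r) = g (u r)) : IsRadialSol n g u := by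
  refine ⟨hu.cont, fun r hr => ?_⟩
  rw [hu.eq r hr]
  congr 1
  refine intervalIntegral.integral_congr fun s hs => ?_
  rw [uIcc_of_le hr.1] at hs
  simp only [sinMean]
  congr 1
  refine intervalIntegral.integral_congr fun t ht => ?_
  rw [uIcc_of_le hs.1] at ht
  simp only [h t ⟨ht.1, (ht.2.trans hs.2).trans_lt hr.2⟩]

lemma flux_congr {f g u : ℝ → ℝ} (h : ∀ r ∈ Ico 0 π, f (u r) = g (u r)) {r : ℝ}
    (hr : r ∈ Ico 0 π) : flux n f u r = flux n g u r := by
  rw [flux, flux]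
  congr 1
  refine intervalIntegral.integral_congr fun t ht => ?_
  rw [uIcc_of_le hr.1] at ht
  simp only [h t ⟨ht.1, ht.2.trans_lt hr.2⟩]

theorem exists_powTerm_solution (hn : 1 ≤ n) (hp : 1 < p) (hlam : 0 < lam)
    (hsub : p * ((n : ℝ) - 1) < n + 3) {j k : ℕ} (hj : 1 ≤ j) (hjk : j ≤ k)
    (hk : (k : ℝ) * (k + n) < (p - 1) * lam) :
    ∃ u : ℝ → ℝ, IsRadialSol n (powTerm p lam) u ∧
      IsRadialSol n (powTerm p lam) (fun r => u (π - r)) ∧ (∀ r ∈ Icc 0 π, 0 < u r) ∧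
      u 0 ≠ lam ^ ((1 : ℝ) / (p - 1)) ∧ u π ≠ lam ^ ((1 : ℝ) / (p - 1)) ∧
      ∃ Z : Finset ℝ, (∀ r, r ∈ Z ↔ r ∈ Ioo 0 π ∧ u r = lam ^ ((1 : ℝ) / (p - 1))) ∧
        (∀ r ∈ Z, flux n (powTerm p lam) u r ≠ 0) ∧ Z.card = j := by
  have hp1 : (0 : ℝ) < p - 1 := by linarith
  obtain ⟨w, hw⟩ : ∃ w, w = lam ^ ((1 : ℝ) / (p - 1)) := ⟨_, rfl⟩
  have hw0 : 0 < w := by rw [hw]; positivity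
  have hwp : w ^ (p - 1) = lam := by
    rw [hw, ← rpow_mul hlam.le, one_div, inv_mul_cancel₀ hp1.ne', rpow_one]
  obtain ⟨M, hM0, hwM, hMp, hbound⟩ := exists_large_truncation hn hp hlam hsub
  have hMl : lam < M ^ (p - 1) := by nlinarith
  obtain ⟨L, hL⟩ := exists_lipschitzWith_trunc_powTerm hp hlam hM0.le
  have hfw : powTerm p lam w = 0 := by rw [powTerm_eq hp hw0.le, hwp]; ring
  have htw : trunc M (powTerm p lam) w = 0 := by
    rw [trunc_of_mem _ ⟨hw0.le, (hw ▸ hwM).le⟩, hfw]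
  have hder : HasDerivAt (trunc M (powTerm p lam)) ((p - 1) * lam) w := by
    have h1 := hasDerivAt_powTerm (lam := lam) hp w
    rw [hwp] at h1
    refine (h1.congr_of_eventuallyEq ?_).congr_deriv (by ring)
    filter_upwards [Ioo_mem_nhds hw0 (hw ▸ hwM)] with x hx
    exact trunc_of_mem _ ⟨hx.1.le, hx.2.le⟩
  obtain ⟨u, hu, hv, hpos, hu0, huπ, Z, hZ, hcard⟩ := exists_radial_solution hn hL hw0 htw hder
    (fun x => abs_powTerm_le hp hlam hMl.le (clamp_mem hM0.le x))
    (fun x hx => by rw [trunc_of_nonpos _ hx, powTerm_zero hp]) hj hjk hk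
  have hle := hbound u hu hv hpos (hw ▸ hu0)
  have heq : ∀ r ∈ Icc 0 π, trunc M (powTerm p lam) (u r) = powTerm p lam (u r) :=
    fun r hr => trunc_of_mem _ ⟨(hpos r hr).le, hle r hr⟩
  have heq1 : ∀ r ∈ Ico 0 π, trunc M (powTerm p lam) (u r) = powTerm p lam (u r) :=
    fun r hr => heq r ⟨hr.1, hr.2.le⟩
  rw [← hw]
  refine ⟨u, hu.congr heq1, hv.congr fun r hr => heq _ ⟨by linarith [hr.2], by linarith [hr.1]⟩,
    hpos, hu0.2.ne, huπ, Z, hZ, fun r hr => ?_, hcard⟩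
  obtain ⟨hr1, hr2⟩ := (hZ r).1 hr
  rw [← flux_congr heq1 ⟨hr1.1.le, hr1.2⟩]
  exact flux_ne_zero_of_eq hL hu htw hu0.2.ne hr1 hr2

end

section

variable {n : ℕ} {f f' u : ℝ → ℝ}

/-- The second derivative, with respect to `t = cos r`, of a radial solution. -/
noncomputable def axialSecond (n : ℕ) (f u : ℝ → ℝ) (r : ℝ) : ℝ :=
  (-((n + 1) * cos r * flux n f u r) - sin r ^ (n + 1) * f (u r)) / sin r ^ (n + 3)

lemma IsRadialSol.tendsto_axialSecond (hu : IsRadialSol n f u) (hf : ∀ x, HasDerivAt f (f' x) x)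
    (hf' : Continuous f') : ∃ l, Tendsto (axialSecond n f u) (𝓝[>] 0) (𝓝 l) := by
  have hπ := pi_pos
  have hfc : Continuous f := continuous_iff_continuousAt.2 fun x => (hf x).continuousAt
  have hz0 := tendsto_nhdsGT_zero_of_continuousOn (hu.continuousOn_flux hfc)
  have hv0 := tendsto_nhdsGT_zero_of_continuousOn hu.cont
  have hs0 := tendsto_nhdsGT_zero_of_continuousOn continuous_sin.continuousOn
  have hc0 := tendsto_nhdsGT_zero_of_continuousOn continuous_cos.continuousOn
  have hnum : ∀ r ∈ Ioo 0 (π / 2), HasDerivAt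
      (fun r => -((n + 1) * cos r * flux n f u r) - sin r ^ (n + 1) * f (u r))
      (sin r * flux n f u r * (n + 1 - f' (u r))) r := by
    intro r hr
    have hr' : r ∈ Ioo 0 π := ⟨hr.1, by linarith [hr.2]⟩
    have hg := sin_pow_pos (n := n) hr'
    have h1 := (((hasDerivAt_cos r).const_mul ((n : ℝ) + 1)).fun_mul
      (hu.hasDerivAt_flux hfc hr')).fun_neg
    have h2 := (hasDerivAt_sin_pow_succ n r).fun_mul ((hf (u r)).comp r (hu.hasDerivAt hfc hr'))
    refine (h1.sub h2).congr_deriv ?_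
    simp only [Function.comp, pow_succ]
    field_simp
    ring
  have hden : ∀ r : ℝ, HasDerivAt (fun r => sin r ^ (n + 3))
      ((n + 3) * sin r ^ (n + 2) * cos r) r := by
    intro r
    refine (hasDerivAt_sin_pow_succ (n + 2) r).congr_deriv ?_
    push_cast; ring
  have hlim := ((hu.tendsto_flux_div hfc).mul (((hf'.tendsto _).comp hv0).const_sub
    ((n : ℝ) + 1))).div (hc0.const_mul ((n : ℝ) + 3)) (by rw [cos_zero]; positivity)
  refine ⟨_, HasDerivAt.lhopital_zero_right_on_Ioo (by linarith : (0 : ℝ) < π / 2) hnum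
    (fun r _ => hden r) (fun r hr => ?_) ?_ ?_ (hlim.congr' ?_)⟩
  · have h1 := sin_pos_of_pos_of_lt_pi hr.1 (by linarith [hr.2])
    have h2 : 0 < cos r := cos_pos_of_mem_Ioo ⟨by linarith [hr.1], hr.2⟩
    positivity
  · have := ((hc0.const_mul ((n : ℝ) + 1)).mul hz0).neg.sub
      ((hs0.pow (n + 1)).mul ((hfc.tendsto _).comp hv0))
    simpa [flux_zero] using this
  · simpa using hs0.pow (n + 3)
  · filter_upwards [Ioo_mem_nhdsGT (by linarith : (0 : ℝ) < π / 2)] with r hr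
    have h1 := sin_pos_of_pos_of_lt_pi hr.1 (by linarith [hr.2])
    have h2 : 0 < cos r := cos_pos_of_mem_Ioo ⟨by linarith [hr.1], hr.2⟩
    simp only [Function.comp, Pi.div_apply, pow_succ]
    field_simp

lemma flux_reflection (hf : Continuous f) (hu : IsRadialSol n f u)
    (hv : IsRadialSol n f fun r => u (π - r)) {r : ℝ} (hr : r ∈ Ioo 0 π) :
    flux n f (fun r => u (π - r)) r = -flux n f u (π - r) := by
  have hr' : π - r ∈ Ioo 0 π := ⟨by linarith [hr.2], by linarith [hr.1]⟩
  have h1 := hv.hasDerivAt hf hr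
  have h2 := (hu.hasDerivAt hf hr').comp r ((hasDerivAt_id r).const_sub π)
  have h3 := h1.unique h2
  rw [sin_pi_sub] at h3
  have := sin_pow_pos (n := n) hr
  field_simp at h3
  linarith

lemma axialSecond_reflection (hf : Continuous f) (hu : IsRadialSol n f u)
    (hv : IsRadialSol n f fun r => u (π - r)) {r : ℝ} (hr : r ∈ Ioo 0 π) :
    axialSecond n f (fun r => u (π - r)) r = axialSecond n f u (π - r) := by
  rw [axialSecond, axialSecond, flux_reflection hf hu hv hr, sin_pi_sub, cos_pi_sub]
  ring

lemma tendsto_const_sub_nhdsLT (a : ℝ) : Tendsto (fun r => a - r) (𝓝[<] a) (𝓝[>] 0) := by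
  refine tendsto_nhdsWithin_iff.2 ⟨?_, ?_⟩
  · have : Tendsto (fun r => a - r) (𝓝 a) (𝓝 (a - a)) :=
      (continuous_const.sub continuous_id).tendsto a
    rw [sub_self] at this
    exact this.mono_left nhdsWithin_le_nhds
  · filter_upwards [self_mem_nhdsWithin] with r hr
    exact sub_pos.2 (mem_Iio.1 hr)

/-- A function whose second derivative on `(-1, 1)` extends continuously has a global `C²`
extension. -/
lemma exists_extension_of_second_deriv {y y₁ g : ℝ → ℝ} (hgc : Continuous g) (hyc : Continuous y)
    (hdy : ∀ t ∈ Ioo (-1 : ℝ) 1, HasDerivAt y (y₁ t) t)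
    (hdy₁ : ∀ t ∈ Ioo (-1 : ℝ) 1, HasDerivAt y₁ (g t) t) :
    ∃ W W₁ : ℝ → ℝ, (∀ t, HasDerivAt W (W₁ t) t) ∧ (∀ t, HasDerivAt W₁ (g t) t) ∧
      EqOn W y (Icc (-1) 1) ∧ EqOn W₁ y₁ (Ioo (-1) 1) := by
  obtain ⟨W₁, hW₁⟩ : ∃ W₁ : ℝ → ℝ, W₁ = fun t => y₁ 0 + ∫ s in (0 : ℝ)..t, g s := ⟨_, rfl⟩
  have hdW₁ : ∀ t, HasDerivAt W₁ (g t) t := fun t => by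
    rw [hW₁]
    exact (hgc.integral_hasStrictDerivAt 0 t).hasDerivAt.const_add _
  have hW₁c : Continuous W₁ := continuous_iff_continuousAt.2 fun t => (hdW₁ t).continuousAt
  obtain ⟨W, hW⟩ : ∃ W : ℝ → ℝ, W = fun t => y 0 + ∫ s in (0 : ℝ)..t, W₁ s := ⟨_, rfl⟩
  have hdW : ∀ t, HasDerivAt W (W₁ t) t := fun t => by
    rw [hW]
    exact (hW₁c.integral_hasStrictDerivAt 0 t).hasDerivAt.const_add _
  have hWc : Continuous W := continuous_iff_continuousAt.2 fun t => (hdW t).continuousAt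
  have h0 : (0 : ℝ) ∈ Ioo (-1 : ℝ) 1 := by constructor <;> norm_num
  have huniq : ∀ A B C : ℝ → ℝ, (∀ t ∈ Ioo (-1 : ℝ) 1, HasDerivAt A (C t) t) →
      (∀ t ∈ Ioo (-1 : ℝ) 1, HasDerivAt B (C t) t) → A 0 = B 0 → EqOn A B (Ioo (-1) 1) := by
    intro A B C hA hB hAB
    refine isOpen_Ioo.eqOn_of_deriv_eq isPreconnected_Ioo
      (fun t ht => (hA t ht).differentiableAt.differentiableWithinAt)
      (fun t ht => (hB t ht).differentiableAt.differentiableWithinAt)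
      (fun t ht => by rw [(hA t ht).deriv, (hB t ht).deriv]) h0 hAB
  have hE₁ : EqOn W₁ y₁ (Ioo (-1) 1) := huniq _ _ g (fun t _ => hdW₁ t) hdy₁ (by simp [hW₁])
  have hE : EqOn W y (Ioo (-1) 1) := huniq _ _ y₁ (fun t ht => hE₁ ht ▸ hdW t) hdy (by simp [hW])
  have hclos : closure (Ioo (-1 : ℝ) 1) = Icc (-1) 1 := closure_Ioo (by norm_num)
  exact ⟨W, W₁, hdW, hdW₁, hclos ▸ hE.closure hWc hyc, hE₁⟩

lemma continuousOn_Icc_of_reflection (hu : IsRadialSol n f u)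
    (hv : IsRadialSol n f fun r => u (π - r)) : ContinuousOn u (Icc 0 π) := by
  have hπ := pi_pos
  intro r hr
  rcases hr.2.lt_or_eq with h | h
  · refine (hu.cont r ⟨hr.1, h⟩).mono_of_mem_nhdsWithin ?_
    exact mem_nhdsWithin.2 ⟨Iio π, isOpen_Iio, h, fun s hs => ⟨hs.2.1, hs.1⟩⟩
  · have h1 : ContinuousOn (fun r => u (π - (π - r))) (Ioc 0 π) :=
      hv.cont.comp (continuous_const.sub continuous_id).continuousOn
        fun s hs => ⟨by simpa using hs.2, by simpa using hs.1⟩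
    simp only [sub_sub_cancel] at h1
    refine (h1 r ⟨h ▸ hπ, hr.2⟩).mono_of_mem_nhdsWithin ?_
    exact mem_nhdsWithin.2 ⟨Ioi 0, isOpen_Ioi, h ▸ hπ, fun s hs => ⟨hs.1, hs.2.2⟩⟩

/-- A radial solution is a twice continuously differentiable function of `cos r`. -/
theorem exists_axial_profile (hf : ∀ x, HasDerivAt f (f' x) x) (hf' : Continuous f')
    (hu : IsRadialSol n f u) (hv : IsRadialSol n f fun r => u (π - r)) :
    ∃ W W₁ W₂ : ℝ → ℝ, (∀ t, HasDerivAt W (W₁ t) t) ∧ (∀ t, HasDerivAt W₁ (W₂ t) t) ∧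
      Continuous W₂ ∧ (∀ t ∈ Icc (-1 : ℝ) 1, W t = u (arccos t)) ∧
      (∀ t ∈ Ioo (-1 : ℝ) 1,
        W₁ t = -(flux n f u (arccos t) / sin (arccos t) ^ (n + 1))) ∧
      ∀ t ∈ Icc (-1 : ℝ) 1, (1 - t ^ 2) * W₂ t - (n + 1) * t * W₁ t = -f (W t) := by
  have hπ := pi_pos
  have hfc : Continuous f := continuous_iff_continuousAt.2 fun x => (hf x).continuousAt
  have hac : ∀ t ∈ Ioo (-1 : ℝ) 1, arccos t ∈ Ioo 0 π := fun t ht =>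
    ⟨arccos_pos.2 ht.2, arccos_lt_pi.2 ht.1⟩
  obtain ⟨l, hl⟩ := hu.tendsto_axialSecond hf hf'
  obtain ⟨m, hm⟩ := hv.tendsto_axialSecond hf hf'
  have hm' : Tendsto (axialSecond n f u) (𝓝[<] π) (𝓝 m) := by
    refine (hm.comp (tendsto_const_sub_nhdsLT π)).congr' ?_
    filter_upwards [Ioo_mem_nhdsLT hπ] with r hr
    rw [Function.comp, axialSecond_reflection hfc hu hv ⟨by linarith [hr.2], by linarith [hr.1]⟩,
      sub_sub_cancel]
  have hcont : ContinuousOn (axialSecond n f u) (Ioo 0 π) := by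
    have h1 := (hu.continuousOn_flux hfc).mono Ioo_subset_Ico_self
    have h2 := (hu.continuousOn_comp hfc).mono Ioo_subset_Ico_self
    refine ContinuousOn.div (((continuousOn_const.mul continuous_cos.continuousOn).mul h1).neg.sub
      ((continuous_sin.pow (n + 1)).continuousOn.mul h2)) (continuous_sin.pow (n + 3)).continuousOn
      fun r hr => (sin_pow_pos hr).ne'
  have hext := continuousOn_Icc_extendFrom_Ioo hcont hl hm'
  set g : ℝ → ℝ := fun t => extendFrom (Ioo 0 π) (axialSecond n f u) (arccos t) with hg
  have hgc : Continuous g := hext.comp_continuous continuous_arccos fun t =>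
    ⟨arccos_nonneg t, arccos_le_pi t⟩
  have hgI : ∀ t ∈ Ioo (-1 : ℝ) 1, g t = axialSecond n f u (arccos t) := fun t ht =>
    extendFrom_eq (subset_closure (hac t ht))
      ((hcont (arccos t) (hac t ht)).tendsto)
  obtain ⟨y, hy⟩ : ∃ y : ℝ → ℝ, y = fun t => u (arccos t) := ⟨_, rfl⟩
  obtain ⟨y₁, hy₁⟩ : ∃ y₁ : ℝ → ℝ,
    y₁ = fun t => -(flux n f u (arccos t) / sin (arccos t) ^ (n + 1)) := ⟨_, rfl⟩
  have hdac : ∀ t ∈ Ioo (-1 : ℝ) 1, HasDerivAt arccos (-(1 / sin (arccos t))) t := by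
    intro t ht
    rw [sin_arccos]
    exact hasDerivAt_arccos ht.1.ne' ht.2.ne
  have hdy : ∀ t ∈ Ioo (-1 : ℝ) 1, HasDerivAt y (y₁ t) t := by
    intro t ht
    have h1 := sin_pos_of_pos_of_lt_pi (hac t ht).1 (hac t ht).2
    rw [hy, hy₁]
    refine ((hu.hasDerivAt hfc (hac t ht)).comp t (hdac t ht)).congr_deriv ?_
    simp only [pow_succ]
    field_simp
  have hdy₁ : ∀ t ∈ Ioo (-1 : ℝ) 1, HasDerivAt y₁ (g t) t := by
    intro t ht
    have h1 := sin_pos_of_pos_of_lt_pi (hac t ht).1 (hac t ht).2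
    have h2 := (((hu.hasDerivAt_flux hfc (hac t ht)).fun_div
      (hasDerivAt_sin_pow_succ n (arccos t)) (by positivity)).comp t (hdac t ht)).fun_neg
    rw [hy₁, hgI t ht]
    refine h2.congr_deriv ?_
    rw [axialSecond]
    simp only [pow_succ]
    field_simp
    ring
  have hyc : Continuous y := by
    rw [hy]
    exact (continuousOn_Icc_of_reflection hu hv).comp_continuous continuous_arccos fun t =>
      ⟨arccos_nonneg t, arccos_le_pi t⟩
  obtain ⟨W, W₁, hdW, hdW₁, hEI, hE₁⟩ := exists_extension_of_second_deriv hgc hyc hdy hdy₁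
  have hWc : Continuous W := continuous_iff_continuousAt.2 fun t => (hdW t).continuousAt
  have hW₁c : Continuous W₁ := continuous_iff_continuousAt.2 fun t => (hdW₁ t).continuousAt
  have hODE : EqOn (fun t => (1 - t ^ 2) * g t - (n + 1) * t * W₁ t) (fun t => -f (W t))
      (Ioo (-1) 1) := by
    intro t ht
    have h1 := sin_pos_of_pos_of_lt_pi (hac t ht).1 (hac t ht).2
    have h2 : cos (arccos t) = t := cos_arccos ht.1.le ht.2.le
    have h3 : 1 - t ^ 2 = sin (arccos t) ^ 2 := by
      rw [sin_sq, h2]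
    simp only [h3, hgI t ht, hE₁ ht, hEI (Ioo_subset_Icc_self ht), hy₁, hy, axialSecond, h2]
    simp only [pow_succ]
    field_simp
    ring
  refine ⟨W, W₁, g, hdW, hdW₁, hgc, fun t ht => by rw [hEI ht, hy],
    fun t ht => by rw [hE₁ ht, hy₁], ?_⟩
  have := hODE.closure (by fun_prop) (by fun_prop)
  rw [closure_Ioo (by norm_num)] at this
  exact this

end

section

/-- Second directional derivatives from second derivatives along a line. -/
lemma iteratedFDeriv_two_of_line {E : Type*} [NormedAddCommGroup E] [NormedSpace ℝ E]
    {U : E → ℝ} {x e : E} (hU : ContDiffAt ℝ 2 U x) {ψ : ℝ → ℝ} {c : ℝ}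
    (hψ : ∀ᶠ s in 𝓝 (0 : ℝ), HasDerivAt (fun s : ℝ => U (x + s • e)) (ψ s) s)
    (hc : HasDerivAt ψ c 0) : iteratedFDeriv ℝ 2 U x ![e, e] = c := by
  have hline : ∀ s : ℝ, HasDerivAt (fun s : ℝ => x + s • e) e s := fun s => by
    simpa using ((hasDerivAt_id s).smul_const e).const_add x
  have hl0 : x + (0 : ℝ) • e = x := by simp
  have h1 : HasFDerivAt (fderiv ℝ U) (fderiv ℝ (fderiv ℝ U) x) (x + (0 : ℝ) • e) := by
    rw [hl0]
    exact ((hU.fderiv_right (m := 1) (by norm_num)).differentiableAt (by norm_num)).hasFDerivAt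
  have h2 : HasDerivAt (fun s : ℝ => fderiv ℝ U (x + s • e) e)
      (fderiv ℝ (fderiv ℝ U) x e e) 0 := by
    have h : HasFDerivAt (fun y => fderiv ℝ U y e)
        ((ContinuousLinearMap.apply ℝ ℝ e).comp (fderiv ℝ (fderiv ℝ U) x)) (x + (0 : ℝ) • e) :=
      (ContinuousLinearMap.apply ℝ ℝ e).hasFDerivAt.comp (x + (0 : ℝ) • e) h1
    exact h.comp_hasDerivAt (0 : ℝ) (hline 0)
  have h3 : ∀ᶠ s in 𝓝 (0 : ℝ), DifferentiableAt ℝ U (x + s • e) := by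
    have h4 : ∀ᶠ y in 𝓝 x, DifferentiableAt ℝ U y :=
      (hU.eventually (by norm_num)).mono fun y hy => hy.differentiableAt (by norm_num)
    have h5 : Tendsto (fun s : ℝ => x + s • e) (𝓝 0) (𝓝 x) := by
      have := (hline 0).continuousAt.tendsto
      rwa [hl0] at this
    exact h5.eventually h4
  have h6 : (fun s : ℝ => fderiv ℝ U (x + s • e) e) =ᶠ[𝓝 0] ψ := by
    filter_upwards [h3, hψ] with s hs hs'
    exact (hs.hasFDerivAt.comp_hasDerivAt s (hline s)).unique hs'
  rw [iteratedFDeriv_two_apply]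
  exact h2.unique (hc.congr_of_eventuallyEq h6)

/-- The derivative of an axial function along a straight line through a point of the sphere. -/
noncomputable def lineDerivAxial (W₁ : ℝ → ℝ) (a b d s : ℝ) : ℝ :=
  W₁ ((√(1 + 2 * s * b + s ^ 2))⁻¹ * (a + s * d)) *
    (d * (√(1 + 2 * s * b + s ^ 2))⁻¹
      - (a + s * d) * (b + s) * ((√(1 + 2 * s * b + s ^ 2))⁻¹) ^ 3)

lemma hasDerivAt_inv_sqrt_line (b : ℝ) {s : ℝ} (hs : 0 < 1 + 2 * s * b + s ^ 2) :
    HasDerivAt (fun s => (√(1 + 2 * s * b + s ^ 2))⁻¹)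
      (-((b + s) * ((√(1 + 2 * s * b + s ^ 2))⁻¹) ^ 3)) s := by
  have h1 : HasDerivAt (fun s : ℝ => 1 + 2 * s * b + s ^ 2) (2 * b + 2 * s) s := by
    have := ((((hasDerivAt_id s).const_mul 2).mul_const b).const_add 1).add
      ((hasDerivAt_id s).fun_pow 2)
    refine this.congr_deriv ?_
    simp
  have h2 : 0 < √(1 + 2 * s * b + s ^ 2) := sqrt_pos.2 hs
  refine ((h1.sqrt hs.ne').fun_inv h2.ne').congr_deriv ?_
  field_simp

lemma eventually_line_pos (b : ℝ) : ∀ᶠ s in 𝓝 (0 : ℝ), 0 < 1 + 2 * s * b + s ^ 2 := by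
  have hc : Continuous fun s : ℝ => 1 + 2 * s * b + s ^ 2 := by fun_prop
  have := hc.tendsto 0
  exact this.eventually (lt_mem_nhds (by norm_num))

lemma hasDerivAt_axial_line {W W₁ : ℝ → ℝ} (hW : ∀ t, HasDerivAt W (W₁ t) t) (a b d : ℝ) {s : ℝ}
    (hs : 0 < 1 + 2 * s * b + s ^ 2) :
    HasDerivAt (fun s => W ((√(1 + 2 * s * b + s ^ 2))⁻¹ * (a + s * d)))
      (lineDerivAxial W₁ a b d s) s := by
  have h1 := (hasDerivAt_inv_sqrt_line b hs).fun_mul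
    (((hasDerivAt_id s).mul_const d).const_add a)
  refine ((hW _).comp s h1).congr_deriv ?_
  rw [lineDerivAxial]
  simp only [id]
  ring

lemma hasDerivAt_lineDerivAxial {W₁ W₂ : ℝ → ℝ} (hW₁ : ∀ t, HasDerivAt W₁ (W₂ t) t)
    (a b d : ℝ) :
    HasDerivAt (lineDerivAxial W₁ a b d)
      (W₂ a * (d - a * b) ^ 2 + W₁ a * (3 * a * b ^ 2 - a - 2 * d * b)) 0 := by
  have h0 : (0 : ℝ) < 1 + 2 * 0 * b + 0 ^ 2 := by norm_num
  have hi := hasDerivAt_inv_sqrt_line b h0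
  have hl : HasDerivAt (fun s : ℝ => a + s * d) d 0 := by
    simpa using ((hasDerivAt_id (0 : ℝ)).mul_const d).const_add a
  have hb : HasDerivAt (fun s : ℝ => b + s) 1 0 := (hasDerivAt_id (0 : ℝ)).const_add b
  have h1 := hasDerivAt_axial_line hW₁ a b d h0
  have h2 := (hi.const_mul d).sub ((hl.fun_mul hb).fun_mul (hi.fun_pow 3))
  refine HasDerivAt.congr_deriv (f := lineDerivAxial W₁ a b d) (h1.mul h2) ?_
  simp [lineDerivAxial]
  ring

variable {N : ℕ}

lemma norm_line {x : EuclideanSpace ℝ (Fin (N + 1))} (hx : ‖x‖ = 1) (i : Fin (N + 1)) (s : ℝ) :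
    ‖x + s • EuclideanSpace.single i (1 : ℝ)‖ = √(1 + 2 * s * x i + s ^ 2) := by
  rw [← sqrt_sq (norm_nonneg (x + s • EuclideanSpace.single i (1 : ℝ))), norm_add_sq_real, hx,
    inner_smul_right, EuclideanSpace.inner_single_right, norm_smul, PiLp.norm_single]
  congr 1
  simp
  ring

lemma contDiffOn_axial {W : ℝ → ℝ} (hW : ContDiff ℝ 2 W) :
    ContDiffOn ℝ 2 (fun x : EuclideanSpace ℝ (Fin (N + 1)) => W ((‖x‖⁻¹ • x) (Fin.last N)))
      {x | x ≠ 0} := by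
  intro x hx
  have h1 : ContDiffAt ℝ 2 (fun x : EuclideanSpace ℝ (Fin (N + 1)) => ‖x‖) x :=
    contDiffAt_norm ℝ hx
  have h2 : ContDiffAt ℝ 2 (fun x : EuclideanSpace ℝ (Fin (N + 1)) => x (Fin.last N)) x := by
    fun_prop
  have h3 := (h1.inv (norm_ne_zero_iff.2 hx)).mul h2
  exact (hW.contDiffAt.comp x h3).contDiffWithinAt

/-- The Laplace–Beltrami operator on axially symmetric functions. -/
theorem sphLaplacian_axial {W W₁ W₂ : ℝ → ℝ} (hW : ∀ t, HasDerivAt W (W₁ t) t)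
    (hW₁ : ∀ t, HasDerivAt W₁ (W₂ t) t) (hW₂ : ContDiff ℝ 2 W)
    {x : EuclideanSpace ℝ (Fin (N + 1))} (hx : ‖x‖ = 1) :
    sphLaplacian (fun y => W (y (Fin.last N))) x
      = (1 - x (Fin.last N) ^ 2) * W₂ (x (Fin.last N))
        - N * x (Fin.last N) * W₁ (x (Fin.last N)) := by
  have hx0 : x ≠ 0 := by rintro rfl; simp at hx
  have hC : ContDiffAt ℝ 2
      (fun x : EuclideanSpace ℝ (Fin (N + 1)) => W ((‖x‖⁻¹ • x) (Fin.last N))) x :=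
    (contDiffOn_axial hW₂).contDiffAt (isOpen_ne.mem_nhds hx0)
  obtain ⟨d, hd⟩ : ∃ d : Fin (N + 1) → ℝ,
    d = fun i => (EuclideanSpace.single i (1 : ℝ) : EuclideanSpace ℝ (Fin (N + 1))) (Fin.last N) :=
    ⟨_, rfl⟩
  have hterm : ∀ i, iteratedFDeriv ℝ 2
      (fun x : EuclideanSpace ℝ (Fin (N + 1)) => W ((‖x‖⁻¹ • x) (Fin.last N))) x
      ![EuclideanSpace.single i 1, EuclideanSpace.single i 1] =
      W₂ (x (Fin.last N)) * (d i - x (Fin.last N) * x i) ^ 2 + W₁ (x (Fin.last N)) *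
        (3 * x (Fin.last N) * x i ^ 2 - x (Fin.last N) - 2 * d i * x i) := by
    intro i
    refine iteratedFDeriv_two_of_line hC (ψ := lineDerivAxial W₁ (x (Fin.last N)) (x i) (d i)) ?_
      (hasDerivAt_lineDerivAxial hW₁ _ _ _)
    filter_upwards [eventually_line_pos (x i)] with s hs
    refine (hasDerivAt_axial_line hW (x (Fin.last N)) (x i) (d i) hs).congr_of_eventuallyEq ?_
    refine Eventually.of_forall fun s => ?_
    simp only [norm_line hx, hd, PiLp.smul_apply, PiLp.add_apply, smul_eq_mul]
  have hd' : ∀ i, d i = if i = Fin.last N then 1 else 0 := by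
    intro i
    rw [hd]
    simp [eq_comm]
  have hsum : ∑ i, x i ^ 2 = 1 := by
    have := EuclideanSpace.real_norm_sq_eq x
    rw [hx] at this
    linarith
  have hS1 : ∑ i, (d i - x (Fin.last N) * x i) ^ 2 = 1 - x (Fin.last N) ^ 2 := by
    have h : ∀ i, (d i - x (Fin.last N) * x i) ^ 2 = (if i = Fin.last N then 1 else 0)
        - (if i = Fin.last N then 2 * x (Fin.last N) * x i else 0)
        + x (Fin.last N) ^ 2 * x i ^ 2 := by
      intro i
      rw [hd']
      split_ifs <;> ring
    simp only [h, Finset.sum_add_distrib, Finset.sum_sub_distrib, ← Finset.mul_sum, hsum,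
      Finset.sum_ite_eq', Finset.mem_univ, if_true]
    ring
  have hS2 : ∑ i, (3 * x (Fin.last N) * x i ^ 2 - x (Fin.last N) - 2 * d i * x i)
      = -(N * x (Fin.last N)) := by
    have h : ∀ i, 3 * x (Fin.last N) * x i ^ 2 - x (Fin.last N) - 2 * d i * x i
        = 3 * x (Fin.last N) * x i ^ 2 - x (Fin.last N)
          - (if i = Fin.last N then 2 * x i else 0) := by
      intro i
      rw [hd']
      split_ifs <;> ring
    simp only [h, Finset.sum_sub_distrib, ← Finset.mul_sum, hsum, Finset.sum_const,
      Finset.sum_ite_eq', Finset.mem_univ, if_true, Finset.card_univ, Fintype.card_fin,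
      nsmul_eq_mul]
    push_cast
    ring
  rw [sphLaplacian, eLaplacian, Finset.sum_congr rfl fun i _ => hterm i, Finset.sum_add_distrib,
    ← Finset.mul_sum, ← Finset.mul_sum, hS1, hS2]
  ring

end

lemma exists_mem_sphere_last {N : ℕ} (hN : 1 ≤ N) {t : ℝ} (ht : t ∈ Icc (-1 : ℝ) 1) :
    ∃ x ∈ Metric.sphere (0 : EuclideanSpace ℝ (Fin (N + 1))) 1, x (Fin.last N) = t := by
  have h0 : (0 : Fin (N + 1)) ≠ Fin.last N := by
    intro h
    have := congrArg Fin.val h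
    simp at this
    omega
  refine ⟨EuclideanSpace.single 0 (√(1 - t ^ 2)) + EuclideanSpace.single (Fin.last N) t, ?_, ?_⟩
  · have h1 : 0 ≤ 1 - t ^ 2 := by nlinarith [ht.1, ht.2]
    rw [mem_sphere_zero_iff_norm, ← sq_eq_sq₀ (norm_nonneg _) zero_le_one, norm_add_sq_real,
      EuclideanSpace.inner_single_left, PiLp.norm_single, PiLp.norm_single,
      Real.norm_eq_abs, Real.norm_eq_abs, sq_abs, sq_abs, sq_sqrt h1]
    simp [h0]
  · simp [h0.symm]

lemma last_mem_Icc {N : ℕ} {x : EuclideanSpace ℝ (Fin (N + 1))}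
    (hx : x ∈ Metric.sphere (0 : EuclideanSpace ℝ (Fin (N + 1))) 1) :
    x (Fin.last N) ∈ Icc (-1 : ℝ) 1 := by
  have h := PiLp.norm_apply_le x (Fin.last N)
  rw [mem_sphere_zero_iff_norm.1 hx, Real.norm_eq_abs] at h
  exact abs_le.1 h

/-- Axial solutions as functions of the last coordinate. -/
theorem exists_axial_solution {n : ℕ} (hn : 1 ≤ n) {p lam : ℝ} (hp : 1 < p) (hlam : 0 < lam)
    (hsub : p * ((n : ℝ) - 1) < n + 3) {j k : ℕ} (hj : 1 ≤ j) (hjk : j ≤ k)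
    (hk : (k : ℝ) * (k + n) < (p - 1) * lam) :
    ∃ W W₁ W₂ : ℝ → ℝ, (∀ t, HasDerivAt W (W₁ t) t) ∧ (∀ t, HasDerivAt W₁ (W₂ t) t) ∧
      ContDiff ℝ 2 W ∧ (∀ t ∈ Icc (-1 : ℝ) 1, 0 < W t) ∧
      (∀ t ∈ Icc (-1 : ℝ) 1, (1 - t ^ 2) * W₂ t - (n + 1) * t * W₁ t = -(W t ^ p - lam * W t)) ∧
      W 1 ≠ lam ^ ((1 : ℝ) / (p - 1)) ∧
      ∃ Z : Finset ℝ, Z.card = j ∧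
        (∀ t ∈ Icc (-1 : ℝ) 1, W t - lam ^ ((1 : ℝ) / (p - 1)) = 0 ↔ t ∈ Z) ∧
        ∀ t ∈ Z, t ∈ Ioo (-1 : ℝ) 1 ∧ deriv W t ≠ 0 := by
  obtain ⟨u, hu, hv, hpos, hu0, huπ, Z, hZ, hfl, hcard⟩ :=
    exists_powTerm_solution hn hp hlam hsub hj hjk hk
  have hf' : Continuous fun x : ℝ => p * x ^ (p - 1) - lam :=
    (continuous_const.mul (continuous_rpow_const (by linarith))).sub continuous_const
  obtain ⟨W, W₁, W₂, hW, hW₁, hW₂, hWu, hWfl, hode⟩ :=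
    exists_axial_profile (hasDerivAt_powTerm hp) hf' hu hv
  have hcos : InjOn cos Z := injOn_cos.mono fun r hr => Ioo_subset_Icc_self ((hZ r).1 hr).1
  have hmem : ∀ t ∈ Ioo (-1 : ℝ) 1, arccos t ∈ Ioo 0 π := fun t ht =>
    ⟨arccos_pos.2 ht.2, arccos_lt_pi.2 ht.1⟩
  have hC : ContDiff ℝ 2 W := by
    have hd : deriv W = W₁ := funext fun t => (hW t).deriv
    have hd₁ : deriv W₁ = W₂ := funext fun t => (hW₁ t).deriv
    rw [show (2 : WithTop ℕ∞) = 1 + 1 by norm_num, contDiff_succ_iff_deriv]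
    refine ⟨fun t => (hW t).differentiableAt, by simp, ?_⟩
    rw [hd, contDiff_one_iff_deriv, hd₁]
    exact ⟨fun t => (hW₁ t).differentiableAt, hW₂⟩
  have hZ' : ∀ t ∈ Z.image cos, t ∈ Ioo (-1 : ℝ) 1 ∧ arccos t ∈ Z := by
    intro t ht
    obtain ⟨r, hr, rfl⟩ := Finset.mem_image.1 ht
    have h1 := ((hZ r).1 hr).1
    rw [arccos_cos h1.1.le h1.2.le]
    refine ⟨⟨?_, ?_⟩, hr⟩
    · rw [← cos_pi]
      exact cos_lt_cos_of_nonneg_of_le_pi h1.1.le le_rfl h1.2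
    · rw [← cos_zero]
      exact cos_lt_cos_of_nonneg_of_le_pi le_rfl h1.2.le h1.1
  refine ⟨W, W₁, W₂, hW, hW₁, hC, fun t ht => ?_, fun t ht => hode t ht, ?_, Z.image cos, ?_,
    fun t ht => ⟨fun h => ?_, fun h => ?_⟩, fun t ht => ⟨(hZ' t ht).1, ?_⟩⟩
  · rw [hWu t ht]
    exact hpos _ ⟨arccos_nonneg t, arccos_le_pi t⟩
  · rw [hWu 1 (by simp), arccos_one]
    exact hu0
  · rw [Finset.card_image_of_injOn hcos, hcard]
  · rw [sub_eq_zero, hWu t ht] at h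
    have h1 : -1 ≠ t := by
      rintro rfl
      rw [arccos_neg_one] at h
      exact huπ h
    have h2 : t ≠ 1 := by
      rintro rfl
      rw [arccos_one] at h
      exact hu0 h
    have ht' : t ∈ Ioo (-1 : ℝ) 1 := ⟨lt_of_le_of_ne ht.1 h1, lt_of_le_of_ne ht.2 h2⟩
    exact Finset.mem_image.2 ⟨arccos t, (hZ _).2 ⟨hmem t ht', h⟩, cos_arccos ht.1 ht.2⟩
  · rw [sub_eq_zero, hWu t ht]
    exact ((hZ _).1 (hZ' t h).2).2
  · obtain ⟨h1, h2⟩ := hZ' t ht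
    have h3 := sin_pos_of_pos_of_lt_pi (hmem t h1).1 (hmem t h1).2
    rw [(hW t).deriv, hWfl t h1]
    exact neg_ne_zero.2 (div_ne_zero (hfl _ h2) (by positivity))

end SphereShooting

theorem stmt8 (N : ℕ) (hN : 2 ≤ N) (p : ℝ) (hp1 : 1 < p)
    (hp2 : 3 ≤ N → p < ((N : ℝ) + 2) / ((N : ℝ) - 2))
    (k : ℕ) (hk : 1 ≤ k) (lam : ℝ)
    (hlam1 : ((k : ℝ) * ((k : ℝ) + (N : ℝ) - 1)) / (p - 1) < lam)
    (hlam2 : lam ≤ (((k : ℝ) + 1) * (((k : ℝ) + 1) + (N : ℝ) - 1)) / (p - 1)) :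
    ∃ v : Fin k → (EuclideanSpace ℝ (Fin (N + 1)) → ℝ),
      (∀ i j : Fin k, i ≠ j →
        ∃ θ ∈ Metric.sphere (0 : EuclideanSpace ℝ (Fin (N + 1))) 1, v i θ ≠ v j θ) ∧
      ∀ j : Fin k,
        ContDiffOn ℝ 2 (fun x => v j (‖x‖⁻¹ • x)) {x | x ≠ 0} ∧
        (∀ θ ∈ Metric.sphere (0 : EuclideanSpace ℝ (Fin (N + 1))) 1, 0 < v j θ) ∧
        (¬ ∀ θ ∈ Metric.sphere (0 : EuclideanSpace ℝ (Fin (N + 1))) 1,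
            ∀ θ' ∈ Metric.sphere (0 : EuclideanSpace ℝ (Fin (N + 1))) 1, v j θ = v j θ') ∧
        (∀ θ ∈ Metric.sphere (0 : EuclideanSpace ℝ (Fin (N + 1))) 1,
          -(sphLaplacian (v j) θ) = v j θ ^ p - lam * v j θ) ∧
        ∃ vt : ℝ → ℝ,
          (∀ θ ∈ Metric.sphere (0 : EuclideanSpace ℝ (Fin (N + 1))) 1,
            v j θ = vt (θ (Fin.last N))) ∧
          ∃ Z : Finset ℝ, Z.card = (j : ℕ) + 1 ∧
            (∀ t ∈ Set.Icc (-1 : ℝ) 1,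
              (vt t - lam ^ ((1 : ℝ) / (p - 1)) = 0 ↔ t ∈ Z)) ∧
            (∀ t ∈ Z, t ∈ Set.Ioo (-1 : ℝ) 1 ∧ deriv vt t ≠ 0) := by
  obtain ⟨n, rfl⟩ : ∃ n, N = n + 1 := ⟨N - 1, by omega⟩
  have hn : 1 ≤ n := by omega
  have hp0 : 0 < p - 1 := by linarith
  have hlam : 0 < lam := by
    refine lt_of_le_of_lt (div_nonneg (mul_nonneg (by positivity) ?_) hp0.le) hlam1
    push_cast
    linarith [(Nat.cast_nonneg k : (0 : ℝ) ≤ k), (Nat.cast_nonneg n : (0 : ℝ) ≤ n)]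
  have hsub : p * ((n : ℝ) - 1) < n + 3 := by
    rcases hn.eq_or_lt with h | h
    · rw [← h]; norm_num
    · have h1 := hp2 (by omega)
      have h2 : (2 : ℝ) ≤ n := by exact_mod_cast h
      rw [lt_div_iff₀ (by push_cast; linarith)] at h1
      push_cast at h1
      linarith
  have hk' : (k : ℝ) * (k + n) < (p - 1) * lam := by
    rw [div_lt_iff₀ hp0] at hlam1
    push_cast at hlam1
    linarith
  choose W W₁ W₂ hW hW₁ hC hpos hode hone Z hcard hZ hZ' using fun j : Fin k =>
    SphereShooting.exists_axial_solution hn hp1 hlam hsub (j := (j : ℕ) + 1) (by omega)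
      (by omega) hk'
  refine ⟨fun j x => W j (x (Fin.last (n + 1))), fun i j hij => ?_, fun j => ⟨?_, ?_, ?_, ?_, W j,
    fun _ _ => rfl, Z j, hcard j, hZ j, hZ' j⟩⟩
  · by_contra! hc
    have heq : ∀ t ∈ Set.Icc (-1 : ℝ) 1, W i t = W j t := by
      intro t ht
      obtain ⟨x, hx, rfl⟩ := SphereShooting.exists_mem_sphere_last (N := n + 1) (by omega) ht
      exact hc x hx
    have hZeq : Z i = Z j := by
      ext t
      constructor
      · intro h
        have ht := Set.Ioo_subset_Icc_self (hZ' i t h).1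
        rw [← hZ j t ht, ← heq t ht, hZ i t ht]
        exact h
      · intro h
        have ht := Set.Ioo_subset_Icc_self (hZ' j t h).1
        rw [← hZ i t ht, heq t ht, hZ j t ht]
        exact h
    have h := hcard i
    rw [hZeq, hcard j] at h
    exact hij (Fin.ext (by omega))
  · exact SphereShooting.contDiffOn_axial (hC j)
  · exact fun θ hθ => hpos j _ (SphereShooting.last_mem_Icc hθ)
  · intro hconst
    obtain ⟨t, ht⟩ : (Z j).Nonempty := Finset.card_pos.1 (by rw [hcard j]; omega)
    have htI := Set.Ioo_subset_Icc_self (hZ' j t ht).1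
    obtain ⟨x, hx, hxt⟩ := SphereShooting.exists_mem_sphere_last (N := n + 1) (by omega) htI
    obtain ⟨y, hy, hyt⟩ := SphereShooting.exists_mem_sphere_last (N := n + 1) (t := 1) (by omega)
      (by simp)
    have h := hconst x hx y hy
    simp only [hxt, hyt] at h
    exact hone j (h ▸ sub_eq_zero.1 ((hZ j t htI).2 ht))
  · intro θ hθ
    rw [SphereShooting.sphLaplacian_axial (hW j) (hW₁ j) (hC j) (mem_sphere_zero_iff_norm.1 hθ)]
    have h := hode j _ (SphereShooting.last_mem_Icc hθ)
    push_cast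
    rw [h, neg_neg]
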